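/- arXiv:2112.01861 — 4 statements merged into one kernel-verified Lean document; each statement's English description precedes it below -/
import Mathlib

section
/- For every u ∈ C²(Ω̄) and every λ > 0 the following pointwise identity holds on Ω: θ(u_{xx} + p u)·I₁ = I₁² + (−λμ v_x² − λ³μ³ v² + 2λ²μ v²)_x + 2λ v_x² + 6λ³μ² v² − 4λ² v² − 2λμ p v v_x, where v = θu and I₁ = −2λμ v_x. -/
open Real Set

/-- Pointwise multiplier identity for the operator `u ↦ u'' + p u` on `Ω = (0,1)`
with weight `θ = e^{λΦ}`, `Φ(x) = |x - x₀|²`, `μ(x) = 2(x - x₀)`, `v = θ u`,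
`I₁ = -2λμ v_x`. -/
theorem pointwise_identity_second_order
    (p : ℝ → ℝ) (x₀ : ℝ) (hx₀ : x₀ ∉ Icc (0:ℝ) 1)
    (lam : ℝ) (hlam : 0 < lam) (u : ℝ → ℝ) (hu : ContDiff ℝ 2 u) :
    ∀ x ∈ Ioo (0:ℝ) 1,
      let μ : ℝ → ℝ := fun y => 2 * (y - x₀)
      let θ : ℝ → ℝ := fun y => exp (lam * (y - x₀) ^ 2)
      let v : ℝ → ℝ := fun y => θ y * u y
      let I₁ : ℝ → ℝ := fun y => -2 * lam * μ y * deriv v y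
      θ x * (iteratedDeriv 2 u x + p x * u x) * I₁ x =
        I₁ x ^ 2 +
        deriv (fun y => -lam * μ y * (deriv v y) ^ 2 - lam ^ 3 * μ y ^ 3 * v y ^ 2
            + 2 * lam ^ 2 * μ y * v y ^ 2) x +
        2 * lam * (deriv v x) ^ 2 + 6 * lam ^ 3 * μ x ^ 2 * v x ^ 2
          - 4 * lam ^ 2 * v x ^ 2 - 2 * lam * μ x * p x * v x * deriv v x := by
  intro x _ μ θ v I₁
  have hu₁ : ∀ y, HasDerivAt u (deriv u y) y := fun y =>
    (hu.differentiable (by norm_num) y).hasDerivAt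
  have hu₂ : HasDerivAt (deriv u) (iteratedDeriv 2 u x) x := by
    have h := hu.differentiable_iteratedDeriv 1 (by norm_num)
    rw [iteratedDeriv_one] at h
    rw [iteratedDeriv_succ, iteratedDeriv_one]
    exact (h x).hasDerivAt
  have hμ : ∀ y, HasDerivAt μ 2 y := fun y => by
    simpa [μ] using ((hasDerivAt_id y).sub_const x₀).const_mul 2
  have hθ : ∀ y, HasDerivAt θ (lam * μ y * θ y) y := fun y => by
    have h := ((((hasDerivAt_id y).sub_const x₀).pow 2).const_mul lam).exp
    refine h.congr_deriv ?_
    simp [μ, θ]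
    ring
  have hv : ∀ y, HasDerivAt v (θ y * (lam * μ y * u y + deriv u y)) y := fun y =>
    ((hθ y).mul (hu₁ y)).congr_deriv (by ring)
  have hdv : deriv v = fun y => θ y * (lam * μ y * u y + deriv u y) :=
    funext fun y => (hv y).deriv
  have hv₂ : HasDerivAt (deriv v) (lam * μ x * θ x * (lam * μ x * u x + deriv u x)
      + θ x * (lam * 2 * u x + lam * μ x * deriv u x + iteratedDeriv 2 u x)) x := by
    rw [hdv]
    exact (hθ x).mul ((((hμ x).const_mul lam).mul (hu₁ x)).add hu₂)
  have hflux := ((((hμ x).const_mul (-lam)).mul (hv₂.pow 2)).sub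
    ((((hμ x).pow 3).const_mul (lam ^ 3)).mul ((hv x).pow 2))).add
    (((hμ x).const_mul (2 * lam ^ 2)).mul ((hv x).pow 2))
  have hflux' := hflux.deriv
  simp only [Pi.add_def, Pi.sub_def, Pi.mul_def, Pi.pow_def] at hflux'
  rw [hflux']
  have hvx : v x = θ x * u x := rfl
  have hI : I₁ x = -2 * lam * μ x * deriv v x := rfl
  rw [hI, (hv x).deriv, hvx]
  clear_value μ θ v I₁
  push_cast
  ring
end

section
/- For any ε with (x₀−L)² < ε < x₀², any c ∈ (0, ε), and any v ∈ H^{(1,4)}(Q_c) (one time derivative and four space derivatives square-integrable) with supp v ⊂ Q_ε, there exists λ₀ > 0 and C > 0 such that for all λ > λ₀: ∫_{Q_c} e^{2λψ} ( λ⁷|v|² + λ⁵|∂_x v|² + λ³|∂_x² v|² + λ|∂_x³ v|² ) dx dt ≤ C ∫_{Q_c} e^{2λψ} |γ∂_t v + ∂_x⁴ v|² dx dt. -/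
open MeasureTheory Real Set

/-- `f` is of class `C^n` on the plane and has compact support. -/
structure IsTest (n : ℕ) (f : ℝ × ℝ → ℝ) : Prop where
  contDiff : ContDiff ℝ n f
  hasCompactSupport : HasCompactSupport f

/-- The derivative of `f` in the direction `e`. -/
noncomputable def dirDeriv (e : ℝ × ℝ) (f : ℝ × ℝ → ℝ) (p : ℝ × ℝ) : ℝ := fderiv ℝ f p e

/-- The operator `∂_x - b (x - a)`. -/
noncomputable def conjDeriv (b a : ℝ) (f : ℝ × ℝ → ℝ) (p : ℝ × ℝ) : ℝ :=
  dirDeriv (0, 1) f p - b * (p.2 - a) * f p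

/-- The formal adjoint `-∂_x - b (x - a)` of `conjDeriv b a`. -/
noncomputable def conjDerivAdj (b a : ℝ) (f : ℝ × ℝ → ℝ) (p : ℝ × ℝ) : ℝ :=
  -dirDeriv (0, 1) f p - b * (p.2 - a) * f p

lemma integral_sq_nonneg (f : ℝ × ℝ → ℝ) : 0 ≤ ∫ p, f p ^ 2 :=
  integral_nonneg fun p => sq_nonneg (f p)

lemma contDiff_dirDeriv {n : ℕ} {f : ℝ × ℝ → ℝ} (e : ℝ × ℝ) (hf : ContDiff ℝ (n + 1 : ℕ) f) :
    ContDiff ℝ n (dirDeriv e f) :=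
  (hf.fderiv_right (m := n) (by norm_cast)).clm_apply contDiff_const

lemma dirDeriv_mul {e : ℝ × ℝ} {f g : ℝ × ℝ → ℝ} {p : ℝ × ℝ} (hf : DifferentiableAt ℝ f p)
    (hg : DifferentiableAt ℝ g p) :
    dirDeriv e (fun q => f q * g q) p = dirDeriv e f p * g p + f p * dirDeriv e g p := by
  simp only [dirDeriv]
  rw [fderiv_fun_mul hf hg]
  simp only [add_apply, smul_apply, smul_eq_mul]
  ring

lemma hasFDerivAt_linearWeight (b a : ℝ) (p : ℝ × ℝ) :
    HasFDerivAt (fun q : ℝ × ℝ => b * (q.2 - a)) (b • ContinuousLinearMap.snd ℝ ℝ ℝ) p :=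
  (hasFDerivAt_snd.sub_const a).const_mul b

lemma dirDeriv_weight_mul {e : ℝ × ℝ} (b a : ℝ) {f : ℝ × ℝ → ℝ} {p : ℝ × ℝ}
    (hf : DifferentiableAt ℝ f p) :
    dirDeriv e (fun q => b * (q.2 - a) * f q) p
      = b * e.2 * f p + b * (p.2 - a) * dirDeriv e f p := by
  rw [dirDeriv_mul (f := fun q : ℝ × ℝ => b * (q.2 - a))
    (hasFDerivAt_linearWeight b a p).differentiableAt hf]
  simp [dirDeriv, (hasFDerivAt_linearWeight b a p).fderiv]

lemma dirDeriv_conjDeriv {e : ℝ × ℝ} (b a : ℝ) {f : ℝ × ℝ → ℝ} (hf : ContDiff ℝ 2 f)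
    (p : ℝ × ℝ) :
    dirDeriv e (conjDeriv b a f) p = dirDeriv e (dirDeriv (0, 1) f) p
      - (b * e.2 * f p + b * (p.2 - a) * dirDeriv e f p) := by
  have h1 : Differentiable ℝ (dirDeriv (0, 1) f) :=
    (contDiff_dirDeriv (n := 1) _ hf).differentiable (by norm_num)
  have h0 : Differentiable ℝ f := hf.differentiable (by norm_num)
  rw [← dirDeriv_weight_mul b a (h0 p)]
  change fderiv ℝ (fun q => dirDeriv (0, 1) f q - b * (q.2 - a) * f q) p e = _
  rw [fderiv_fun_sub (h1 p)
    ((hasFDerivAt_linearWeight b a p).differentiableAt.fun_mul (h0 p))]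
  rfl

lemma dirDeriv_conjDerivAdj {e : ℝ × ℝ} (b a : ℝ) {f : ℝ × ℝ → ℝ} (hf : ContDiff ℝ 2 f)
    (p : ℝ × ℝ) :
    dirDeriv e (conjDerivAdj b a f) p = -dirDeriv e (dirDeriv (0, 1) f) p
      - (b * e.2 * f p + b * (p.2 - a) * dirDeriv e f p) := by
  have h1 : Differentiable ℝ (dirDeriv (0, 1) f) :=
    (contDiff_dirDeriv (n := 1) _ hf).differentiable (by norm_num)
  have h0 : Differentiable ℝ f := hf.differentiable (by norm_num)
  rw [← dirDeriv_weight_mul b a (h0 p)]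
  change fderiv ℝ (fun q => -dirDeriv (0, 1) f q - b * (q.2 - a) * f q) p e = _
  rw [fderiv_fun_sub (h1 p).fun_neg
    ((hasFDerivAt_linearWeight b a p).differentiableAt.fun_mul (h0 p)), fderiv_fun_neg]
  rfl

lemma conjDerivAdj_conjDeriv (b a : ℝ) {f : ℝ × ℝ → ℝ} (hf : ContDiff ℝ 2 f) (p : ℝ × ℝ) :
    conjDerivAdj b a (conjDeriv b a f) p
      = conjDeriv b a (conjDerivAdj b a f) p + 2 * b * f p := by
  rw [conjDerivAdj, dirDeriv_conjDeriv b a hf, conjDeriv, conjDeriv, dirDeriv_conjDerivAdj b a hf,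
    conjDerivAdj]
  ring

lemma conjDeriv_add_const_mul (b a c : ℝ) {f g : ℝ × ℝ → ℝ} (hf : Differentiable ℝ f)
    (hg : Differentiable ℝ g) :
    conjDeriv b a (fun q => f q + c * g q)
      = fun p => conjDeriv b a f p + c * conjDeriv b a g p := by
  funext p
  simp only [conjDeriv, dirDeriv]
  rw [fderiv_fun_add (hf p) ((hg p).const_mul c), fderiv_const_mul (hg p)]
  simp only [add_apply, smul_apply, smul_eq_mul]
  ring

lemma dirDeriv_comm {f : ℝ × ℝ → ℝ} (hf : ContDiff ℝ 2 f) (e e' : ℝ × ℝ) (p : ℝ × ℝ) :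
    dirDeriv e (dirDeriv e' f) p = dirDeriv e' (dirDeriv e f) p := by
  have h : DifferentiableAt ℝ (fderiv ℝ f) p :=
    ((hf.fderiv_right (m := 1) (by norm_num)).differentiable (by norm_num)) p
  have key : ∀ d d' : ℝ × ℝ, dirDeriv d (dirDeriv d' f) p = fderiv ℝ (fderiv ℝ f) p d d' := by
    intro d d'
    have := (h.hasFDerivAt.clm_apply (hasFDerivAt_const d' p)).fderiv
    change fderiv ℝ (fun q => fderiv ℝ f q d') p d = _
    rw [this]
    simp
  rw [key, key]
  exact (hf.contDiffAt.isSymmSndFDerivAt (by simp)) e e'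

lemma dirDeriv_time_conjDeriv (b a : ℝ) {f : ℝ × ℝ → ℝ} (hf : ContDiff ℝ 2 f) :
    dirDeriv (1, 0) (conjDeriv b a f) = conjDeriv b a (dirDeriv (1, 0) f) := by
  funext p
  rw [dirDeriv_conjDeriv b a hf, conjDeriv, dirDeriv_comm hf]
  ring

lemma dirDeriv_time_conjDerivAdj (b a : ℝ) {f : ℝ × ℝ → ℝ} (hf : ContDiff ℝ 2 f) :
    dirDeriv (1, 0) (conjDerivAdj b a f) = conjDerivAdj b a (dirDeriv (1, 0) f) := by
  funext p
  rw [dirDeriv_conjDerivAdj b a hf, conjDerivAdj, dirDeriv_comm hf]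
  ring

namespace IsTest

variable {n : ℕ} {f g : ℝ × ℝ → ℝ}

lemma of_le {m : ℕ} (hf : IsTest n f) (h : m ≤ n) : IsTest m f :=
  ⟨hf.contDiff.of_le (by exact_mod_cast h), hf.hasCompactSupport⟩

lemma differentiable (hf : IsTest (n + 1) f) : Differentiable ℝ f :=
  hf.contDiff.differentiable (by simp)

lemma dirDeriv (hf : IsTest (n + 1) f) (e : ℝ × ℝ) : IsTest n (dirDeriv e f) :=
  ⟨contDiff_dirDeriv e hf.contDiff, hf.hasCompactSupport.fderiv_apply ℝ e⟩

lemma mul_left (hf : IsTest n f) {h : ℝ × ℝ → ℝ} (hh : ContDiff ℝ n h) :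
    IsTest n (fun p => h p * f p) :=
  ⟨hh.mul hf.contDiff, hf.hasCompactSupport.mul_left⟩

lemma add (hf : IsTest n f) (hg : IsTest n g) : IsTest n (fun p => f p + g p) :=
  ⟨hf.contDiff.add hg.contDiff, hf.hasCompactSupport.add hg.hasCompactSupport⟩

lemma conjDeriv (hf : IsTest (n + 1) f) (b a : ℝ) : IsTest n (conjDeriv b a f) := by
  have h := (hf.dirDeriv (0, 1)).add ((hf.of_le n.le_succ).mul_left
    (h := fun p => -(b * (p.2 - a))) (by fun_prop))
  convert h using 2
  simp only [_root_.conjDeriv]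
  ring

lemma conjDerivAdj (hf : IsTest (n + 1) f) (b a : ℝ) : IsTest n (conjDerivAdj b a f) := by
  have h := ((hf.dirDeriv (0, 1)).mul_left (h := fun _ => -1) contDiff_const).add
    ((hf.of_le n.le_succ).mul_left (h := fun p => -(b * (p.2 - a))) (by fun_prop))
  convert h using 2
  simp only [_root_.conjDerivAdj]
  ring

lemma conjDeriv_iterate (b a : ℝ) : ∀ (k : ℕ) {n : ℕ} {f : ℝ × ℝ → ℝ}, IsTest (n + k) f →
    IsTest n ((_root_.conjDeriv b a)^[k] f)
  | 0, _, _, hf => hf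
  | k + 1, n, _, hf => conjDeriv_iterate b a k (IsTest.conjDeriv (n := n + k) hf b a)

lemma integrable_mul (hf : IsTest n f) (hg : IsTest n g) : Integrable (fun p => f p * g p) :=
  (hf.contDiff.continuous.mul hg.contDiff.continuous).integrable_of_hasCompactSupport
    hf.hasCompactSupport.mul_right

lemma integrable_sq (hf : IsTest n f) : Integrable (fun p => f p ^ 2) := by
  simpa only [sq] using hf.integrable_mul hf

lemma integral_mul_dirDeriv (hf : IsTest 1 f) (hg : IsTest 1 g) (e : ℝ × ℝ) :
    ∫ p, f p * _root_.dirDeriv e g p = -∫ p, _root_.dirDeriv e f p * g p :=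
  integral_mul_fderiv_eq_neg_fderiv_mul_of_integrable
    ((IsTest.dirDeriv (n := 0) hf e).integrable_mul (hg.of_le zero_le_one))
    ((hf.of_le zero_le_one).integrable_mul (IsTest.dirDeriv (n := 0) hg e))
    (hf.integrable_mul hg)
    (fun p _ => hf.differentiable p) (fun p _ => hg.differentiable p)

lemma integral_conjDeriv_mul (b a : ℝ) (hf : IsTest 1 f) (hg : IsTest 1 g) :
    ∫ p, _root_.conjDeriv b a f p * g p = ∫ p, f p * _root_.conjDerivAdj b a g p := by
  have hg0 := hg.of_le zero_le_one
  have hf0 := hf.of_le zero_le_one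
  have i1 := (IsTest.dirDeriv (n := 0) hf (0, 1)).integrable_mul hg0
  have i2 := hf0.integrable_mul (IsTest.dirDeriv (n := 0) hg (0, 1))
  have i3 := (hf0.mul_left (h := fun p => b * (p.2 - a)) (by fun_prop)).integrable_mul hg0
  have e1 : ∫ p, _root_.conjDeriv b a f p * g p
      = (∫ p, _root_.dirDeriv (0, 1) f p * g p) - ∫ p, b * (p.2 - a) * f p * g p := by
    rw [← integral_sub i1 i3]
    congr 1 with p
    simp only [_root_.conjDeriv]
    ring
  have e2 : ∫ p, f p * _root_.conjDerivAdj b a g p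
      = -(∫ p, f p * _root_.dirDeriv (0, 1) g p) - ∫ p, b * (p.2 - a) * f p * g p := by
    rw [← integral_neg, ← integral_sub i2.fun_neg i3]
    congr 1 with p
    simp only [_root_.conjDerivAdj]
    ring
  rw [e1, e2, hf.integral_mul_dirDeriv hg]
  ring

lemma integral_sq_conjDeriv (b a : ℝ) (hf : IsTest 1 f) :
    ∫ p, _root_.conjDeriv b a f p ^ 2
      = (∫ p, _root_.conjDerivAdj b a f p ^ 2) + 2 * b * ∫ p, f p ^ 2 := by
  have hf0 := hf.of_le zero_le_one
  have hsf : IsTest 1 (fun p => b * (p.2 - a) * f p) := hf.mul_left (by fun_prop)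
  have hI := (IsTest.conjDerivAdj (n := 0) hf b a).integrable_sq
  have i1 := (hsf.of_le zero_le_one).integrable_mul (IsTest.dirDeriv (n := 0) hf (0, 1))
  have key := hsf.integral_mul_dirDeriv hf (0, 1)
  have e1 : ∫ p, _root_.dirDeriv (0, 1) (fun q => b * (q.2 - a) * f q) p * f p
      = b * (∫ p, f p ^ 2) + ∫ p, b * (p.2 - a) * f p * _root_.dirDeriv (0, 1) f p := by
    rw [← integral_const_mul, ← integral_add (hf0.integrable_sq.const_mul b) i1]
    congr 1 with p
    rw [dirDeriv_weight_mul b a (hf.differentiable p)]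
    ring
  have e2 : ∫ p, _root_.conjDeriv b a f p ^ 2 = (∫ p, _root_.conjDerivAdj b a f p ^ 2)
      + -4 * ∫ p, b * (p.2 - a) * f p * _root_.dirDeriv (0, 1) f p := by
    rw [← integral_const_mul, ← integral_add hI (i1.const_mul _)]
    congr 1 with p
    simp only [_root_.conjDeriv, _root_.conjDerivAdj]
    ring
  rw [e2]
  linarith

end IsTest

lemma conjDerivAdj_conjDeriv_iterate (b a : ℝ) {u : ℝ × ℝ → ℝ} (k : ℕ) (hu : IsTest (k + 2) u) :
    conjDerivAdj b a ((conjDeriv b a)^[k + 1] u) = fun p =>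
      (conjDeriv b a)^[k + 1] (conjDerivAdj b a u) p
        + (k + 1) * (2 * b) * (conjDeriv b a)^[k] u p := by
  induction k with
  | zero =>
    funext p
    simpa using conjDerivAdj_conjDeriv b a hu.contDiff p
  | succ k ih =>
    have hu' : IsTest (k + 2) u := hu.of_le (by omega)
    have h2 : IsTest 2 ((conjDeriv b a)^[k + 1] u) :=
      IsTest.conjDeriv_iterate b a (k + 1) (hu.of_le (by omega))
    have h1 : IsTest 1 ((conjDeriv b a)^[k + 1] (conjDerivAdj b a u)) :=
      IsTest.conjDeriv_iterate b a (k + 1)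
        (IsTest.conjDerivAdj (n := 1 + (k + 1)) (hu.of_le (by omega)) b a)
    have h0 : IsTest 1 ((conjDeriv b a)^[k] u) :=
      IsTest.conjDeriv_iterate b a k (hu.of_le (by omega))
    funext p
    rw [Function.iterate_succ_apply' _ (k + 1), conjDerivAdj_conjDeriv b a h2.contDiff, ih hu',
      conjDeriv_add_const_mul b a _ h1.differentiable h0.differentiable,
      Function.iterate_succ_apply' _ (k + 1), Function.iterate_succ_apply' _ k u]
    push_cast
    ring

lemma integral_conjDeriv_iterate_mul_nonneg {b : ℝ} (hb : 0 ≤ b) (a : ℝ) {u : ℝ × ℝ → ℝ} (k : ℕ)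
    (hu : IsTest (k + 2) u) :
    0 ≤ ∫ p, (conjDeriv b a)^[k + 1] (conjDerivAdj b a u) p * (conjDeriv b a)^[k] u p := by
  induction k with
  | zero =>
    have h : IsTest 1 (conjDerivAdj b a u) := IsTest.conjDerivAdj (n := 1) hu b a
    have := h.integral_conjDeriv_mul b a (hu.of_le (by norm_num : 1 ≤ 2))
    simp only [zero_add, Function.iterate_one, Function.iterate_zero, id] at this ⊢
    rw [this]
    exact integral_nonneg fun p => mul_self_nonneg _
  | succ k ih =>
    have hu' : IsTest (k + 2) u := hu.of_le (by omega)
    have h1 : IsTest 1 ((conjDeriv b a)^[k + 1] u) :=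
      IsTest.conjDeriv_iterate b a (k + 1) (hu.of_le (by omega))
    have h1' : IsTest 1 ((conjDeriv b a)^[k + 1] (conjDerivAdj b a u)) :=
      IsTest.conjDeriv_iterate b a (k + 1)
        (IsTest.conjDerivAdj (n := 1 + (k + 1)) (hu.of_le (by omega)) b a)
    have h0 : IsTest 1 ((conjDeriv b a)^[k] u) :=
      IsTest.conjDeriv_iterate b a k (hu.of_le (by omega))
    rw [Function.iterate_succ_apply' _ (k + 1), h1'.integral_conjDeriv_mul b a h1,
      conjDerivAdj_conjDeriv_iterate b a k hu']
    have e : ∀ p, (conjDeriv b a)^[k + 1] (conjDerivAdj b a u) p *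
        ((conjDeriv b a)^[k + 1] (conjDerivAdj b a u) p
          + (k + 1) * (2 * b) * (conjDeriv b a)^[k] u p)
        = (conjDeriv b a)^[k + 1] (conjDerivAdj b a u) p ^ 2 + (k + 1) * (2 * b) *
          ((conjDeriv b a)^[k + 1] (conjDerivAdj b a u) p * (conjDeriv b a)^[k] u p) :=
      fun p => by ring
    simp_rw [e]
    rw [integral_add h1'.integrable_sq ((h1'.integrable_mul h0).const_mul _), integral_const_mul]
    have := ih hu'
    have := integral_sq_nonneg ((conjDeriv b a)^[k + 1] (conjDerivAdj b a u))
    positivity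

lemma integral_sq_conjDeriv_iterate_ge {b : ℝ} (hb : 0 ≤ b) (a : ℝ) {u : ℝ × ℝ → ℝ} (k : ℕ)
    (hu : IsTest (k + 1) u) :
    (∫ p, (conjDeriv b a)^[k] (conjDerivAdj b a u) p ^ 2)
        + 2 * b * ∫ p, (conjDeriv b a)^[k] u p ^ 2
      ≤ ∫ p, (conjDeriv b a)^[k + 1] u p ^ 2 := by
  have h1 : IsTest 1 ((conjDeriv b a)^[k] u) :=
    IsTest.conjDeriv_iterate b a k (hu.of_le (by omega))
  rw [Function.iterate_succ_apply', h1.integral_sq_conjDeriv b a]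
  gcongr ?_ + _
  cases k with
  | zero => simp
  | succ k =>
    have hY : IsTest 0 ((conjDeriv b a)^[k + 1] (conjDerivAdj b a u)) :=
      IsTest.conjDeriv_iterate b a (k + 1)
        (IsTest.conjDerivAdj (n := 0 + (k + 1)) (hu.of_le (by omega)) b a)
    have h0 : IsTest 0 ((conjDeriv b a)^[k] u) :=
      IsTest.conjDeriv_iterate b a k (hu.of_le (by omega))
    rw [conjDerivAdj_conjDeriv_iterate b a k hu]
    have e : ∀ p, ((conjDeriv b a)^[k + 1] (conjDerivAdj b a u) p
          + (k + 1) * (2 * b) * (conjDeriv b a)^[k] u p) ^ 2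
        = (conjDeriv b a)^[k + 1] (conjDerivAdj b a u) p ^ 2 + (2 * ((k + 1) * (2 * b)) *
          ((conjDeriv b a)^[k + 1] (conjDerivAdj b a u) p * (conjDeriv b a)^[k] u p)
          + ((k + 1) * (2 * b)) ^ 2 * (conjDeriv b a)^[k] u p ^ 2) :=
      fun p => by ring
    simp_rw [e]
    have i1 := (hY.integrable_mul h0).const_mul (2 * ((k + 1) * (2 * b)))
    have i2 := h0.integrable_sq.const_mul (((k + 1) * (2 * b)) ^ 2)
    rw [integral_add hY.integrable_sq (i1.fun_add i2), integral_add i1 i2, integral_const_mul,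
      integral_const_mul]
    have := integral_conjDeriv_iterate_mul_nonneg hb a k hu
    have := integral_sq_nonneg ((conjDeriv b a)^[k] u)
    have : 0 ≤ 2 * ((k + 1) * (2 * b)) *
        ∫ p, (conjDeriv b a)^[k + 1] (conjDerivAdj b a u) p * (conjDeriv b a)^[k] u p := by
      positivity
    have : 0 ≤ ((k + 1) * (2 * b)) ^ 2 * ∫ p, (conjDeriv b a)^[k] u p ^ 2 := by positivity
    linarith

lemma integral_sq_conjDerivAdj_iterate_le {b : ℝ} (hb : 0 ≤ b) (a : ℝ) (k : ℕ) :
    ∀ {u : ℝ × ℝ → ℝ}, IsTest k u →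
      ∫ p, (conjDerivAdj b a)^[k] u p ^ 2 ≤ ∫ p, (conjDeriv b a)^[k] u p ^ 2 := by
  induction k with
  | zero => simp
  | succ k ih =>
    intro u hu
    have h1 := ih (hu.conjDerivAdj b a)
    have h2 := integral_sq_conjDeriv_iterate_ge hb a k hu
    have := integral_sq_nonneg ((conjDeriv b a)^[k] u)
    have : 0 ≤ 2 * b * ∫ p, (conjDeriv b a)^[k] u p ^ 2 := by positivity
    rw [Function.iterate_succ_apply]
    linarith

lemma integral_sq_le_integral_sq_conjDeriv {b a L : ℝ} (hb : 0 ≤ b) (hL : L < a)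
    {u : ℝ × ℝ → ℝ} (hu : IsTest 1 u) (hsupp : ∀ p, L < p.2 → u p = 0) :
    (b * (a - L)) ^ 2 * ∫ p, u p ^ 2 ≤ ∫ p, conjDeriv b a u p ^ 2 := by
  have hX := (IsTest.conjDeriv (n := 0) hu b a).integrable_sq
  have hY := (IsTest.conjDerivAdj (n := 0) hu b a).integrable_sq
  have hXY := hu.integral_sq_conjDeriv b a
  have h0 := integral_sq_nonneg u
  have h : ∫ p, 2 * ((b * (a - L)) ^ 2 * u p ^ 2)
      ≤ ∫ p, (conjDeriv b a u p ^ 2 + conjDerivAdj b a u p ^ 2) := by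
    refine integral_mono ((hu.integrable_sq.const_mul _).const_mul _) (hX.add hY) fun p => ?_
    rcases lt_or_ge L p.2 with hp | hp
    · have := add_nonneg (sq_nonneg (conjDeriv b a u p)) (sq_nonneg (conjDerivAdj b a u p))
      simpa [hsupp p hp] using this
    · have h1 : (b * (a - L)) ^ 2 ≤ (b * (p.2 - a)) ^ 2 := by
        rw [mul_pow, mul_pow]
        gcongr ?_ * ?_
        nlinarith
      have h2 : (b * (a - L)) ^ 2 * u p ^ 2 ≤ (b * (p.2 - a)) ^ 2 * u p ^ 2 := by gcongr
      simp only [conjDeriv, conjDerivAdj]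
      nlinarith [sq_nonneg (dirDeriv (0, 1) u p)]
  rw [integral_const_mul, integral_const_mul, integral_add hX hY] at h
  have : 0 ≤ 2 * b * ∫ p, u p ^ 2 := by positivity
  linarith

lemma integral_conjDeriv_four_mul_time (b a : ℝ) {w : ℝ × ℝ → ℝ} (hw : IsTest 4 w) :
    ∫ p, (conjDeriv b a)^[4] w p * dirDeriv (1, 0) w p
      = -∫ p, (conjDerivAdj b a)^[4] w p * dirDeriv (1, 0) w p := by
  have hX1 : IsTest 3 (conjDeriv b a w) := hw.conjDeriv b a
  have hX2 : IsTest 2 (conjDeriv b a (conjDeriv b a w)) := hX1.conjDeriv b a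
  have hX3 : IsTest 1 (conjDeriv b a (conjDeriv b a (conjDeriv b a w))) := hX2.conjDeriv b a
  have hY1 : IsTest 3 (conjDerivAdj b a w) := hw.conjDerivAdj b a
  have hY2 : IsTest 2 (conjDerivAdj b a (conjDerivAdj b a w)) := hY1.conjDerivAdj b a
  have hY3 : IsTest 1 (conjDerivAdj b a (conjDerivAdj b a (conjDerivAdj b a w))) :=
    hY2.conjDerivAdj b a
  have hT : IsTest 3 (dirDeriv (1, 0) w) := hw.dirDeriv _
  have hTY1 : IsTest 2 (conjDerivAdj b a (dirDeriv (1, 0) w)) := hT.conjDerivAdj b a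
  have hTX1 : IsTest 2 (conjDeriv b a (dirDeriv (1, 0) w)) := hT.conjDeriv b a
  simp only [Function.iterate_succ_apply', Function.iterate_zero, id]
  calc ∫ p, conjDeriv b a (conjDeriv b a (conjDeriv b a (conjDeriv b a w))) p
          * dirDeriv (1, 0) w p
      = ∫ p, conjDeriv b a (conjDeriv b a (conjDeriv b a w)) p
          * conjDerivAdj b a (dirDeriv (1, 0) w) p :=
        hX3.integral_conjDeriv_mul b a (hT.of_le (by norm_num))
    _ = ∫ p, conjDeriv b a (conjDeriv b a w) p
          * conjDerivAdj b a (conjDerivAdj b a (dirDeriv (1, 0) w)) p :=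
        (hX2.of_le one_le_two).integral_conjDeriv_mul b a (hTY1.of_le one_le_two)
    _ = ∫ p, conjDeriv b a (conjDeriv b a w) p
          * dirDeriv (1, 0) (conjDerivAdj b a (conjDerivAdj b a w)) p := by
        rw [dirDeriv_time_conjDerivAdj b a (hY1.of_le (by norm_num : 2 ≤ 3)).contDiff,
          dirDeriv_time_conjDerivAdj b a (hw.of_le (by norm_num : 2 ≤ 4)).contDiff]
    _ = -∫ p, dirDeriv (1, 0) (conjDeriv b a (conjDeriv b a w)) p
          * conjDerivAdj b a (conjDerivAdj b a w) p :=
        (hX2.of_le one_le_two).integral_mul_dirDeriv (hY2.of_le one_le_two) _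
    _ = -∫ p, conjDeriv b a (conjDeriv b a (dirDeriv (1, 0) w)) p
          * conjDerivAdj b a (conjDerivAdj b a w) p := by
        rw [dirDeriv_time_conjDeriv b a (hX1.of_le (by norm_num : 2 ≤ 3)).contDiff,
          dirDeriv_time_conjDeriv b a (hw.of_le (by norm_num : 2 ≤ 4)).contDiff]
    _ = -∫ p, conjDeriv b a (dirDeriv (1, 0) w) p
          * conjDerivAdj b a (conjDerivAdj b a (conjDerivAdj b a w)) p := by
        rw [(hTX1.of_le one_le_two).integral_conjDeriv_mul b a (hY2.of_le one_le_two)]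
    _ = -∫ p, conjDerivAdj b a (conjDerivAdj b a (conjDerivAdj b a (conjDerivAdj b a w))) p
          * dirDeriv (1, 0) w p := by
        rw [(hT.of_le (by norm_num : 1 ≤ 3)).integral_conjDeriv_mul b a hY3]
        simp only [mul_comm]

lemma integral_sq_conjDeriv_three_le {b : ℝ} (hb : 0 ≤ b) (a γ : ℝ) {w : ℝ × ℝ → ℝ}
    (hw : IsTest 4 w) :
    2 * b * ∫ p, (conjDeriv b a)^[3] w p ^ 2
      ≤ ∫ p, ((conjDeriv b a)^[4] w p + γ * dirDeriv (1, 0) w p) ^ 2 := by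
  have hX : IsTest 0 ((conjDeriv b a)^[4] w) := IsTest.conjDeriv_iterate b a 4 hw
  have hY : IsTest 0 ((conjDerivAdj b a)^[4] w) :=
    ((((hw.conjDerivAdj b a).conjDerivAdj b a).conjDerivAdj b a).conjDerivAdj b a :)
  have hT : IsTest 0 (dirDeriv (1, 0) w) := IsTest.dirDeriv (n := 0) (hw.of_le (by norm_num)) _
  have hZ : IsTest 0 (fun p => (conjDerivAdj b a)^[4] w p + (-γ) * dirDeriv (1, 0) w p) :=
    hY.add (hT.mul_left contDiff_const)
  have e : ∀ p, ((conjDeriv b a)^[4] w p + γ * dirDeriv (1, 0) w p) ^ 2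
      = ((conjDeriv b a)^[4] w p ^ 2 - (conjDerivAdj b a)^[4] w p ^ 2)
        + (((conjDerivAdj b a)^[4] w p + (-γ) * dirDeriv (1, 0) w p) ^ 2
        + 2 * γ * ((conjDeriv b a)^[4] w p * dirDeriv (1, 0) w p
          + (conjDerivAdj b a)^[4] w p * dirDeriv (1, 0) w p)) := fun p => by ring
  have i1 : Integrable fun p => (conjDeriv b a)^[4] w p ^ 2 - (conjDerivAdj b a)^[4] w p ^ 2 :=
    hX.integrable_sq.sub hY.integrable_sq
  have i2 := ((hX.integrable_mul hT).fun_add (hY.integrable_mul hT)).const_mul (2 * γ)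
  simp_rw [e]
  rw [integral_add i1 (hZ.integrable_sq.fun_add i2), integral_add hZ.integrable_sq i2,
    integral_sub hX.integrable_sq hY.integrable_sq, integral_const_mul (2 * γ),
    integral_add (hX.integrable_mul hT) (hY.integrable_mul hT),
    integral_conjDeriv_four_mul_time b a hw]
  have h1 := integral_sq_conjDeriv_iterate_ge hb a 3 hw
  have h2 := integral_sq_conjDerivAdj_iterate_le hb a 3 (hw.conjDerivAdj b a)
  have h3 := integral_sq_nonneg
    (fun p => (conjDerivAdj b a)^[4] w p + (-γ) * dirDeriv (1, 0) w p)
  rw [← Function.iterate_succ_apply] at h2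
  simp only [Nat.succ_eq_add_one, Nat.reduceAdd] at h1 h2
  linarith

lemma hasFDerivAt_exp_quadratic (lam x₀ t₀ β : ℝ) (p : ℝ × ℝ) :
    HasFDerivAt (fun q : ℝ × ℝ => exp (lam * ((q.2 - x₀) ^ 2 - β * (q.1 - t₀) ^ 2)))
      (exp (lam * ((p.2 - x₀) ^ 2 - β * (p.1 - t₀) ^ 2)) •
        ((2 * lam * (p.2 - x₀)) • ContinuousLinearMap.snd ℝ ℝ ℝ
          - (2 * lam * β * (p.1 - t₀)) • ContinuousLinearMap.fst ℝ ℝ ℝ)) p := by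
  have h1 : HasFDerivAt (fun q : ℝ × ℝ => q.2 - x₀) (ContinuousLinearMap.snd ℝ ℝ ℝ) p :=
    hasFDerivAt_snd.sub_const x₀
  have h2 : HasFDerivAt (fun q : ℝ × ℝ => q.1 - t₀) (ContinuousLinearMap.fst ℝ ℝ ℝ) p :=
    hasFDerivAt_fst.sub_const t₀
  refine (((h1.pow 2).fun_sub ((h2.pow 2).const_mul β)).const_mul lam).exp.congr_fderiv ?_
  ext <;> simp <;> ring

lemma dirDeriv_exp_quadratic_mul (lam x₀ t₀ β : ℝ) (e : ℝ × ℝ) {f : ℝ × ℝ → ℝ} {p : ℝ × ℝ}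
    (hf : DifferentiableAt ℝ f p) :
    dirDeriv e (fun q => exp (lam * ((q.2 - x₀) ^ 2 - β * (q.1 - t₀) ^ 2)) * f q) p
      = exp (lam * ((p.2 - x₀) ^ 2 - β * (p.1 - t₀) ^ 2)) * (dirDeriv e f p
        + (2 * lam * (p.2 - x₀) * e.2 - 2 * lam * β * (p.1 - t₀) * e.1) * f p) := by
  rw [dirDeriv_mul (hasFDerivAt_exp_quadratic lam x₀ t₀ β p).differentiableAt hf]
  simp only [dirDeriv, (hasFDerivAt_exp_quadratic lam x₀ t₀ β p).fderiv]
  simp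
  ring

lemma contDiff_iterate_dirDeriv (e : ℝ × ℝ) : ∀ (k : ℕ) {n : ℕ} {f : ℝ × ℝ → ℝ},
    ContDiff ℝ (n + k : ℕ) f → ContDiff ℝ n ((dirDeriv e)^[k] f)
  | 0, _, _, hf => hf
  | k + 1, n, _, hf => contDiff_iterate_dirDeriv e k (contDiff_dirDeriv (n := n + k) e hf)

lemma conjDeriv_iterate_exp_quadratic_mul (lam x₀ t₀ β : ℝ) (k : ℕ) {f : ℝ × ℝ → ℝ}
    (hf : ContDiff ℝ k f) :
    (conjDeriv (2 * lam) x₀)^[k]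
        (fun q => exp (lam * ((q.2 - x₀) ^ 2 - β * (q.1 - t₀) ^ 2)) * f q)
      = fun p => exp (lam * ((p.2 - x₀) ^ 2 - β * (p.1 - t₀) ^ 2))
        * (dirDeriv (0, 1))^[k] f p := by
  induction k with
  | zero => rfl
  | succ k ih =>
    have h : ContDiff ℝ (1 : ℕ) ((dirDeriv (0, 1))^[k] f) :=
      contDiff_iterate_dirDeriv _ k (by rwa [add_comm])
    funext p
    rw [Function.iterate_succ_apply', ih (hf.of_le (by norm_cast; omega)), conjDeriv,
      dirDeriv_exp_quadratic_mul _ _ _ _ _ (h.differentiable (by norm_num) p),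
      Function.iterate_succ_apply']
    ring

lemma iteratedDeriv_slice (k : ℕ) {f : ℝ × ℝ → ℝ} (hf : ContDiff ℝ k f) (t : ℝ) :
    iteratedDeriv k (fun x => f (t, x)) = fun x => (dirDeriv (0, 1))^[k] f (t, x) := by
  induction k with
  | zero => simp
  | succ k ih =>
    have h : ContDiff ℝ (1 : ℕ) ((dirDeriv (0, 1))^[k] f) :=
      contDiff_iterate_dirDeriv _ k (by rwa [add_comm])
    funext x
    rw [iteratedDeriv_succ, ih (hf.of_le (by norm_cast; omega)), Function.iterate_succ_apply']
    exact ((h.differentiable (by norm_num) (t, x)).hasFDerivAt.comp_hasDerivAt x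
      ((hasDerivAt_const x t).prodMk (hasDerivAt_id x))).deriv

lemma deriv_slice_time {f : ℝ × ℝ → ℝ} {t x : ℝ} (hf : DifferentiableAt ℝ f (t, x)) :
    deriv (fun τ => f (τ, x)) t = dirDeriv (1, 0) f (t, x) :=
  (hf.hasFDerivAt.comp_hasDerivAt t ((hasDerivAt_id t).prodMk (hasDerivAt_const t x))).deriv

lemma dirDeriv_eq_zero_of_isOpen {U : Set (ℝ × ℝ)} (hU : IsOpen U) (e : ℝ × ℝ) {f : ℝ × ℝ → ℝ}
    (hf : ∀ p ∈ U, f p = 0) : ∀ p ∈ U, dirDeriv e f p = 0 := by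
  intro p hp
  have : f =ᶠ[nhds p] fun _ => 0 := Filter.eventually_of_mem (hU.mem_nhds hp) hf
  simp [dirDeriv, this.fderiv_eq]

lemma iterate_dirDeriv_eq_zero_of_isOpen {U : Set (ℝ × ℝ)} (hU : IsOpen U) (e : ℝ × ℝ) (k : ℕ)
    {f : ℝ × ℝ → ℝ} (hf : ∀ p ∈ U, f p = 0) : ∀ p ∈ U, (dirDeriv e)^[k] f p = 0 := by
  induction k with
  | zero => exact hf
  | succ k ih =>
    rw [Function.iterate_succ_apply']
    exact dirDeriv_eq_zero_of_isOpen hU e ih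

lemma conjDeriv_iterate_eq_zero (b a L : ℝ) (k : ℕ) {w : ℝ × ℝ → ℝ}
    (hw : ∀ p, L < p.2 → w p = 0) : ∀ p, L < p.2 → (conjDeriv b a)^[k] w p = 0 := by
  induction k with
  | zero => exact hw
  | succ k ih =>
    intro p hp
    rw [Function.iterate_succ_apply', conjDeriv, ih p hp, dirDeriv_eq_zero_of_isOpen
      (isOpen_lt continuous_const continuous_snd) (0, 1) ih p hp]
    ring

/-- The Carleman estimate after conjugation by the exponential weight. -/
lemma carleman_conjugated {L T γ x₀ t₀ β lam : ℝ} (hx₀ : L < x₀) (ht₀ : t₀ ∈ Icc 0 T)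
    (hlam : 1 ≤ lam)
    (hlam' : 4 * (γ * β * T) ^ 2 / (4 * (x₀ - L) ^ 2) ^ 3 ≤ lam)
    {w : ℝ × ℝ → ℝ} (hw : IsTest 4 w) (hwx : ∀ p, L < p.2 → w p = 0)
    (hwt : ∀ p : ℝ × ℝ, p.1 ∉ Icc 0 T → w p = 0) :
    lam ^ 7 * (∫ p, w p ^ 2) + lam ^ 5 * (∫ p, conjDeriv (2 * lam) x₀ w p ^ 2)
        + lam ^ 3 * (∫ p, (conjDeriv (2 * lam) x₀)^[2] w p ^ 2)
        + lam * (∫ p, (conjDeriv (2 * lam) x₀)^[3] w p ^ 2)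
      ≤ (1 + 1 / (4 * (x₀ - L) ^ 2) + 1 / (4 * (x₀ - L) ^ 2) ^ 2 + 1 / (4 * (x₀ - L) ^ 2) ^ 3) *
        ∫ p, ((conjDeriv (2 * lam) x₀)^[4] w p + γ * (dirDeriv (1, 0) w p
          + 2 * lam * β * (p.1 - t₀) * w p)) ^ 2 := by
  have hb : 0 ≤ 2 * lam := by linarith
  have ha : 0 < 4 * (x₀ - L) ^ 2 := by
    have : 0 < x₀ - L := sub_pos.2 hx₀
    positivity
  have coercive : ∀ k, k ≤ 2 → 4 * (x₀ - L) ^ 2 * lam ^ 2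
      * ∫ p, (conjDeriv (2 * lam) x₀)^[k] w p ^ 2
      ≤ ∫ p, (conjDeriv (2 * lam) x₀)^[k + 1] w p ^ 2 := by
    intro k hk
    have h := integral_sq_le_integral_sq_conjDeriv hb hx₀
      (IsTest.conjDeriv_iterate (2 * lam) x₀ k (n := 1) (hw.of_le (by omega)))
      (conjDeriv_iterate_eq_zero (2 * lam) x₀ L k hwx)
    rw [Function.iterate_succ_apply']
    convert h using 2
    ring
  have hX : IsTest 0 ((conjDeriv (2 * lam) x₀)^[4] w) := IsTest.conjDeriv_iterate _ _ 4 hw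
  have hT : IsTest 0 (dirDeriv (1, 0) w) := IsTest.dirDeriv (n := 0) (hw.of_le (by norm_num)) _
  have hw0 : IsTest 0 w := hw.of_le (by norm_num)
  have hR : IsTest 0 (fun p => (conjDeriv (2 * lam) x₀)^[4] w p + γ * (dirDeriv (1, 0) w p
      + 2 * lam * β * (p.1 - t₀) * w p)) :=
    hX.add ((hT.add (hw0.mul_left (by fun_prop))).mul_left contDiff_const)
  have hR' : IsTest 0 (fun p => (conjDeriv (2 * lam) x₀)^[4] w p + γ * dirDeriv (1, 0) w p) :=
    hX.add (hT.mul_left contDiff_const)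
  have hmain := integral_sq_conjDeriv_three_le hb x₀ γ hw
  have hpert : ∫ p, ((conjDeriv (2 * lam) x₀)^[4] w p + γ * dirDeriv (1, 0) w p) ^ 2
      ≤ ∫ p, (2 * ((conjDeriv (2 * lam) x₀)^[4] w p + γ * (dirDeriv (1, 0) w p
          + 2 * lam * β * (p.1 - t₀) * w p)) ^ 2
        + 8 * lam ^ 2 * (γ * β * T) ^ 2 * w p ^ 2) := by
    refine integral_mono hR'.integrable_sq
      ((hR.integrable_sq.const_mul 2).fun_add (hw0.integrable_sq.const_mul _)) fun p => ?_
    have h : (2 * lam * γ * β) ^ 2 * ((p.1 - t₀) ^ 2 * w p ^ 2)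
        ≤ (2 * lam * γ * β) ^ 2 * (T ^ 2 * w p ^ 2) := by
      gcongr ?_ * ?_
      by_cases hp : p.1 ∈ Icc 0 T
      · gcongr ?_ * _
        exact sq_le_sq' (by linarith [hp.1, ht₀.2]) (by linarith [hp.2, ht₀.1])
      · simp [hwt p hp]
    nlinarith [sq_nonneg ((conjDeriv (2 * lam) x₀)^[4] w p + γ * dirDeriv (1, 0) w p
      + 2 * (γ * (2 * lam * β * (p.1 - t₀) * w p)))]
  rw [integral_add (hR.integrable_sq.const_mul 2) (hw0.integrable_sq.const_mul _),
    integral_const_mul, integral_const_mul] at hpert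
  have c0 := coercive 0 (by norm_num)
  have c1 := coercive 1 (by norm_num)
  have c2 := coercive 2 le_rfl
  simp only [Function.iterate_zero, id, zero_add, Function.iterate_one, Nat.reduceAdd]
    at c0 c1 c2
  have n3 := integral_sq_nonneg ((conjDeriv (2 * lam) x₀)^[3] w)
  set a := 4 * (x₀ - L) ^ 2
  set N0 := ∫ p, w p ^ 2
  set N1 := ∫ p, conjDeriv (2 * lam) x₀ w p ^ 2
  set N2 := ∫ p, (conjDeriv (2 * lam) x₀)^[2] w p ^ 2
  set N3 := ∫ p, (conjDeriv (2 * lam) x₀)^[3] w p ^ 2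
  set R := ∫ p, ((conjDeriv (2 * lam) x₀)^[4] w p + γ * (dirDeriv (1, 0) w p
          + 2 * lam * β * (p.1 - t₀) * w p)) ^ 2
  have hl : 0 < lam := by linarith
  have d2 : lam ^ 2 * N2 ≤ 1 / a * N3 := by
    rw [one_div, le_inv_mul_iff₀ ha]
    linarith
  have d1 : lam ^ 4 * N1 ≤ 1 / a ^ 2 * N3 := by
    rw [one_div, le_inv_mul_iff₀ (by positivity)]
    calc a ^ 2 * (lam ^ 4 * N1) = a * lam ^ 2 * (a * lam ^ 2 * N1) := by ring
      _ ≤ a * lam ^ 2 * N2 := by gcongr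
      _ ≤ N3 := c2
  have d0 : lam ^ 6 * N0 ≤ 1 / a ^ 3 * N3 := by
    rw [one_div, le_inv_mul_iff₀ (by positivity)]
    calc a ^ 3 * (lam ^ 6 * N0) = a * lam ^ 2 * (a * lam ^ 2 * (a * lam ^ 2 * N0)) := by ring
      _ ≤ a * lam ^ 2 * (a * lam ^ 2 * N1) := by gcongr
      _ ≤ a * lam ^ 2 * N2 := by gcongr
      _ ≤ N3 := c2
  have n0 : 0 ≤ N0 := integral_sq_nonneg w
  have absorb : 8 * lam ^ 2 * (γ * β * T) ^ 2 * N0 ≤ 2 * lam * N3 := by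
    calc 8 * lam ^ 2 * (γ * β * T) ^ 2 * N0
        = 8 * (γ * β * T) ^ 2 * (lam ^ 2 * N0) := by ring
      _ ≤ 8 * (γ * β * T) ^ 2 * (lam ^ 6 * N0) := by
        gcongr
        norm_num
      _ ≤ 8 * (γ * β * T) ^ 2 * (1 / a ^ 3 * N3) := by gcongr
      _ = 2 * (4 * (γ * β * T) ^ 2 / a ^ 3) * N3 := by ring
      _ ≤ 2 * lam * N3 := by gcongr
  have hN3 : lam * N3 ≤ R := by linarith
  calc lam ^ 7 * N0 + lam ^ 5 * N1 + lam ^ 3 * N2 + lam * N3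
      = lam * (lam ^ 6 * N0 + lam ^ 4 * N1 + lam ^ 2 * N2 + N3) := by ring
    _ ≤ lam * (1 / a ^ 3 * N3 + 1 / a ^ 2 * N3 + 1 / a * N3 + N3) := by gcongr
    _ = (1 + 1 / a + 1 / a ^ 2 + 1 / a ^ 3) * (lam * N3) := by ring
    _ ≤ (1 + 1 / a + 1 / a ^ 2 + 1 / a ^ 3) * R := by gcongr

/-- Carleman estimate for the fourth order operator `γ∂_t + ∂_x⁴` on
`Q = (0,T) × (0,L)` with weight `ψ(t,x) = (x - x₀)² - β(t - t₀)²`, for functions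
supported in `Q_ε = {ψ > ε}`, integrating over `Q_c` with `0 < c < ε`. -/
theorem carleman_fourth_order_singular_support
    (L T γ x₀ t₀ β : ℝ) (hL : 0 < L) (hT : 0 < T)
    (hx₀ : L < x₀) (hx₀' : (x₀ - L) ^ 2 < x₀ ^ 2 / 3) (ht₀ : t₀ ∈ Ioo 0 T) (hβ : 0 < β)
    (ε c : ℝ) (hε₁ : (x₀ - L) ^ 2 < ε) (hε₂ : ε < x₀ ^ 2) (hc : c ∈ Ioo 0 ε)
    (v : ℝ → ℝ → ℝ) (hv : ContDiff ℝ 4 (Function.uncurry v))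
    (hsupp : ∀ t x : ℝ,
      (t, x) ∉ {p : ℝ × ℝ | p.1 ∈ Ioo 0 T ∧ p.2 ∈ Ioo 0 L ∧
        ε < (p.2 - x₀) ^ 2 - β * (p.1 - t₀) ^ 2} → v t x = 0) :
    ∃ lam₀ > (0:ℝ), ∃ C > (0:ℝ), ∀ lam > lam₀,
      (∫ p in {p : ℝ × ℝ | p.1 ∈ Ioo 0 T ∧ p.2 ∈ Ioo 0 L ∧
          c < (p.2 - x₀) ^ 2 - β * (p.1 - t₀) ^ 2},
        exp (2 * lam * ((p.2 - x₀) ^ 2 - β * (p.1 - t₀) ^ 2)) *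
          (lam ^ 7 * (v p.1 p.2) ^ 2 + lam ^ 5 * (deriv (v p.1) p.2) ^ 2
            + lam ^ 3 * (iteratedDeriv 2 (v p.1) p.2) ^ 2
            + lam * (iteratedDeriv 3 (v p.1) p.2) ^ 2))
      ≤ C * ∫ p in {p : ℝ × ℝ | p.1 ∈ Ioo 0 T ∧ p.2 ∈ Ioo 0 L ∧
            c < (p.2 - x₀) ^ 2 - β * (p.1 - t₀) ^ 2},
          exp (2 * lam * ((p.2 - x₀) ^ 2 - β * (p.1 - t₀) ^ 2)) *
            (γ * deriv (fun τ => v τ p.2) p.1 + iteratedDeriv 4 (v p.1) p.2) ^ 2 := by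
  set V : ℝ × ℝ → ℝ := Function.uncurry v
  have hV4 : ContDiff ℝ (4 : ℕ) V := hv
  set S : Set (ℝ × ℝ) := {p : ℝ × ℝ | p.1 ∈ Ioo 0 T ∧ p.2 ∈ Ioo 0 L ∧
          c < (p.2 - x₀) ^ 2 - β * (p.1 - t₀) ^ 2}
  let U : Set (ℝ × ℝ) := {p | p.1 < 0} ∪ {p | T < p.1} ∪ {p | p.2 < 0} ∪ {p | L < p.2}
    ∪ {p | (p.2 - x₀) ^ 2 - β * (p.1 - t₀) ^ 2 < ε}
  have hU : IsOpen U :=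
    ((((isOpen_lt continuous_fst continuous_const).union
      (isOpen_lt continuous_const continuous_fst)).union
      (isOpen_lt continuous_snd continuous_const)).union
      (isOpen_lt continuous_const continuous_snd)).union
      (isOpen_lt (by fun_prop) continuous_const)
  have hVU : ∀ p ∈ U, V p = 0 := by
    rintro ⟨t, x⟩ hp
    refine hsupp t x ?_
    rintro ⟨⟨h1, h2⟩, ⟨h3, h4⟩, h5⟩
    rcases hp with (((hp | hp) | hp) | hp) | hp <;> simp only [mem_ofPred_eq] at * <;> linarith
  have hSU : ∀ p ∉ S, p ∈ closure U := by
    rintro ⟨t, x⟩ hp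
    have h1 : closure (Iio 0 ×ˢ univ : Set (ℝ × ℝ)) ⊆ closure U :=
      closure_mono fun q hq => Or.inl (Or.inl (Or.inl (Or.inl hq.1)))
    have h2 : closure (Ioi T ×ˢ univ : Set (ℝ × ℝ)) ⊆ closure U :=
      closure_mono fun q hq => Or.inl (Or.inl (Or.inl (Or.inr hq.1)))
    have h3 : closure (univ ×ˢ Iio 0 : Set (ℝ × ℝ)) ⊆ closure U :=
      closure_mono fun q hq => Or.inl (Or.inl (Or.inr hq.2))
    have h4 : closure (univ ×ˢ Ioi L : Set (ℝ × ℝ)) ⊆ closure U :=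
      closure_mono fun q hq => Or.inl (Or.inr hq.2)
    simp only [closure_prod_eq, closure_Iio, closure_Ioi, closure_univ] at h1 h2 h3 h4
    by_contra hcl
    refine hp ⟨⟨?_, ?_⟩, ⟨?_, ?_⟩, ?_⟩ <;> by_contra! h
    · exact hcl (h1 ⟨h, trivial⟩)
    · exact hcl (h2 ⟨h, trivial⟩)
    · exact hcl (h3 ⟨trivial, h⟩)
    · exact hcl (h4 ⟨trivial, h⟩)
    · exact hcl (subset_closure (Or.inr (lt_of_le_of_lt h hc.2)))
  have hVcpt : HasCompactSupport V := by
    refine HasCompactSupport.intro (isCompact_Icc.prod isCompact_Icc :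
      IsCompact (Icc 0 T ×ˢ Icc 0 L)) fun p hp => hVU p ?_
    by_contra h
    simp only [U, mem_union, mem_ofPred_eq, not_or, not_lt] at h
    exact hp ⟨⟨h.1.1.1.1, h.1.1.1.2⟩, ⟨h.1.1.2, h.1.2⟩⟩
  have hslice : ∀ k : ℕ, k ≤ 4 → ∀ p : ℝ × ℝ,
      iteratedDeriv k (v p.1) p.2 = (dirDeriv (0, 1))^[k] V p := fun k hk p =>
    congrFun (iteratedDeriv_slice k (hV4.of_le (by exact_mod_cast hk)) p.1) p.2
  have hslice1 : ∀ p : ℝ × ℝ, deriv (v p.1) p.2 = dirDeriv (0, 1) V p := fun p => by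
    rw [← iteratedDeriv_one]
    exact hslice 1 (by norm_num) p
  have hsliceT : ∀ p : ℝ × ℝ, deriv (fun τ => v τ p.2) p.1 = dirDeriv (1, 0) V p := fun p =>
    deriv_slice_time (hV4.differentiable (by norm_num) (p.1, p.2))
  have hd : 0 < x₀ - L := sub_pos.2 hx₀
  refine ⟨1 + 4 * (γ * β * T) ^ 2 / (4 * (x₀ - L) ^ 2) ^ 3, by positivity,
    1 + 1 / (4 * (x₀ - L) ^ 2) + 1 / (4 * (x₀ - L) ^ 2) ^ 2 + 1 / (4 * (x₀ - L) ^ 2) ^ 3,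
    by positivity, fun lam hlam => ?_⟩
  have hq : 0 ≤ 4 * (γ * β * T) ^ 2 / (4 * (x₀ - L) ^ 2) ^ 3 := by positivity
  have hlam0 : 0 < lam := by linarith
  set w : ℝ × ℝ → ℝ := fun q => exp (lam * ((q.2 - x₀) ^ 2 - β * (q.1 - t₀) ^ 2)) * V q with hwdef
  have hw : IsTest 4 w := IsTest.mul_left ⟨hV4, hVcpt⟩ (by fun_prop)
  have hwU : ∀ p ∈ U, w p = 0 := fun p hp => by simp [hwdef, hVU p hp]
  have hconj : ∀ k : ℕ, k ≤ 4 → ∀ p, (conjDeriv (2 * lam) x₀)^[k] w p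
      = exp (lam * ((p.2 - x₀) ^ 2 - β * (p.1 - t₀) ^ 2)) * (dirDeriv (0, 1))^[k] V p :=
    fun k hk p => congrFun (conjDeriv_iterate_exp_quadratic_mul lam x₀ t₀ β k
      (hV4.of_le (by exact_mod_cast hk))) p
  have hconjT : ∀ p : ℝ × ℝ, dirDeriv (1, 0) w p + 2 * lam * β * (p.1 - t₀) * w p
      = exp (lam * ((p.2 - x₀) ^ 2 - β * (p.1 - t₀) ^ 2)) * dirDeriv (1, 0) V p := fun p => by
    rw [hwdef, dirDeriv_exp_quadratic_mul lam x₀ t₀ β (1, 0)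
      (hV4.differentiable (by norm_num) p)]
    ring
  have hexp : ∀ r : ℝ, exp (2 * lam * r) = exp (lam * r) ^ 2 := fun r => by
    rw [← Real.exp_nat_mul]
    congr 1
    push_cast
    ring
  have hmain := carleman_conjugated (γ := γ) (β := β) hx₀ (Ioo_subset_Icc_self ht₀)
    (by linarith : 1 ≤ lam) (by linarith) hw (fun p hp => hwU p (Or.inl (Or.inr hp)))
    (fun p hp => hwU p (by
      by_contra h
      simp only [U, mem_union, mem_ofPred_eq, not_or, not_lt] at h
      exact hp ⟨h.1.1.1.1, h.1.1.1.2⟩))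
  have eL : ∀ p : ℝ × ℝ, exp (2 * lam * ((p.2 - x₀) ^ 2 - β * (p.1 - t₀) ^ 2)) *
          (lam ^ 7 * (v p.1 p.2) ^ 2 + lam ^ 5 * (deriv (v p.1) p.2) ^ 2
            + lam ^ 3 * (iteratedDeriv 2 (v p.1) p.2) ^ 2
            + lam * (iteratedDeriv 3 (v p.1) p.2) ^ 2)
      = lam ^ 7 * w p ^ 2 + lam ^ 5 * conjDeriv (2 * lam) x₀ w p ^ 2
        + lam ^ 3 * (conjDeriv (2 * lam) x₀)^[2] w p ^ 2
        + lam * (conjDeriv (2 * lam) x₀)^[3] w p ^ 2 := fun p => by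
    have h1 := hconj 1 (by norm_num) p
    simp only [Function.iterate_one] at h1
    rw [hslice 2 (by norm_num), hslice 3 (by norm_num), hslice1, hconj 2 (by norm_num),
      hconj 3 (by norm_num), h1, hexp]
    change _ * (_ * V p ^ 2 + _ + _ + _) = _
    ring
  have eR : ∀ p : ℝ × ℝ, exp (2 * lam * ((p.2 - x₀) ^ 2 - β * (p.1 - t₀) ^ 2)) *
            (γ * deriv (fun τ => v τ p.2) p.1 + iteratedDeriv 4 (v p.1) p.2) ^ 2
      = ((conjDeriv (2 * lam) x₀)^[4] w p + γ * (dirDeriv (1, 0) w p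
          + 2 * lam * β * (p.1 - t₀) * w p)) ^ 2 := fun p => by
    rw [hslice 4 le_rfl, hsliceT, hconjT, hconj 4 le_rfl, hexp]
    ring
  have i0 := (hw.integrable_sq).const_mul (lam ^ 7)
  have i1 := (IsTest.conjDeriv (n := 3) hw (2 * lam) x₀).integrable_sq.const_mul (lam ^ 5)
  have i2 := (IsTest.conjDeriv_iterate (n := 2) (2 * lam) x₀ 2 hw).integrable_sq.const_mul
    (lam ^ 3)
  have i3 := (IsTest.conjDeriv_iterate (n := 1) (2 * lam) x₀ 3 hw).integrable_sq.const_mul lam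
  have hzero : ∀ p ∉ S, ((conjDeriv (2 * lam) x₀)^[4] w p + γ * (dirDeriv (1, 0) w p
          + 2 * lam * β * (p.1 - t₀) * w p)) ^ 2 = 0 := by
    have hcX := (IsTest.conjDeriv_iterate (n := 0) (2 * lam) x₀ 4 hw).contDiff.continuous
    have hcT := (IsTest.dirDeriv (n := 3) hw (1, 0)).contDiff.continuous
    have hcw := hw.contDiff.continuous
    have hclosed : IsClosed {p : ℝ × ℝ | ((conjDeriv (2 * lam) x₀)^[4] w p
        + γ * (dirDeriv (1, 0) w p + 2 * lam * β * (p.1 - t₀) * w p)) ^ 2 = 0} :=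
      isClosed_eq (by fun_prop) continuous_const
    refine fun p hp => closure_minimal (fun q hq => ?_) hclosed (hSU p hp)
    simp only [mem_ofPred_eq]
    rw [hconjT, hconj 4 le_rfl, iterate_dirDeriv_eq_zero_of_isOpen hU _ 4 hVU q hq,
      dirDeriv_eq_zero_of_isOpen hU _ hVU q hq]
    ring
  simp_rw [eL, eR]
  rw [setIntegral_eq_integral_of_forall_compl_eq_zero hzero]
  refine le_trans (setIntegral_le_integral (((i0.fun_add i1).fun_add i2).fun_add i3)
    (Filter.Eventually.of_forall fun p => ?_)) ?_
  · simp only [Pi.zero_apply]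
    positivity
  · rw [integral_add ((i0.fun_add i1).fun_add i2) i3, integral_add (i0.fun_add i1) i2,
      integral_add i0 i1, integral_const_mul, integral_const_mul, integral_const_mul,
      integral_const_mul]
    exact hmain
end

section
/- There exists s₀ > 0 such that for every s ≥ s₀ there exist λ₀ > 0 and C > 0 with the following property: for every v ∈ H⁴(Q) satisfying γ∂_t v + ∂_x⁴ v = f with f ∈ L²(Q) and either v = v_x = 0 on (0,T)×∂Ω or v = v_{xx} = 0 on (0,T)×∂Ω, and every λ ≥ λ₀, ∫_Q λ s² φ e^{2λρ} ( |∂_x³ v|² + λ²s²φ²|∂_x² v|² + λ⁴s⁴φ⁴|∂_x v|² + λ⁶s⁶φ⁶|v|² ) dx dt ≤ C ∫_Q e^{2λρ} f² dx dt + C ∫_0^T ∫_ω λ⁷ s⁸ φ⁷ e^{2λρ} |v|² dx dt. -/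
open MeasureTheory Real Set

/-- The weight `φ(t,x) = e^{sφ̂(x)}/(t(T-t))`. -/
noncomputable def wphi (s T : ℝ) (g : ℝ → ℝ) (t x : ℝ) : ℝ :=
  Real.exp (s * g x) / (t * (T - t))

/-- The weight `ρ(t,x) = (e^{sφ̂(x)} - e^{2s‖φ̂‖_C})/(t(T-t))`. -/
noncomputable def wrho (s T K : ℝ) (g : ℝ → ℝ) (t x : ℝ) : ℝ :=
  (Real.exp (s * g x) - Real.exp (2 * s * K)) / (t * (T - t))

namespace CarlemanFourth

open Filter Topology

/-- A continuous family of quadratic forms is bounded uniformly over bounded parameters. -/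
lemma exists_quadratic_bound {n : ℕ} (q : (Fin n → ℝ) → (Fin 4 → ℝ) → ℝ)
    (hc : Continuous (fun z : (Fin n → ℝ) × (Fin 4 → ℝ) => q z.1 z.2))
    (hh : ∀ θ (c : ℝ) W, q θ (fun i => c * W i) = c ^ 2 * q θ W) {R : ℝ} (hR : 0 ≤ R) :
    ∃ K > (0:ℝ), ∀ θ, (∀ i, |θ i| ≤ R) → ∀ W,
      |q θ W| ≤ K * (W 0 ^ 2 + W 1 ^ 2 + W 2 ^ 2 + W 3 ^ 2) := by
  obtain ⟨K, hK⟩ := ((isCompact_closedBall (0 : Fin n → ℝ) R).prod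
    (isCompact_closedBall (0 : Fin 4 → ℝ) 1)).exists_bound_of_continuousOn hc.continuousOn
  refine ⟨|K| + 1, by positivity, fun θ hθ W => ?_⟩
  have hS : ∀ i, W i ^ 2 ≤ W 0 ^ 2 + W 1 ^ 2 + W 2 ^ 2 + W 3 ^ 2 := by
    intro i
    fin_cases i <;> simp <;> nlinarith [sq_nonneg (W 0), sq_nonneg (W 1), sq_nonneg (W 2),
      sq_nonneg (W 3)]
  set S := W 0 ^ 2 + W 1 ^ 2 + W 2 ^ 2 + W 3 ^ 2 with hSdef
  have hS0 : 0 ≤ S := by positivity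
  rcases hS0.eq_or_lt with h0 | hpos
  · have hW : W = fun i => (0:ℝ) * W i := by
      funext i
      have := hS i
      rw [← h0] at this
      simpa using (pow_eq_zero_iff (two_ne_zero)).1 (le_antisymm this (sq_nonneg _))
    rw [hW, hh, ← h0]
    simp
  · set c := Real.sqrt S with hcdef
    have hcpos : 0 < c := Real.sqrt_pos.2 hpos
    have hc2 : c ^ 2 = S := Real.sq_sqrt hS0
    have hW : W = fun i => c * (fun j => c⁻¹ * W j) i := by
      funext i
      field_simp
    have hball : ∀ j, |c⁻¹ * W j| ≤ 1 := by
      intro j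
      rw [abs_mul, abs_of_pos (inv_pos.2 hcpos), inv_mul_le_one₀ hcpos]
      exact abs_le_of_sq_le_sq (by rw [hc2]; exact hS j) hcpos.le
    have hb := hK (θ, fun j => c⁻¹ * W j) ⟨by
      rw [mem_closedBall_zero_iff]; exact (pi_norm_le_iff_of_nonneg hR).2 hθ, by
      rw [mem_closedBall_zero_iff]; exact (pi_norm_le_iff_of_nonneg zero_le_one).2 hball⟩
    have hqW : q θ W = S * q θ (fun j => c⁻¹ * W j) := by
      conv_lhs => rw [hW]
      rw [hh, hc2]
    rw [hqW, abs_mul, abs_of_pos hpos, mul_comm]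
    refine mul_le_mul_of_nonneg_right ?_ hS0
    rw [Real.norm_eq_abs] at hb
    exact hb.trans ((le_abs_self K).trans (by linarith))

/-- The symmetric part of the conjugated operator. -/
def symPart (a a1 w0 w1 w2 w4 : ℝ) : ℝ :=
  w4 + 6 * a ^ 2 * w2 + 12 * a * a1 * w1 + a ^ 4 * w0

/-- The skew-symmetric part of the conjugated operator. -/
def skewPart (γ a a1 w0 w1 w2 w3 wt : ℝ) : ℝ :=
  γ * wt - 4 * a * w3 - 6 * a1 * w2 - 4 * a ^ 3 * w1 - 6 * a ^ 2 * a1 * w0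

/-- The flux in space of the product of the symmetric and skew-symmetric parts. -/
def flux (γ a a1 at' w0 w1 w2 w3 wt w1t : ℝ) : ℝ :=
  -2 * a * w3 ^ 2 - 6 * a1 * w2 * w3 - 4 * a ^ 3 * w1 * w3 - 10 * a ^ 3 * w2 ^ 2
    - 30 * a ^ 2 * a1 * w1 * w2 - 6 * a ^ 2 * a1 * w0 * w3 - 10 * a ^ 5 * w1 ^ 2
    - 22 * a ^ 4 * a1 * w0 * w1 - 4 * a ^ 5 * w0 * w2 - 2 * a ^ 7 * w0 ^ 2
    + γ * (w3 * wt - w2 * w1t + 2 * a * w1 * w1t + at' * w1 ^ 2 + 6 * a ^ 2 * w1 * wt)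

/-- The formal space derivative of `flux`. -/
def fluxX (γ a a1 a2 at' a1t w0 w1 w2 w3 w4 wt w1t w2t : ℝ) : ℝ :=
  -4 * a ^ 7 * w0 * w1 - 14 * a ^ 6 * a1 * w0 ^ 2 - 4 * a ^ 5 * w0 * w3 - 24 * a ^ 5 * w1 * w2
    - 42 * a ^ 4 * a1 * w0 * w2 - 72 * a ^ 4 * a1 * w1 ^ 2 - 22 * a ^ 4 * a2 * w0 * w1
    - 88 * a ^ 3 * a1 ^ 2 * w0 * w1 - 4 * a ^ 3 * w1 * w4 - 24 * a ^ 3 * w2 * w3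
    - 6 * a ^ 2 * a1 * w0 * w4 - 48 * a ^ 2 * a1 * w1 * w3 - 60 * a ^ 2 * a1 * w2 ^ 2
    - 6 * a ^ 2 * a2 * w0 * w3 - 30 * a ^ 2 * a2 * w1 * w2 - 12 * a * a1 ^ 2 * w0 * w3
    - 60 * a * a1 ^ 2 * w1 * w2 - 4 * a * w3 * w4 - 6 * a1 * w2 * w4 - 8 * a1 * w3 ^ 2
    - 6 * a2 * w2 * w3
    + γ * (6 * a ^ 2 * w1 * w1t + 6 * a ^ 2 * w2 * wt + 12 * a * a1 * w1 * wt + 2 * a * w1 * w2t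
      + 2 * a * w1t * w2 + 2 * a1 * w1 * w1t + a1t * w1 ^ 2 + 2 * at' * w1 * w2 - w2 * w2t
      + w4 * wt)

/-- The density in time of the product of the symmetric and skew-symmetric parts. -/
noncomputable def dens (γ a a1 w0 w1 w2 : ℝ) : ℝ :=
  γ * (w2 ^ 2 / 2 - 2 * a * w1 * w2 - a1 * w1 ^ 2 - 3 * a ^ 2 * w1 ^ 2 + a ^ 4 * w0 ^ 2 / 2)

/-- The formal time derivative of `dens`. -/
def densT (γ a a1 at' a1t w0 w1 w2 wt w1t w2t : ℝ) : ℝ :=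
  γ * (a ^ 4 * w0 * wt + 2 * a ^ 3 * at' * w0 ^ 2 - 6 * a ^ 2 * w1 * w1t - 6 * a * at' * w1 ^ 2
    - 2 * a * w1 * w2t - 2 * a * w1t * w2 - 2 * a1 * w1 * w1t - a1t * w1 ^ 2
    - 2 * at' * w1 * w2 + w2 * w2t)

/-- The flux used to localize the energy. -/
def locFlux (k₁ k₂ τ χ w0 w1 w2 w3 : ℝ) : ℝ :=
  χ * (τ * w2 * w3 + k₂ * τ ^ 3 * w1 * w2 + k₁ * τ ^ 5 * w0 * w1)

/-- The formal space derivative of `locFlux`. -/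
def locFluxX (k₁ k₂ τ χ χ1 w0 w1 w2 w3 w4 : ℝ) : ℝ :=
  χ1 * (τ * w2 * w3 + k₂ * τ ^ 3 * w1 * w2 + k₁ * τ ^ 5 * w0 * w1)
    + χ * (τ * (w3 ^ 2 + w2 * w4) + k₂ * τ ^ 3 * (w2 ^ 2 + w1 * w3)
      + k₁ * τ ^ 5 * (w1 ^ 2 + w0 * w2))

/-- The energy density in the scaled variables `τ³w, τ²w_x, τw_xx, w_xxx`. -/
def energy (τ w0 w1 w2 w3 : ℝ) : ℝ :=
  (τ ^ 3 * w0) ^ 2 + (τ ^ 2 * w1) ^ 2 + (τ * w2) ^ 2 + w3 ^ 2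

lemma energy_nonneg (τ w0 w1 w2 w3 : ℝ) : 0 ≤ energy τ w0 w1 w2 w3 := by
  unfold energy; positivity

lemma forall_abs_le_cons {n : ℕ} {R x : ℝ} {θ : Fin n → ℝ} (hx : |x| ≤ R)
    (h : ∀ i, |θ i| ≤ R) : ∀ i, |(Matrix.vecCons x θ : Fin (n + 1) → ℝ) i| ≤ R := by
  intro i
  refine Fin.cases ?_ (fun j => ?_) i
  · simpa using hx
  · simpa using h j

/-- The lower order terms in the product of the symmetric and skew-symmetric parts. -/
lemma exists_lower_order_bound (γ : ℝ) {R : ℝ} (hR : 0 ≤ R) :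
    ∃ K > (0:ℝ), ∀ τ p q r e w0 w1 w2 w3 w4 wt w1t w2t a1t : ℝ,
      |p| ≤ R → |q| ≤ R → |r| ≤ R → |e| ≤ R →
      |symPart (τ * p) (τ * q) w0 w1 w2 w4 * skewPart γ (τ * p) (τ * q) w0 w1 w2 w3 wt
        - fluxX γ (τ * p) (τ * q) (τ * r) (τ ^ 3 * e * p) a1t w0 w1 w2 w3 w4 wt w1t w2t
        - densT γ (τ * p) (τ * q) (τ ^ 3 * e * p) a1t w0 w1 w2 wt w1t w2t
        - 8 * (τ * q) * (w3 ^ 2 + 3 * (τ * p) ^ 2 * w2 ^ 2 + 3 * (τ * p) ^ 4 * w1 ^ 2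
          + (τ * p) ^ 6 * w0 ^ 2)|
      ≤ K * energy τ w0 w1 w2 w3 := by
  obtain ⟨K, hK, h⟩ := exists_quadratic_bound (n := 4) (fun θ W =>
    22 * θ 0 ^ 4 * θ 2 * W 0 * W 1 + 16 * θ 0 ^ 3 * θ 1 ^ 2 * W 0 * W 1
      - 2 * θ 0 ^ 4 * θ 3 * γ * W 0 ^ 2 + 6 * θ 0 ^ 2 * θ 2 * W 0 * W 3
      + 30 * θ 0 ^ 2 * θ 2 * W 1 * W 2 + 12 * θ 0 * θ 1 ^ 2 * W 0 * W 3
      - 12 * θ 0 * θ 1 ^ 2 * W 1 * W 2 + 6 * θ 0 ^ 2 * θ 3 * γ * W 1 ^ 2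
      + 6 * θ 2 * W 2 * W 3) (by fun_prop) (by intros; ring) hR
  refine ⟨K, hK, fun τ p q r e w0 w1 w2 w3 w4 wt w1t w2t a1t hp hq hr he => ?_⟩
  have := h ![p, q, r, e] (forall_abs_le_cons hp (forall_abs_le_cons hq (forall_abs_le_cons hr
    (forall_abs_le_cons he fun i => i.elim0)))) ![τ ^ 3 * w0, τ ^ 2 * w1, τ * w2, w3]
  simp only [Matrix.cons_val] at this
  refine le_trans (le_of_eq (congrArg abs ?_)) this
  unfold symPart skewPart fluxX densT
  ring

/-- The terms of the conjugated operator that are left out of its symmetric and skew-symmetric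
parts. -/
def remainder (γ τ b e p q r u w0 w1 : ℝ) : ℝ :=
  γ * (τ ^ 3 * e * b) * w0 + 4 * (τ * r) * w1
    - (4 * (τ * p) * (τ * r) + 3 * (τ * q) ^ 2 - τ * u) * w0

lemma exists_remainder_bound (γ : ℝ) {R : ℝ} (hR : 1 ≤ R) :
    ∃ K > (0:ℝ), ∀ τ b e p q r u w0 w1 w2 w3 : ℝ, 1 ≤ τ → |b| ≤ R → |e| ≤ R →
      |p| ≤ R → |q| ≤ R → |r| ≤ R → |u| ≤ R →
      remainder γ τ b e p q r u w0 w1 ^ 2 ≤ K * energy τ w0 w1 w2 w3 := by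
  obtain ⟨K, hK, h⟩ := exists_quadratic_bound (n := 7) (fun θ W =>
    (γ * θ 1 * θ 0 * W 0 + 4 * θ 4 * θ 6 * W 1
      - (4 * θ 2 * θ 4 + 3 * θ 3 ^ 2 - θ 5 * θ 6) * θ 6 * W 0) ^ 2)
    (by fun_prop) (by intros; ring) (zero_le_one.trans hR)
  refine ⟨K, hK, fun τ b e p q r u w0 w1 w2 w3 hτ hb he hp hq hr hu => ?_⟩
  have hτ0 : τ ≠ 0 := by positivity
  have hδ : |τ⁻¹| ≤ R := by
    rw [abs_of_nonneg (by positivity)]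
    exact (inv_le_one_of_one_le₀ hτ).trans hR
  have := h ![b, e, p, q, r, u, τ⁻¹] (forall_abs_le_cons hb (forall_abs_le_cons he
    (forall_abs_le_cons hp (forall_abs_le_cons hq (forall_abs_le_cons hr
    (forall_abs_le_cons hu (forall_abs_le_cons hδ fun i => i.elim0)))))))
    ![τ ^ 3 * w0, τ ^ 2 * w1, τ * w2, w3]
  simp only [Matrix.cons_val] at this
  refine le_trans (le_of_eq ?_) ((le_abs_self _).trans this)
  unfold remainder
  field_simp

lemma exists_principal_bound {R c : ℝ} (hR : 0 ≤ R) (hc : 0 < c) (hc1 : c ≤ 1) :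
    ∃ D > (0:ℝ), ∀ τ p q χ w0 w1 w2 w3 : ℝ, 0 < τ → |p| ≤ R → |q| ≤ R → 0 ≤ χ →
      (χ = 1 ∨ c ≤ q ∧ c ≤ |p|) →
      8 * c ^ 7 * τ * energy τ w0 w1 w2 w3 - D * (χ * τ * energy τ w0 w1 w2 w3) ≤
      8 * (τ * q) * (w3 ^ 2 + 3 * (τ * p) ^ 2 * w2 ^ 2 + 3 * (τ * p) ^ 4 * w1 ^ 2
          + (τ * p) ^ 6 * w0 ^ 2) := by
  obtain ⟨D, hD, h⟩ := exists_quadratic_bound (n := 2) (fun θ W =>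
    8 * θ 1 * (W 3 ^ 2 + 3 * θ 0 ^ 2 * W 2 ^ 2 + 3 * θ 0 ^ 4 * W 1 ^ 2 + θ 0 ^ 6 * W 0 ^ 2))
    (by fun_prop) (by intros; ring) hR
  refine ⟨D + 8 * c ^ 7, by positivity, fun τ p q χ w0 w1 w2 w3 hτ hp hq hχ hcase => ?_⟩
  have heq : 8 * (τ * q) * (w3 ^ 2 + 3 * (τ * p) ^ 2 * w2 ^ 2 + 3 * (τ * p) ^ 4 * w1 ^ 2
      + (τ * p) ^ 6 * w0 ^ 2) = τ * (8 * q * (w3 ^ 2 + 3 * p ^ 2 * (τ * w2) ^ 2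
        + 3 * p ^ 4 * (τ ^ 2 * w1) ^ 2 + p ^ 6 * (τ ^ 3 * w0) ^ 2)) := by ring
  have hN := energy_nonneg τ w0 w1 w2 w3
  rw [heq]
  rcases hcase with rfl | ⟨hq1, hp1⟩
  · have := h ![p, q] (forall_abs_le_cons hp (forall_abs_le_cons hq fun i => i.elim0))
      ![τ ^ 3 * w0, τ ^ 2 * w1, τ * w2, w3]
    simp only [Matrix.cons_val] at this
    have h2 := (abs_le.1 this).1
    have h3 := mul_le_mul_of_nonneg_left h2 hτ.le
    unfold energy at *
    linarith
  · have hp2 : c ^ 2 ≤ p ^ 2 := by rw [← sq_abs p]; gcongr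
    have hp4 : c ^ 4 ≤ p ^ 4 := by
      calc c ^ 4 = (c ^ 2) ^ 2 := by ring
        _ ≤ (p ^ 2) ^ 2 := by gcongr
        _ = p ^ 4 := by ring
    have hp6 : c ^ 6 ≤ p ^ 6 := by
      calc c ^ 6 = (c ^ 2) ^ 3 := by ring
        _ ≤ (p ^ 2) ^ 3 := by gcongr
        _ = p ^ 6 := by ring
    have e4 : c ^ 6 ≤ 3 * p ^ 4 := by
      nlinarith [pow_le_pow_of_le_one hc.le hc1 (show 4 ≤ 6 by norm_num), pow_pos hc 4]
    have e2 : c ^ 6 ≤ 3 * p ^ 2 := by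
      nlinarith [pow_le_pow_of_le_one hc.le hc1 (show 2 ≤ 6 by norm_num), pow_pos hc 2]
    have e0 : c ^ 6 ≤ 1 := pow_le_one₀ hc.le hc1
    have hin : c ^ 6 * energy τ w0 w1 w2 w3 ≤ w3 ^ 2 + 3 * p ^ 2 * (τ * w2) ^ 2
        + 3 * p ^ 4 * (τ ^ 2 * w1) ^ 2 + p ^ 6 * (τ ^ 3 * w0) ^ 2 := by
      have i0 := mul_le_mul_of_nonneg_right e0 (sq_nonneg w3)
      have i2 := mul_le_mul_of_nonneg_right e2 (sq_nonneg (τ * w2))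
      have i4 := mul_le_mul_of_nonneg_right e4 (sq_nonneg (τ ^ 2 * w1))
      have i6 := mul_le_mul_of_nonneg_right hp6 (sq_nonneg (τ ^ 3 * w0))
      unfold energy
      linarith
    have h1 : 8 * c * (c ^ 6 * energy τ w0 w1 w2 w3) ≤ 8 * q * (w3 ^ 2
        + 3 * p ^ 2 * (τ * w2) ^ 2 + 3 * p ^ 4 * (τ ^ 2 * w1) ^ 2 + p ^ 6 * (τ ^ 3 * w0) ^ 2) := by
      have : 0 ≤ c ^ 6 * energy τ w0 w1 w2 w3 := by positivity
      have h0 : 0 < q := hc.trans_le hq1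
      gcongr
    have h3 := mul_le_mul_of_nonneg_left h1 hτ.le
    have : 0 ≤ (D + 8 * c ^ 7) * (χ * τ * energy τ w0 w1 w2 w3) := by positivity
    linarith

/-- Localization of the energy: up to a flux, the symmetric part and lower order terms, the energy
where `χ` is supported is controlled by the zeroth order term. -/
lemma exists_localization_bound {R : ℝ} (hR : 1 ≤ R) :
    ∃ k₁ k₂ A K : ℝ, 0 < A ∧ 0 < K ∧ ∀ τ p q χ χ1 w0 w1 w2 w3 w4 : ℝ, 1 ≤ τ → |p| ≤ R → |q| ≤ R →
      0 ≤ χ → χ ≤ 1 → |χ1| ≤ R →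
      χ * τ * energy τ w0 w1 w2 w3 ≤ 2 * (locFluxX k₁ k₂ τ χ χ1 w0 w1 w2 w3 w4
        - χ * (τ * w2) * symPart (τ * p) (τ * q) w0 w1 w2 w4) + A * (χ * τ * (τ ^ 3 * w0) ^ 2)
        + K * energy τ w0 w1 w2 w3 := by
  obtain ⟨A, hA⟩ : ∃ A, A = 6 * R ^ 2 + R ^ 4 := ⟨_, rfl⟩
  obtain ⟨k₂, hk₂⟩ : ∃ k₂, k₂ = A + 2 := ⟨_, rfl⟩
  obtain ⟨k₁, hk₁⟩ : ∃ k₁, k₁ = k₂ ^ 2 / 2 + 1 := ⟨_, rfl⟩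
  have hA0 : 0 < A := by rw [hA]; positivity
  obtain ⟨K, hK, h⟩ := exists_quadratic_bound (n := 4) (fun θ W =>
    -2 * θ 3 * (W 2 * W 3 + k₂ * W 1 * W 2 + k₁ * W 0 * W 1)
      + 24 * θ 2 * θ 0 * θ 1 * W 1 * W 2) (by fun_prop) (by intros; ring) (zero_le_one.trans hR)
  refine ⟨k₁, k₂, 2 * A + k₁ ^ 2 + 1, K, by positivity, hK,
    fun τ p q χ χ1 w0 w1 w2 w3 w4 hτ hp hq hχ hχ1 hχ' => ?_⟩
  have h1 := h ![p, q, χ, χ1] (forall_abs_le_cons hp (forall_abs_le_cons hq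
    (forall_abs_le_cons (by rw [abs_of_nonneg hχ]; linarith)
    (forall_abs_le_cons hχ' fun i => i.elim0)))) ![τ ^ 3 * w0, τ ^ 2 * w1, τ * w2, w3]
  simp only [Matrix.cons_val] at h1
  have h2 := (abs_le.1 h1).2
  have hp2 : p ^ 2 ≤ R ^ 2 := by rw [← sq_abs p]; gcongr
  have hp4 : p ^ 4 ≤ R ^ 4 := by
    calc p ^ 4 = (p ^ 2) ^ 2 := by ring
      _ ≤ (R ^ 2) ^ 2 := by gcongr
      _ = R ^ 4 := by ring
  have hId : locFluxX k₁ k₂ τ χ χ1 w0 w1 w2 w3 w4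
        - χ * (τ * w2) * symPart (τ * p) (τ * q) w0 w1 w2 w4
      = χ1 * (τ * w2 * w3 + k₂ * (τ ^ 2 * w1) * (τ * w2) + k₁ * (τ ^ 3 * w0) * (τ ^ 2 * w1))
        - 12 * χ * p * q * (τ ^ 2 * w1) * (τ * w2)
        + χ * τ * (w3 ^ 2 + k₂ * (τ * w2) ^ 2 + k₁ * (τ ^ 2 * w1) ^ 2 + k₂ * (τ ^ 2 * w1) * w3
          + k₁ * (τ ^ 3 * w0) * (τ * w2) - 6 * p ^ 2 * (τ * w2) ^ 2
          - p ^ 4 * (τ ^ 3 * w0) * (τ * w2)) := by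
    unfold locFluxX symPart
    ring
  generalize hW0 : τ ^ 3 * w0 = W0 at *
  generalize hW1 : τ ^ 2 * w1 = W1 at *
  generalize hW2 : τ * w2 = W2 at *
  have hyoung : W0 ^ 2 + W1 ^ 2 + W2 ^ 2 + w3 ^ 2 ≤ 2 * (w3 ^ 2 + k₂ * W2 ^ 2 + k₁ * W1 ^ 2
      + k₂ * W1 * w3 + k₁ * W0 * W2 - 6 * p ^ 2 * W2 ^ 2 - p ^ 4 * W0 * W2)
      + (2 * A + k₁ ^ 2 + 1) * W0 ^ 2 := by
    have i1 : p ^ 2 * W2 ^ 2 ≤ R ^ 2 * W2 ^ 2 := by gcongr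
    have i2 : p ^ 4 * W0 * W2 ≤ R ^ 4 * (W0 ^ 2 + W2 ^ 2) / 2 := by
      have : p ^ 4 * (W0 ^ 2 + W2 ^ 2) ≤ R ^ 4 * (W0 ^ 2 + W2 ^ 2) := by gcongr
      nlinarith [mul_nonneg (show 0 ≤ p ^ 4 by positivity) (sq_nonneg (W0 - W2))]
    have i3 : 0 ≤ (w3 + k₂ * W1) ^ 2 := sq_nonneg _
    have i4 : 0 ≤ (W2 + k₁ * W0) ^ 2 := sq_nonneg _
    have i5 : 0 ≤ R ^ 4 * (W0 ^ 2 + W2 ^ 2) := by positivity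
    have i6 : 0 ≤ R ^ 2 * W0 ^ 2 := by positivity
    have e0 : A * W0 ^ 2 = 6 * R ^ 2 * W0 ^ 2 + R ^ 4 * W0 ^ 2 := by rw [hA]; ring
    have e2 : k₂ * W2 ^ 2 = (6 * R ^ 2 + R ^ 4) * W2 ^ 2 + 2 * W2 ^ 2 := by rw [hk₂, hA]; ring
    have e1 : k₁ * W1 ^ 2 = k₂ ^ 2 * W1 ^ 2 / 2 + W1 ^ 2 := by rw [hk₁]; ring
    linarith [sq_nonneg w3, sq_nonneg W1, sq_nonneg W2, sq_nonneg W0]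
  have hmul := mul_le_mul_of_nonneg_left hyoung (show 0 ≤ χ * τ by positivity)
  rw [hId]
  unfold energy
  rw [hW0, hW1, hW2]
  linarith

/-- The pointwise Carleman inequality for the conjugated operator. -/
lemma exists_pointwise_carleman (γ : ℝ) {R c : ℝ} (hR : 1 ≤ R) (hc : 0 < c) (hc1 : c ≤ 1) :
    ∃ k₁ k₂ B τ₀ c₁ μ : ℝ, 0 < B ∧ 1 ≤ τ₀ ∧ 0 < c₁ ∧
    ∀ τ b e p q r u χ χ1 w0 w1 w2 w3 w4 wt w1t w2t a1t g : ℝ, τ₀ ≤ τ → |b| ≤ R → |e| ≤ R →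
      |p| ≤ R → |q| ≤ R → |r| ≤ R → |u| ≤ R → 0 ≤ χ → χ ≤ 1 → |χ1| ≤ R →
      (χ = 1 ∨ c ≤ q ∧ c ≤ |p|) →
      symPart (τ * p) (τ * q) w0 w1 w2 w4 + skewPart γ (τ * p) (τ * q) w0 w1 w2 w3 wt
        = g + remainder γ τ b e p q r u w0 w1 →
      c₁ * (τ * energy τ w0 w1 w2 w3) ≤ 2 * g ^ 2 + B * (χ * τ * (τ ^ 3 * w0) ^ 2)
        + (μ * locFluxX k₁ k₂ τ χ χ1 w0 w1 w2 w3 w4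
        - 2 * fluxX γ (τ * p) (τ * q) (τ * r) (τ ^ 3 * e * p) a1t w0 w1 w2 w3 w4 wt w1t w2t)
        - 2 * densT γ (τ * p) (τ * q) (τ ^ 3 * e * p) a1t w0 w1 w2 wt w1t w2t := by
  have hR0 : 0 ≤ R := zero_le_one.trans hR
  obtain ⟨K₁, hK₁, h1⟩ := exists_lower_order_bound γ hR0
  obtain ⟨K₂, hK₂, h2⟩ := exists_remainder_bound γ hR
  obtain ⟨D, hD, h3⟩ := exists_principal_bound hR0 hc hc1
  obtain ⟨k₁, k₂, A, K₃, hA, hK₃, h4⟩ := exists_localization_bound hR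
  obtain ⟨Kt, hKt⟩ : ∃ Kt, Kt = 2 * K₁ + 2 * K₂ + 2 * D * K₃ + 4 * D ^ 2 := ⟨_, rfl⟩
  refine ⟨k₁, k₂, 2 * D * A, max 1 (Kt / (8 * c ^ 7)), 8 * c ^ 7, 4 * D, by positivity,
    le_max_left _ _, by positivity, ?_⟩
  intro τ b e p q r u χ χ1 w0 w1 w2 w3 w4 wt w1t w2t a1t g hτ hb he hp hq hr hu hχ hχ1 hχ' hcase
    heq
  have hτ1 : 1 ≤ τ := (le_max_left _ _).trans hτ
  have hτ0 : 0 < τ := by linarith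
  have i1 := h1 τ p q r e w0 w1 w2 w3 w4 wt w1t w2t a1t hp hq hr he
  have i2 := h2 τ b e p q r u w0 w1 w2 w3 hτ1 hb he hp hq hr hu
  have i3 := h3 τ p q χ w0 w1 w2 w3 hτ0 hp hq hχ hcase
  have i4 := h4 τ p q χ χ1 w0 w1 w2 w3 w4 hτ1 hp hq hχ hχ1 hχ'
  have i5 : (χ * (τ * w2)) ^ 2 ≤ energy τ w0 w1 w2 w3 := by
    have : χ ^ 2 ≤ 1 := pow_le_one₀ hχ hχ1
    unfold energy
    nlinarith [mul_le_mul_of_nonneg_right this (sq_nonneg (τ * w2)), sq_nonneg (τ ^ 3 * w0),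
      sq_nonneg (τ ^ 2 * w1), sq_nonneg w3]
  have i6 : Kt * energy τ w0 w1 w2 w3 ≤ 8 * c ^ 7 * (τ * energy τ w0 w1 w2 w3) := by
    have : Kt ≤ τ * (8 * c ^ 7) :=
      (div_le_iff₀ (by positivity)).1 ((le_max_right _ _).trans hτ)
    nlinarith [mul_le_mul_of_nonneg_right this (energy_nonneg τ w0 w1 w2 w3)]
  have i7 : (symPart (τ * p) (τ * q) w0 w1 w2 w4 + skewPart γ (τ * p) (τ * q) w0 w1 w2 w3 wt) ^ 2
      ≤ 2 * g ^ 2 + 2 * remainder γ τ b e p q r u w0 w1 ^ 2 := by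
    rw [heq]
    exact add_sq_le.trans (le_of_eq (by ring))
  have i8 := (abs_le.1 i1).1
  have i9 := mul_le_mul_of_nonneg_left i4 hD.le
  generalize symPart (τ * p) (τ * q) w0 w1 w2 w4 = P at *
  generalize skewPart γ (τ * p) (τ * q) w0 w1 w2 w3 wt = S at *
  generalize energy τ w0 w1 w2 w3 = N at *
  generalize fluxX γ (τ * p) (τ * q) (τ * r) (τ ^ 3 * e * p) a1t w0 w1 w2 w3 w4 wt w1t w2t = X at *
  generalize densT γ (τ * p) (τ * q) (τ ^ 3 * e * p) a1t w0 w1 w2 wt w1t w2t = Y at *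
  generalize remainder γ τ b e p q r u w0 w1 ^ 2 = Z at *
  have j1 : 0 ≤ (P + 2 * D * (χ * (τ * w2))) ^ 2 := sq_nonneg _
  have j2 : 4 * D ^ 2 * (χ * (τ * w2)) ^ 2 ≤ 4 * D ^ 2 * N := by gcongr
  have j3 : 0 ≤ S ^ 2 := sq_nonneg _
  have j4 : Kt * N = 2 * K₁ * N + 2 * K₂ * N + 2 * D * K₃ * N + 4 * D ^ 2 * N := by
    rw [hKt]; ring
  linarith

/-- The sign of the flux at the boundary under clamped or hinged conditions. -/
lemma exists_boundary_sign (γ : ℝ) {R c : ℝ} (hR : 1 ≤ R) (hc : 0 < c) (hc1 : c ≤ 1) :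
    ∃ τ₀ : ℝ, 1 ≤ τ₀ ∧ ∀ τ e p q w1 w2 w3 w1t : ℝ, τ₀ ≤ τ → |e| ≤ R → |p| ≤ R → |q| ≤ R →
      c ≤ |p| → (w1 = 0 ∧ w1t = 0 ∨ w2 = 2 * (τ * p) * w1) →
      p * flux γ (τ * p) (τ * q) (τ ^ 3 * e * p) 0 w1 w2 w3 0 w1t ≤ 0 := by
  have hR0 : 0 ≤ R := zero_le_one.trans hR
  obtain ⟨K₁, hK₁, h1⟩ := exists_quadratic_bound (n := 2) (fun θ W =>
    -6 * θ 0 * θ 1 * W 2 * W 3) (by fun_prop) (by intros; ring) hR0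
  obtain ⟨K₂, hK₂, h2⟩ := exists_quadratic_bound (n := 4) (fun θ W =>
    -12 * θ 0 ^ 2 * θ 1 * W 1 * W 3 - 60 * θ 0 ^ 4 * θ 1 * W 1 ^ 2
      + γ * θ 2 * θ 0 ^ 2 * θ 3 * W 1 ^ 2) (by fun_prop) (by intros; ring) hR0
  refine ⟨max 1 ((K₁ + K₂) / c ^ 6), le_max_left _ _,
    fun τ e p q w1 w2 w3 w1t hτ he hp hq hpc hcase => ?_⟩
  have hτ1 : 1 ≤ τ := (le_max_left _ _).trans hτ
  have hτ0 : τ ≠ 0 := by positivity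
  have hτK : K₁ + K₂ ≤ τ * c ^ 6 := (div_le_iff₀ (by positivity)).1 ((le_max_right _ _).trans hτ)
  have hδ : |τ⁻¹| ≤ R := by
    rw [abs_of_nonneg (by positivity)]
    exact (inv_le_one_of_one_le₀ hτ1).trans hR
  have hp2 : c ^ 2 ≤ p ^ 2 := by rw [← sq_abs p]; gcongr
  have hp4 : c ^ 4 ≤ p ^ 4 := by
    calc c ^ 4 = (c ^ 2) ^ 2 := by ring
      _ ≤ (p ^ 2) ^ 2 := by gcongr
      _ = p ^ 4 := by ring
  have hp6 : c ^ 6 ≤ p ^ 6 := by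
    calc c ^ 6 = (c ^ 2) ^ 3 := by ring
      _ ≤ (p ^ 2) ^ 3 := by gcongr
      _ = p ^ 6 := by ring
  have e4 : c ^ 6 ≤ p ^ 4 := (pow_le_pow_of_le_one hc.le hc1 (by norm_num)).trans hp4
  have e2 : c ^ 6 ≤ p ^ 2 := (pow_le_pow_of_le_one hc.le hc1 (by norm_num)).trans hp2
  rcases hcase with ⟨rfl, rfl⟩ | rfl
  · have i1 := h1 ![p, q] (forall_abs_le_cons hp (forall_abs_le_cons hq fun i => i.elim0))
      ![0, 0, τ * w2, w3]
    simp only [Matrix.cons_val] at i1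
    have i2 := (abs_le.1 i1).2
    have hid : p * flux γ (τ * p) (τ * q) (τ ^ 3 * e * p) 0 0 w2 w3 0 0
        = -6 * p * q * (τ * w2) * w3
          - τ * (2 * (p ^ 2 * w3 ^ 2) + 10 * (p ^ 4 * (τ * w2) ^ 2)) := by
      unfold flux; ring
    have j1 := mul_le_mul_of_nonneg_right e2 (sq_nonneg w3)
    have j2 := mul_le_mul_of_nonneg_right e4 (sq_nonneg (τ * w2))
    have j3 : c ^ 6 * ((τ * w2) ^ 2 + w3 ^ 2) ≤
        2 * (p ^ 2 * w3 ^ 2) + 10 * (p ^ 4 * (τ * w2) ^ 2) := by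
      have k1 : 0 ≤ p ^ 2 * w3 ^ 2 := by positivity
      have k2 : 0 ≤ p ^ 4 * (τ * w2) ^ 2 := by positivity
      linarith
    have j4 := mul_le_mul_of_nonneg_left j3 (zero_le_one.trans hτ1)
    have j5 := mul_le_mul_of_nonneg_right hτK (show 0 ≤ (τ * w2) ^ 2 + w3 ^ 2 by positivity)
    have j6 : 0 ≤ K₂ * ((τ * w2) ^ 2 + w3 ^ 2) := by positivity
    rw [hid]
    linarith
  · have i1 := h2 ![p, q, e, τ⁻¹] (forall_abs_le_cons hp (forall_abs_le_cons hq
      (forall_abs_le_cons he (forall_abs_le_cons hδ fun i => i.elim0))))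
      ![0, τ ^ 2 * w1, 0, w3]
    simp only [Matrix.cons_val] at i1
    have i2 := (abs_le.1 i1).2
    have hid : p * flux γ (τ * p) (τ * q) (τ ^ 3 * e * p) 0 w1 (2 * (τ * p) * w1) w3 0 w1t
        = (-12 * p ^ 2 * q * (τ ^ 2 * w1) * w3 - 60 * p ^ 4 * q * (τ ^ 2 * w1) ^ 2
            + γ * e * p ^ 2 * τ⁻¹ * (τ ^ 2 * w1) ^ 2)
          - τ * (p ^ 2 * w3 ^ 2 + 46 * (p ^ 6 * (τ ^ 2 * w1) ^ 2)
            + (p * (w3 + 2 * p ^ 2 * (τ ^ 2 * w1))) ^ 2) := by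
      unfold flux; field_simp; ring
    have j1 := mul_le_mul_of_nonneg_right e2 (sq_nonneg w3)
    have j2 := mul_le_mul_of_nonneg_right hp6 (sq_nonneg (τ ^ 2 * w1))
    have j3 : c ^ 6 * ((τ ^ 2 * w1) ^ 2 + w3 ^ 2) ≤ p ^ 2 * w3 ^ 2
        + 46 * (p ^ 6 * (τ ^ 2 * w1) ^ 2) + (p * (w3 + 2 * p ^ 2 * (τ ^ 2 * w1))) ^ 2 := by
      have k2 : 0 ≤ p ^ 6 * (τ ^ 2 * w1) ^ 2 := by positivity
      have k3 := sq_nonneg (p * (w3 + 2 * p ^ 2 * (τ ^ 2 * w1)))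
      linarith
    have j4 := mul_le_mul_of_nonneg_left j3 (zero_le_one.trans hτ1)
    have j5 := mul_le_mul_of_nonneg_right hτK
      (show 0 ≤ (τ ^ 2 * w1) ^ 2 + w3 ^ 2 by positivity)
    have j6 : 0 ≤ K₁ * ((τ ^ 2 * w1) ^ 2 + w3 ^ 2) := by positivity
    rw [hid]
    linarith

/-- If `z_k = e v^{(k)}` with `e_x = a e`, then `jet1` is the first derivative of `z_0`. -/
def jet1 (a z0 z1 : ℝ) : ℝ := z1 + a * z0

/-- The second derivative of `z_0`. -/
def jet2 (a a1 z0 z1 z2 : ℝ) : ℝ := z2 + 2 * a * z1 + (a ^ 2 + a1) * z0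

/-- The third derivative of `z_0`. -/
def jet3 (a a1 a2 z0 z1 z2 z3 : ℝ) : ℝ :=
  z3 + 3 * a * z2 + (3 * a ^ 2 + 3 * a1) * z1 + (a ^ 3 + 3 * a * a1 + a2) * z0

/-- The fourth derivative of `z_0`. -/
def jet4 (a a1 a2 a3 z0 z1 z2 z3 z4 : ℝ) : ℝ :=
  z4 + 4 * a * z3 + (6 * a ^ 2 + 6 * a1) * z2 + (4 * a ^ 3 + 12 * a * a1 + 4 * a2) * z1
    + (a ^ 4 + 6 * a ^ 2 * a1 + 4 * a * a2 + 3 * a1 ^ 2 + a3) * z0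

lemma symPart_add_skewPart (γ τ b e p q r u z0 z1 z2 z3 z4 zt : ℝ) :
    symPart (τ * p) (τ * q) z0 (jet1 (τ * p) z0 z1) (jet2 (τ * p) (τ * q) z0 z1 z2)
        (jet4 (τ * p) (τ * q) (τ * r) (τ * u) z0 z1 z2 z3 z4)
      + skewPart γ (τ * p) (τ * q) z0 (jet1 (τ * p) z0 z1) (jet2 (τ * p) (τ * q) z0 z1 z2)
        (jet3 (τ * p) (τ * q) (τ * r) z0 z1 z2 z3) (τ ^ 3 * e * b * z0 + zt)
      = (γ * zt + z4) + remainder γ τ b e p q r u z0 (jet1 (τ * p) z0 z1) := by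
  unfold symPart skewPart jet1 jet2 jet3 jet4 remainder
  ring

/-- The weighted energy of `z_k = e v^{(k)}` is controlled by the energy of the derivatives of
`z_0`. -/
lemma exists_weighted_energy_bound (s : ℝ) {R : ℝ} (hR : 1 ≤ R) :
    ∃ K > (0:ℝ), ∀ τ α p q r z0 z1 z2 z3 : ℝ, 1 ≤ τ → |α| ≤ R → |p| ≤ R → |q| ≤ R → |r| ≤ R →
      s ^ 2 * (τ * α) * (z3 ^ 2 + s ^ 2 * (τ * α) ^ 2 * z2 ^ 2 + s ^ 4 * (τ * α) ^ 4 * z1 ^ 2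
        + s ^ 6 * (τ * α) ^ 6 * z0 ^ 2) ≤
      K * (τ * energy τ z0 (jet1 (τ * p) z0 z1) (jet2 (τ * p) (τ * q) z0 z1 z2)
        (jet3 (τ * p) (τ * q) (τ * r) z0 z1 z2 z3)) := by
  obtain ⟨K, hK, h⟩ := exists_quadratic_bound (n := 5) (fun θ W =>
    s ^ 2 * θ 0 * ((W 3 - 3 * θ 1 * W 2 + (3 * θ 1 ^ 2 - 3 * θ 2 * θ 4) * W 1
        + (-θ 1 ^ 3 + 3 * θ 1 * θ 2 * θ 4 - θ 3 * θ 4 ^ 2) * W 0) ^ 2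
      + s ^ 2 * θ 0 ^ 2 * (W 2 - 2 * θ 1 * W 1 + (θ 1 ^ 2 - θ 2 * θ 4) * W 0) ^ 2
      + s ^ 4 * θ 0 ^ 4 * (W 1 - θ 1 * W 0) ^ 2 + s ^ 6 * θ 0 ^ 6 * W 0 ^ 2))
    (by fun_prop) (by intros; ring) (zero_le_one.trans hR)
  refine ⟨K, hK, fun τ α p q r z0 z1 z2 z3 hτ hα hp hq hr => ?_⟩
  have hτ0 : τ ≠ 0 := by positivity
  have hδ : |τ⁻¹| ≤ R := by
    rw [abs_of_nonneg (by positivity)]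
    exact (inv_le_one_of_one_le₀ hτ).trans hR
  have h1 := h ![α, p, q, r, τ⁻¹] (forall_abs_le_cons hα (forall_abs_le_cons hp
    (forall_abs_le_cons hq (forall_abs_le_cons hr (forall_abs_le_cons hδ fun i => i.elim0)))))
    ![τ ^ 3 * z0, τ ^ 2 * jet1 (τ * p) z0 z1, τ * jet2 (τ * p) (τ * q) z0 z1 z2,
      jet3 (τ * p) (τ * q) (τ * r) z0 z1 z2 z3]
  simp only [Matrix.cons_val] at h1
  have h2 := mul_le_mul_of_nonneg_left ((le_abs_self _).trans h1) (zero_le_one.trans hτ)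
  have e1 : τ ^ 2 * jet1 (τ * p) z0 z1 - p * (τ ^ 3 * z0) = τ ^ 2 * z1 := by
    unfold jet1; ring
  have e2 : τ * jet2 (τ * p) (τ * q) z0 z1 z2 - 2 * p * (τ ^ 2 * jet1 (τ * p) z0 z1)
      + (p ^ 2 - q * τ⁻¹) * (τ ^ 3 * z0) = τ * z2 := by
    unfold jet1 jet2; field_simp; ring
  have e3 : jet3 (τ * p) (τ * q) (τ * r) z0 z1 z2 z3
      - 3 * p * (τ * jet2 (τ * p) (τ * q) z0 z1 z2)
      + (3 * p ^ 2 - 3 * q * τ⁻¹) * (τ ^ 2 * jet1 (τ * p) z0 z1)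
      + (-p ^ 3 + 3 * p * q * τ⁻¹ - r * τ⁻¹ ^ 2) * (τ ^ 3 * z0) = z3 := by
    unfold jet1 jet2 jet3; field_simp; ring
  rw [e1, e2, e3] at h2
  unfold energy
  linarith

section Derivatives

variable {γ x : ℝ} {a a1 a2 a3 at' a1t w0 w1 w2 w3 w4 wt w1t w2t : ℝ → ℝ}

lemma hasDerivAt_flux (ha : HasDerivAt a (a1 x) x) (ha1 : HasDerivAt a1 (a2 x) x)
    (hat : HasDerivAt at' (a1t x) x) (h0 : HasDerivAt w0 (w1 x) x) (h1 : HasDerivAt w1 (w2 x) x)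
    (h2 : HasDerivAt w2 (w3 x) x) (h3 : HasDerivAt w3 (w4 x) x) (ht : HasDerivAt wt (w1t x) x)
    (h1t : HasDerivAt w1t (w2t x) x) :
    HasDerivAt (fun y => flux γ (a y) (a1 y) (at' y) (w0 y) (w1 y) (w2 y) (w3 y) (wt y) (w1t y))
      (fluxX γ (a x) (a1 x) (a2 x) (at' x) (a1t x) (w0 x) (w1 x) (w2 x) (w3 x) (w4 x) (wt x)
        (w1t x) (w2t x)) x := by
  unfold flux
  apply HasDerivAt.congr_deriv
  · repeat' first
      | with_reducible assumption
      | with_reducible apply HasDerivAt.fun_add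
      | with_reducible apply HasDerivAt.fun_sub
      | with_reducible apply HasDerivAt.const_mul
      | with_reducible apply HasDerivAt.fun_mul
      | with_reducible apply HasDerivAt.fun_pow
  · unfold fluxX
    push_cast
    ring

lemma hasDerivAt_dens (ha : HasDerivAt a (at' x) x) (ha1 : HasDerivAt a1 (a1t x) x)
    (h0 : HasDerivAt w0 (wt x) x) (h1 : HasDerivAt w1 (w1t x) x) (h2 : HasDerivAt w2 (w2t x) x) :
    HasDerivAt (fun t => dens γ (a t) (a1 t) (w0 t) (w1 t) (w2 t))
      (densT γ (a x) (a1 x) (at' x) (a1t x) (w0 x) (w1 x) (w2 x) (wt x) (w1t x) (w2t x)) x := by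
  unfold dens
  apply HasDerivAt.congr_deriv
  · repeat' first
      | with_reducible assumption
      | with_reducible apply HasDerivAt.fun_add
      | with_reducible apply HasDerivAt.fun_sub
      | with_reducible apply HasDerivAt.div_const
      | with_reducible apply HasDerivAt.const_mul
      | with_reducible apply HasDerivAt.fun_mul
      | with_reducible apply HasDerivAt.fun_pow
  · unfold densT
    push_cast
    ring

lemma hasDerivAt_locFlux {k₁ k₂ τ : ℝ} {χ χ1 : ℝ → ℝ} (hχ : HasDerivAt χ (χ1 x) x)
    (h0 : HasDerivAt w0 (w1 x) x) (h1 : HasDerivAt w1 (w2 x) x) (h2 : HasDerivAt w2 (w3 x) x)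
    (h3 : HasDerivAt w3 (w4 x) x) :
    HasDerivAt (fun y => locFlux k₁ k₂ τ (χ y) (w0 y) (w1 y) (w2 y) (w3 y))
      (locFluxX k₁ k₂ τ (χ x) (χ1 x) (w0 x) (w1 x) (w2 x) (w3 x) (w4 x)) x := by
  unfold locFlux
  apply HasDerivAt.congr_deriv
  · repeat' first
      | with_reducible assumption
      | with_reducible apply HasDerivAt.fun_add
      | with_reducible apply HasDerivAt.const_mul
      | with_reducible apply HasDerivAt.fun_mul
  · unfold locFluxX
    ring

variable {z0 z1 z2 z3 z4 : ℝ → ℝ}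

lemma hasDerivAt_jet1 (ha : HasDerivAt a (a1 x) x) (h0 : HasDerivAt z0 (z1 x + a x * z0 x) x)
    (h1 : HasDerivAt z1 (z2 x + a x * z1 x) x) :
    HasDerivAt (fun y => jet1 (a y) (z0 y) (z1 y)) (jet2 (a x) (a1 x) (z0 x) (z1 x) (z2 x)) x := by
  unfold jet1
  exact (h1.fun_add (ha.fun_mul h0)).congr_deriv (by unfold jet2; ring)

lemma hasDerivAt_jet2 (ha : HasDerivAt a (a1 x) x) (ha1 : HasDerivAt a1 (a2 x) x)
    (h0 : HasDerivAt z0 (z1 x + a x * z0 x) x) (h1 : HasDerivAt z1 (z2 x + a x * z1 x) x)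
    (h2 : HasDerivAt z2 (z3 x + a x * z2 x) x) :
    HasDerivAt (fun y => jet2 (a y) (a1 y) (z0 y) (z1 y) (z2 y))
      (jet3 (a x) (a1 x) (a2 x) (z0 x) (z1 x) (z2 x) (z3 x)) x := by
  unfold jet2
  exact ((h2.fun_add ((ha.const_mul 2).fun_mul h1)).fun_add
    (((ha.fun_pow 2).fun_add ha1).fun_mul h0)).congr_deriv (by unfold jet3; push_cast; ring)

lemma hasDerivAt_jet3 (ha : HasDerivAt a (a1 x) x) (ha1 : HasDerivAt a1 (a2 x) x)
    (ha2 : HasDerivAt a2 (a3 x) x) (h0 : HasDerivAt z0 (z1 x + a x * z0 x) x)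
    (h1 : HasDerivAt z1 (z2 x + a x * z1 x) x) (h2 : HasDerivAt z2 (z3 x + a x * z2 x) x)
    (h3 : HasDerivAt z3 (z4 x + a x * z3 x) x) :
    HasDerivAt (fun y => jet3 (a y) (a1 y) (a2 y) (z0 y) (z1 y) (z2 y) (z3 y))
      (jet4 (a x) (a1 x) (a2 x) (a3 x) (z0 x) (z1 x) (z2 x) (z3 x) (z4 x)) x := by
  unfold jet3
  apply HasDerivAt.congr_deriv
  · repeat' first
      | with_reducible assumption
      | with_reducible apply HasDerivAt.fun_add
      | with_reducible apply HasDerivAt.const_mul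
      | with_reducible apply HasDerivAt.fun_mul
      | with_reducible apply HasDerivAt.fun_pow
  · unfold jet4
    push_cast
    ring

/-- The derivative of `jet1` along a second variable. -/
def jet1T (a at' z0 zt0 zt1 : ℝ) : ℝ := zt1 + a * zt0 + at' * z0

/-- The derivative of `jet2` along a second variable. -/
def jet2T (a a1 at' a1t z0 z1 zt0 zt1 zt2 : ℝ) : ℝ :=
  zt2 + 2 * a * zt1 + (a ^ 2 + a1) * zt0 + 2 * at' * z1 + (2 * a * at' + a1t) * z0

variable {zt0 zt1 zt2 : ℝ → ℝ}

lemma hasDerivAt_jet1T (ha : HasDerivAt a (a1 x) x) (hat : HasDerivAt at' (a1t x) x)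
    (h0 : HasDerivAt z0 (z1 x + a x * z0 x) x)
    (ht0 : HasDerivAt zt0 (zt1 x + a x * zt0 x + at' x * z0 x) x)
    (ht1 : HasDerivAt zt1 (zt2 x + a x * zt1 x + at' x * z1 x) x) :
    HasDerivAt (fun y => jet1T (a y) (at' y) (z0 y) (zt0 y) (zt1 y))
      (jet2T (a x) (a1 x) (at' x) (a1t x) (z0 x) (z1 x) (zt0 x) (zt1 x) (zt2 x)) x := by
  unfold jet1T
  exact ((ht1.fun_add (ha.fun_mul ht0)).fun_add (hat.fun_mul h0)).congr_deriv
    (by unfold jet2T; ring)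

lemma hasDerivAt_time_jet1 (ha : HasDerivAt a (at' x) x) (h0 : HasDerivAt z0 (zt0 x) x)
    (h1 : HasDerivAt z1 (zt1 x) x) :
    HasDerivAt (fun t => jet1 (a t) (z0 t) (z1 t)) (jet1T (a x) (at' x) (z0 x) (zt0 x) (zt1 x))
      x := by
  unfold jet1
  exact (h1.fun_add (ha.fun_mul h0)).congr_deriv (by unfold jet1T; ring)

lemma hasDerivAt_time_jet2 (ha : HasDerivAt a (at' x) x) (ha1 : HasDerivAt a1 (a1t x) x)
    (h0 : HasDerivAt z0 (zt0 x) x) (h1 : HasDerivAt z1 (zt1 x) x) (h2 : HasDerivAt z2 (zt2 x) x) :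
    HasDerivAt (fun t => jet2 (a t) (a1 t) (z0 t) (z1 t) (z2 t))
      (jet2T (a x) (a1 x) (at' x) (a1t x) (z0 x) (z1 x) (zt0 x) (zt1 x) (zt2 x)) x := by
  unfold jet2
  exact ((h2.fun_add ((ha.const_mul 2).fun_mul h1)).fun_add
    (((ha.fun_pow 2).fun_add ha1).fun_mul h0)).congr_deriv (by unfold jet2T; push_cast; ring)

end Derivatives

section Jets

/-- `V k` and `D k` are the continuous derivatives `∂_x^k v` and `∂_t ∂_x^k v` of a function `v`,
for `k ≤ 4` and `k ≤ 2` respectively. -/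
structure IsJet (V D : ℕ → ℝ → ℝ → ℝ) : Prop where
  continuous_space : ∀ k ≤ 4, Continuous (Function.uncurry (V k))
  continuous_time : ∀ k ≤ 2, Continuous (Function.uncurry (D k))
  hasDerivAt_space : ∀ k < 4, ∀ t x, HasDerivAt (V k t) (V (k + 1) t x) x
  hasDerivAt_time : ∀ k ≤ 2, ∀ t x, HasDerivAt (fun r => V k r x) (D k t x) t
  hasDerivAt_mixed : ∀ k < 2, ∀ t x, HasDerivAt (D k t) (D (k + 1) t x) x

variable {u : ℝ → ℝ → ℝ} {n : ℕ}

lemma hasDerivAt_slice_space (hu : ContDiff ℝ 1 (Function.uncurry u)) (t x : ℝ) :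
    HasDerivAt (u t) (fderiv ℝ (Function.uncurry u) (t, x) (0, 1)) x := by
  have h := ((hu.differentiable one_ne_zero) (t, x)).hasFDerivAt
  exact h.comp_hasDerivAt x ((hasDerivAt_const x t).prodMk (hasDerivAt_id x))

lemma hasDerivAt_slice_time (hu : ContDiff ℝ 1 (Function.uncurry u)) (t x : ℝ) :
    HasDerivAt (fun r => u r x) (fderiv ℝ (Function.uncurry u) (t, x) (1, 0)) t := by
  have h := ((hu.differentiable one_ne_zero) (t, x)).hasFDerivAt
  exact h.comp_hasDerivAt t ((hasDerivAt_id t).prodMk (hasDerivAt_const t x))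

lemma contDiff_deriv_space (hu : ContDiff ℝ (n + 1 : ℕ) (Function.uncurry u)) :
    ContDiff ℝ n (Function.uncurry fun t x => deriv (u t) x) := by
  have h1 : ContDiff ℝ 1 (Function.uncurry u) := hu.of_le (by exact_mod_cast Nat.le_add_left 1 n)
  have : (Function.uncurry fun t x => deriv (u t) x) =
      fun z => fderiv ℝ (Function.uncurry u) z (0, 1) := by
    funext ⟨t, x⟩
    exact (hasDerivAt_slice_space h1 t x).deriv
  rw [this]
  exact (hu.fderiv_right (by norm_cast)).clm_apply contDiff_const

lemma contDiff_deriv_time (hu : ContDiff ℝ (n + 1 : ℕ) (Function.uncurry u)) :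
    ContDiff ℝ n (Function.uncurry fun t x => deriv (fun r => u r x) t) := by
  have h1 : ContDiff ℝ 1 (Function.uncurry u) := hu.of_le (by exact_mod_cast Nat.le_add_left 1 n)
  have : (Function.uncurry fun t x => deriv (fun r => u r x) t) =
      fun z => fderiv ℝ (Function.uncurry u) z (1, 0) := by
    funext ⟨t, x⟩
    exact (hasDerivAt_slice_time h1 t x).deriv
  rw [this]
  exact (hu.fderiv_right (by norm_cast)).clm_apply contDiff_const

lemma hasDerivAt_mixed (hu : ContDiff ℝ 2 (Function.uncurry u)) (t x : ℝ) :
    HasDerivAt (fun y => deriv (fun r => u r y) t) (deriv (fun r => deriv (u r) x) t) x := by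
  have h1 : ContDiff ℝ 1 (Function.uncurry u) := hu.of_le (by norm_num)
  have hf : ContDiff ℝ 1 (fderiv ℝ (Function.uncurry u)) := hu.fderiv_right (by norm_num)
  have hd := ((hf.differentiable one_ne_zero) (t, x)).hasFDerivAt
  have hsymm : IsSymmSndFDerivAt ℝ (Function.uncurry u) (t, x) :=
    hu.contDiffAt.isSymmSndFDerivAt (by simp)
  have e1 : (fun y => deriv (fun r => u r y) t) =
      fun y => fderiv ℝ (Function.uncurry u) (t, y) (1, 0) :=
    funext fun y => (hasDerivAt_slice_time h1 t y).deriv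
  have e2 : (fun r => deriv (u r) x) = fun r => fderiv ℝ (Function.uncurry u) (r, x) (0, 1) :=
    funext fun r => (hasDerivAt_slice_space h1 r x).deriv
  have d1 : HasDerivAt (fun y => fderiv ℝ (Function.uncurry u) (t, y))
      (fderiv ℝ (fderiv ℝ (Function.uncurry u)) (t, x) (0, 1)) x :=
    hd.comp_hasDerivAt x ((hasDerivAt_const x t).prodMk (hasDerivAt_id x))
  have d2 : HasDerivAt (fun r => fderiv ℝ (Function.uncurry u) (r, x))
      (fderiv ℝ (fderiv ℝ (Function.uncurry u)) (t, x) (1, 0)) t :=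
    hd.comp_hasDerivAt t ((hasDerivAt_id t).prodMk (hasDerivAt_const t x))
  have d1' := d1.clm_apply (hasDerivAt_const x ((1, 0) : ℝ × ℝ))
  have d2' := d2.clm_apply (hasDerivAt_const t ((0, 1) : ℝ × ℝ))
  rw [e1, e2, d2'.deriv]
  refine d1'.congr_deriv ?_
  simpa using hsymm.eq (0, 1) (1, 0)

lemma contDiff_iteratedDeriv_space {v : ℝ → ℝ → ℝ} (k : ℕ) :
    ∀ n : ℕ, ContDiff ℝ (n + k : ℕ) (Function.uncurry v) →
      ContDiff ℝ n (Function.uncurry fun t x => iteratedDeriv k (v t) x) := by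
  induction k with
  | zero => intro n h; simpa using h
  | succ k ih =>
    intro n h
    simp only [iteratedDeriv_succ]
    exact contDiff_deriv_space (ih (n + 1) (by convert h using 2; ring))

lemma isJet_of_contDiff {v : ℝ → ℝ → ℝ} (hv : ContDiff ℝ 4 (Function.uncurry v)) :
    IsJet (fun k t x => iteratedDeriv k (v t) x)
      (fun k t x => deriv (fun r => iteratedDeriv k (v r) x) t) := by
  have key : ∀ k n : ℕ, n + k = 4 →
      ContDiff ℝ n (Function.uncurry fun t x => iteratedDeriv k (v t) x) := fun k n h =>
    contDiff_iteratedDeriv_space k n (by rw [h]; exact_mod_cast hv)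
  have key1 : ∀ k < 4, ContDiff ℝ 1 (Function.uncurry fun t x => iteratedDeriv k (v t) x) :=
    fun k hk => (key k (4 - k) (by omega)).of_le (by exact_mod_cast (by omega : 1 ≤ 4 - k))
  refine ⟨fun k hk => (key k (4 - k) (by omega)).continuous, fun k hk => ?_, fun k hk t x => ?_,
    fun k hk t x => ?_, fun k hk t x => ?_⟩
  · have h := key k (3 - k + 1) (by omega)
    exact (contDiff_deriv_time h).continuous
  · have h := hasDerivAt_slice_space (key1 k hk) t x
    simp only [iteratedDeriv_succ]
    exact h.differentiableAt.hasDerivAt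
  · exact (hasDerivAt_slice_time (key1 k (by omega)) t x).differentiableAt.hasDerivAt
  · have h2 : ContDiff ℝ 2 (Function.uncurry fun t x => iteratedDeriv k (v t) x) :=
      (key k (4 - k) (by omega)).of_le (by exact_mod_cast (by omega : 2 ≤ 4 - k))
    simp only [iteratedDeriv_succ]
    exact hasDerivAt_mixed h2 t x

end Jets

section Growth

/-- The singular weight `1 + 1/(t(T-t))` measuring growth at the ends of the time interval. -/
noncomputable def blowup (T t : ℝ) : ℝ := 1 + 1 / (t * (T - t))

/-- Continuous functions on `(0,T) × [0,L]` growing at most polynomially in `1/(t(T-t))`. -/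
def Moderate (T L : ℝ) (u : ℝ → ℝ → ℝ) : Prop :=
  ContinuousOn (Function.uncurry u) (Ioo 0 T ×ˢ Icc 0 L) ∧
    ∃ (k : ℕ) (C : ℝ), ∀ t ∈ Ioo 0 T, ∀ x ∈ Icc 0 L, |u t x| ≤ C * blowup T t ^ k

/-- Continuous functions on `(0,T) × [0,L]` decaying faster than any power of `t(T-t)`. -/
def Rapid (T L : ℝ) (u : ℝ → ℝ → ℝ) : Prop :=
  ContinuousOn (Function.uncurry u) (Ioo 0 T ×ˢ Icc 0 L) ∧
    ∀ k : ℕ, ∃ C : ℝ, ∀ t ∈ Ioo 0 T, ∀ x ∈ Icc 0 L, |u t x| * blowup T t ^ k ≤ C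

variable {T L : ℝ} {u v : ℝ → ℝ → ℝ}

lemma one_le_blowup {t : ℝ} (ht : t ∈ Ioo 0 T) : 1 ≤ blowup T t := by
  have h : 0 < t * (T - t) := mul_pos ht.1 (sub_pos.2 ht.2)
  have : 0 ≤ 1 / (t * (T - t)) := by positivity
  unfold blowup; linarith

lemma Moderate.of_continuousOn_time {h : ℝ → ℝ} (hc : ContinuousOn h (Ioo 0 T)) {k : ℕ} {C : ℝ}
    (hb : ∀ t ∈ Ioo 0 T, |h t| ≤ C * blowup T t ^ k) : Moderate T L fun t _ => h t :=
  ⟨hc.comp continuousOn_fst fun _ hz => hz.1, k, C, fun t ht _ _ => hb t ht⟩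

lemma Moderate.of_continuous (h : Continuous (Function.uncurry u)) : Moderate T L u := by
  obtain ⟨C, hC⟩ := ((isCompact_Icc (a := (0:ℝ)) (b := T)).prod
    (isCompact_Icc (a := (0:ℝ)) (b := L))).exists_bound_of_continuousOn h.continuousOn
  refine ⟨h.continuousOn, 0, C, fun t ht x hx => ?_⟩
  simpa using hC (t, x) ⟨Ioo_subset_Icc_self ht, hx⟩

lemma Moderate.of_continuous_space {h : ℝ → ℝ} (hc : Continuous h) :
    Moderate T L fun _ x => h x :=
  Moderate.of_continuous (hc.comp continuous_snd)

lemma Moderate.const (c : ℝ) : Moderate T L fun _ _ => c :=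
  Moderate.of_continuous continuous_const

lemma Moderate.mul (hu : Moderate T L u) (hv : Moderate T L v) :
    Moderate T L fun t x => u t x * v t x := by
  obtain ⟨hu, k, C, hC⟩ := hu
  obtain ⟨hv, l, D, hD⟩ := hv
  refine ⟨hu.mul hv, k + l, C * D, fun t ht x hx => ?_⟩
  rw [abs_mul]
  calc |u t x| * |v t x| ≤ (C * blowup T t ^ k) * (D * blowup T t ^ l) :=
        mul_le_mul (hC t ht x hx) (hD t ht x hx) (abs_nonneg _)
          ((abs_nonneg _).trans (hC t ht x hx))
    _ = _ := by ring

lemma Moderate.pow (hu : Moderate T L u) (n : ℕ) : Moderate T L fun t x => u t x ^ n := by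
  induction n with
  | zero => simpa using Moderate.const 1
  | succ n ih => simpa only [pow_succ] using ih.mul hu

lemma Moderate.add (hu : Moderate T L u) (hv : Moderate T L v) :
    Moderate T L fun t x => u t x + v t x := by
  obtain ⟨hu, k, C, hC⟩ := hu
  obtain ⟨hv, l, D, hD⟩ := hv
  refine ⟨hu.add hv, k + l, |C| + |D|, fun t ht x hx => ?_⟩
  have h1 := one_le_blowup ht
  calc |u t x + v t x| ≤ |u t x| + |v t x| := abs_add_le _ _
    _ ≤ C * blowup T t ^ k + D * blowup T t ^ l := add_le_add (hC t ht x hx) (hD t ht x hx)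
    _ ≤ |C| * blowup T t ^ (k + l) + |D| * blowup T t ^ (k + l) := by
        gcongr
        · exact le_abs_self C
        · omega
        · exact le_abs_self D
        · omega
    _ = _ := by ring

lemma Rapid.mul_left (hu : Moderate T L u) (hv : Rapid T L v) :
    Rapid T L fun t x => u t x * v t x := by
  obtain ⟨hu, k, C, hC⟩ := hu
  refine ⟨hu.mul hv.1, fun l => ?_⟩
  obtain ⟨D, hD⟩ := hv.2 (k + l)
  refine ⟨|C| * D, fun t ht x hx => ?_⟩
  have h1 := one_le_blowup ht
  have h2 : |u t x| ≤ |C| * blowup T t ^ k :=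
    (hC t ht x hx).trans (by gcongr; exact le_abs_self C)
  rw [abs_mul]
  calc |u t x| * |v t x| * blowup T t ^ l
      ≤ (|C| * blowup T t ^ k) * |v t x| * blowup T t ^ l := by gcongr
    _ = |C| * (|v t x| * blowup T t ^ (k + l)) := by ring
    _ ≤ |C| * D := by gcongr; exact hD t ht x hx

lemma Rapid.moderate (hu : Rapid T L u) : Moderate T L u := by
  obtain ⟨C, hC⟩ := hu.2 0
  exact ⟨hu.1, 0, C, fun t ht x hx => by simpa using hC t ht x hx⟩

lemma Rapid.mul_right (hu : Rapid T L u) (hv : Moderate T L v) :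
    Rapid T L fun t x => u t x * v t x := by
  simpa only [mul_comm] using Rapid.mul_left hv hu

lemma Rapid.pow (hu : Rapid T L u) {n : ℕ} (hn : n ≠ 0) : Rapid T L fun t x => u t x ^ n := by
  obtain ⟨n, rfl⟩ := Nat.exists_eq_succ_of_ne_zero hn
  simpa only [pow_succ] using Rapid.mul_left (hu.moderate.pow n) hu

lemma Rapid.const_mul (hu : Rapid T L u) (c : ℝ) : Rapid T L fun t x => c * u t x :=
  Rapid.mul_left (Moderate.const c) hu

lemma Rapid.div_const (hu : Rapid T L u) (c : ℝ) : Rapid T L fun t x => u t x / c := by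
  simpa only [div_eq_mul_inv] using hu.mul_right (Moderate.const c⁻¹)

lemma Rapid.add (hu : Rapid T L u) (hv : Rapid T L v) : Rapid T L fun t x => u t x + v t x := by
  refine ⟨hu.1.add hv.1, fun k => ?_⟩
  obtain ⟨C, hC⟩ := hu.2 k
  obtain ⟨D, hD⟩ := hv.2 k
  refine ⟨C + D, fun t ht x hx => ?_⟩
  have h1 := one_le_blowup ht
  calc |u t x + v t x| * blowup T t ^ k ≤ (|u t x| + |v t x|) * blowup T t ^ k := by
        gcongr; exact abs_add_le _ _
    _ ≤ C + D := by linarith [hC t ht x hx, hD t ht x hx]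

lemma Rapid.sub (hu : Rapid T L u) (hv : Rapid T L v) : Rapid T L fun t x => u t x - v t x := by
  simpa [sub_eq_add_neg] using hu.add (hv.const_mul (-1))

lemma Rapid.integrableOn (hu : Rapid T L u) :
    IntegrableOn (Function.uncurry u) (Ioo 0 T ×ˢ Ioo 0 L) := by
  obtain ⟨C, hC⟩ := hu.2 0
  have hS : MeasurableSet (Ioo (0:ℝ) T ×ˢ Ioo (0:ℝ) L) := measurableSet_Ioo.prod measurableSet_Ioo
  refine ⟨(hu.1.mono (prod_mono_right Ioo_subset_Icc_self)).aestronglyMeasurable hS,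
    HasFiniteIntegral.restrict_of_bounded C ?_ ?_⟩
  · rw [Measure.volume_eq_prod, Measure.prod_prod]
    exact ENNReal.mul_lt_top (by simp) (by simp)
  · refine (ae_restrict_iff' hS).2 (ae_of_all _ fun z hz => ?_)
    simpa [Function.uncurry] using hC z.1 hz.1 z.2 (Ioo_subset_Icc_self hz.2)

lemma Rapid.exists_abs_le (hu : Rapid T L u) {x : ℝ} (hx : x ∈ Icc 0 L) :
    ∃ C : ℝ, ∀ t ∈ Ioo 0 T, |u t x| ≤ C * (t * (T - t)) := by
  obtain ⟨C, hC⟩ := hu.2 1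
  refine ⟨C, fun t ht => ?_⟩
  have h : 0 < t * (T - t) := mul_pos ht.1 (sub_pos.2 ht.2)
  have h1 := hC t ht x hx
  have h2 : |u t x| * (1 / (t * (T - t))) ≤ C := by
    refine le_trans ?_ h1
    rw [pow_one]
    unfold blowup
    gcongr
    linarith
  rw [mul_one_div, div_le_iff₀ h] at h2
  exact h2

lemma Rapid.tendsto_zero (hT : 0 < T) (hu : Rapid T L u) {x : ℝ} (hx : x ∈ Icc 0 L) :
    Tendsto (fun t => u t x) (𝓝[>] 0) (𝓝 0) := by
  obtain ⟨C, hC⟩ := hu.exists_abs_le hx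
  have h : Tendsto (fun t => C * (t * (T - t))) (𝓝[>] 0) (𝓝 0) := by
    have : ContinuousAt (fun t => C * (t * (T - t))) 0 := by fun_prop
    simpa [ContinuousAt] using this.tendsto.mono_left nhdsWithin_le_nhds
  refine squeeze_zero_norm' ?_ h
  filter_upwards [Ioo_mem_nhdsGT hT] with t ht using hC t ht

lemma Rapid.tendsto_right (hT : 0 < T) (hu : Rapid T L u) {x : ℝ} (hx : x ∈ Icc 0 L) :
    Tendsto (fun t => u t x) (𝓝[<] T) (𝓝 0) := by
  obtain ⟨C, hC⟩ := hu.exists_abs_le hx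
  have h : Tendsto (fun t => C * (t * (T - t))) (𝓝[<] T) (𝓝 0) := by
    have : ContinuousAt (fun t => C * (t * (T - t))) T := by fun_prop
    simpa [ContinuousAt] using this.tendsto.mono_left nhdsWithin_le_nhds
  refine squeeze_zero_norm' ?_ h
  filter_upwards [Ioo_mem_nhdsLT hT] with t ht using hC t ht

/-- The singular time weight `l/(t(T-t))`. -/
noncomputable def timeWeight (l T t : ℝ) : ℝ := l / (t * (T - t))

/-- The derivative of `timeWeight`. -/
noncomputable def timeWeightDeriv (l T t : ℝ) : ℝ := -(l * (T - 2 * t)) / (t * (T - t)) ^ 2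

lemma hasDerivAt_timeWeight (l : ℝ) {t : ℝ} (ht : t ∈ Ioo 0 T) :
    HasDerivAt (timeWeight l T) (timeWeightDeriv l T t) t := by
  have h : t * (T - t) ≠ 0 := (mul_pos ht.1 (sub_pos.2 ht.2)).ne'
  have h1 : HasDerivAt (fun t => t * (T - t)) (T - 2 * t) t :=
    ((hasDerivAt_id t).mul ((hasDerivAt_id t).const_sub T)).congr_deriv (by simp; ring)
  exact ((hasDerivAt_const t l).div h1 h).congr_deriv (by unfold timeWeightDeriv; simp)

lemma continuousOn_timeWeightDeriv (l : ℝ) : ContinuousOn (timeWeightDeriv l T) (Ioo 0 T) := by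
  unfold timeWeightDeriv
  refine ContinuousOn.div (by fun_prop) (by fun_prop) fun t ht => ?_
  have h : 0 < t * (T - t) := mul_pos ht.1 (sub_pos.2 ht.2)
  positivity

lemma moderate_timeWeight {l : ℝ} (hl : 0 < l) : Moderate T L fun t _ => timeWeight l T t := by
  refine Moderate.of_continuousOn_time (k := 1) (C := l)
    (fun t ht => (hasDerivAt_timeWeight l ht).continuousAt.continuousWithinAt) fun t ht => ?_
  have h : 0 < t * (T - t) := mul_pos ht.1 (sub_pos.2 ht.2)
  unfold timeWeight blowup
  rw [abs_of_nonneg (by positivity), pow_one, mul_add, mul_one_div]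
  linarith

lemma moderate_timeWeightDeriv {l : ℝ} (hl : 0 < l) :
    Moderate T L fun t _ => timeWeightDeriv l T t := by
  refine Moderate.of_continuousOn_time (k := 2) (C := l * T)
    (continuousOn_timeWeightDeriv l) fun t ht => ?_
  have h : 0 < t * (T - t) := mul_pos ht.1 (sub_pos.2 ht.2)
  have hT : 0 < T := ht.1.trans ht.2
  have h1 : |T - 2 * t| ≤ T := abs_le.2 ⟨by linarith [ht.2], by linarith [ht.1]⟩
  have h2 : (1 / (t * (T - t))) ^ 2 ≤ blowup T t ^ 2 := by
    unfold blowup; gcongr; linarith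
  unfold timeWeightDeriv
  rw [abs_div, abs_neg, abs_mul, abs_of_pos hl, abs_of_pos (by positivity : 0 < (t * (T - t)) ^ 2)]
  calc l * |T - 2 * t| / (t * (T - t)) ^ 2 ≤ l * T / (t * (T - t)) ^ 2 := by gcongr
    _ = l * T * (1 / (t * (T - t))) ^ 2 := by rw [one_div, inv_pow, div_eq_mul_inv]
    _ ≤ _ := by gcongr

lemma rapid_exp {l : ℝ} (hl : 0 < l) {β : ℝ → ℝ} (hβ : Continuous β) {b : ℝ} (hb : 0 < b)
    (h : ∀ x ∈ Icc 0 L, β x ≤ -b) : Rapid T L fun t x => exp (timeWeight l T t * β x) := by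
  refine ⟨?_, fun k => ?_⟩
  · exact continuous_exp.comp_continuousOn ((moderate_timeWeight hl).mul
      (Moderate.of_continuous_space hβ)).1
  obtain ⟨d, hd⟩ : ∃ d, d = b * l / (k + 1) := ⟨_, rfl⟩
  have hd0 : 0 < d := by rw [hd]; positivity
  obtain ⟨N, hN⟩ : ∃ N, N = 1 + 1 / d := ⟨_, rfl⟩
  have hN1 : 1 ≤ N := by rw [hN]; have : 0 < 1 / d := by positivity
                         linarith
  refine ⟨N ^ k, fun t ht x hx => ?_⟩
  obtain ⟨σ, hσ⟩ : ∃ σ, σ = 1 / (t * (T - t)) := ⟨_, rfl⟩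
  have hσ0 : 0 < σ := by
    rw [hσ]; exact one_div_pos.2 (mul_pos ht.1 (sub_pos.2 ht.2))
  have e1 : timeWeight l T t = l * σ := by rw [hσ]; unfold timeWeight; ring
  have e2 : blowup T t ≤ N * exp (d * σ) := by
    have h1 : d * σ + 1 ≤ exp (d * σ) := add_one_le_exp _
    have h2 : N * (d * σ + 1) ≤ N * exp (d * σ) := by gcongr
    have h3 : N * (d * σ + 1) = d * σ + 1 + σ + 1 / d := by rw [hN]; field_simp; ring
    have h4 : 0 < 1 / d := by positivity
    have h5 : 0 < d * σ := by positivity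
    unfold blowup; rw [← hσ]; linarith
  have e3 : exp (timeWeight l T t * β x) ≤ exp (-(k * (d * σ))) := by
    apply exp_le_exp.2
    have h1 : l * σ * β x ≤ l * σ * (-b) := mul_le_mul_of_nonneg_left (h x hx) (by positivity)
    have h2 : b * l = d * (k + 1) := by rw [hd]; field_simp
    have h3 : l * σ * (-b) = -(d * (k + 1)) * σ := by rw [← h2]; ring
    have h5 : 0 < d * σ := by positivity
    rw [e1]; nlinarith
  rw [abs_of_pos (exp_pos _)]
  calc exp (timeWeight l T t * β x) * blowup T t ^ k
      ≤ exp (-(k * (d * σ))) * (N * exp (d * σ)) ^ k := by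
        have := one_le_blowup ht
        gcongr
    _ = N ^ k := by
        rw [mul_pow, ← exp_nat_mul, mul_left_comm, ← exp_add, neg_add_cancel, exp_zero, mul_one]

end Growth

section Energies

variable {T L γ : ℝ} {a a1 a2 at' a1t w0 w1 w2 w3 w4 wt w1t w2t : ℝ → ℝ → ℝ}

lemma rapid_fluxX (ha : Moderate T L a) (ha1 : Moderate T L a1) (ha2 : Moderate T L a2)
    (hat : Moderate T L at') (ha1t : Moderate T L a1t) (h0 : Rapid T L w0) (h1 : Rapid T L w1)
    (h2 : Rapid T L w2) (h3 : Rapid T L w3) (h4 : Rapid T L w4) (ht : Rapid T L wt)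
    (h1t : Rapid T L w1t) (h2t : Rapid T L w2t) :
    Rapid T L fun t x => fluxX γ (a t x) (a1 t x) (a2 t x) (at' t x) (a1t t x) (w0 t x) (w1 t x)
      (w2 t x) (w3 t x) (w4 t x) (wt t x) (w1t t x) (w2t t x) := by
  unfold fluxX
  repeat' first
    | with_reducible assumption
    | with_reducible apply Moderate.const
    | with_reducible apply Rapid.add
    | with_reducible apply Rapid.sub
    | with_reducible apply Rapid.const_mul
    | with_reducible apply Rapid.mul_left
    | with_reducible refine Rapid.pow ?_ two_ne_zero
    | with_reducible apply Moderate.mul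
    | with_reducible apply Moderate.pow
    | with_reducible apply Rapid.moderate

lemma rapid_densT (ha : Moderate T L a) (ha1 : Moderate T L a1) (hat : Moderate T L at')
    (ha1t : Moderate T L a1t) (h0 : Rapid T L w0) (h1 : Rapid T L w1) (h2 : Rapid T L w2)
    (ht : Rapid T L wt) (h1t : Rapid T L w1t) (h2t : Rapid T L w2t) :
    Rapid T L fun t x => densT γ (a t x) (a1 t x) (at' t x) (a1t t x) (w0 t x) (w1 t x) (w2 t x)
      (wt t x) (w1t t x) (w2t t x) := by
  unfold densT
  repeat' first
    | with_reducible assumption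
    | with_reducible apply Moderate.const
    | with_reducible apply Rapid.add
    | with_reducible apply Rapid.sub
    | with_reducible apply Rapid.const_mul
    | with_reducible apply Rapid.mul_left
    | with_reducible refine Rapid.pow ?_ two_ne_zero
    | with_reducible apply Moderate.mul
    | with_reducible apply Moderate.pow
    | with_reducible apply Rapid.moderate

lemma rapid_dens (ha : Moderate T L a) (ha1 : Moderate T L a1) (h0 : Rapid T L w0)
    (h1 : Rapid T L w1) (h2 : Rapid T L w2) :
    Rapid T L fun t x => dens γ (a t x) (a1 t x) (w0 t x) (w1 t x) (w2 t x) := by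
  unfold dens
  repeat' first
    | with_reducible assumption
    | with_reducible apply Moderate.const
    | with_reducible apply Rapid.add
    | with_reducible apply Rapid.sub
    | with_reducible apply Rapid.div_const
    | with_reducible apply Rapid.const_mul
    | with_reducible apply Rapid.mul_left
    | with_reducible refine Rapid.pow ?_ two_ne_zero
    | with_reducible apply Moderate.mul
    | with_reducible apply Moderate.pow
    | with_reducible apply Rapid.moderate

lemma rapid_locFluxX {k₁ k₂ : ℝ} {τ χ χ1 : ℝ → ℝ → ℝ} (hτ : Moderate T L τ)
    (hχ : Moderate T L χ) (hχ1 : Moderate T L χ1) (h0 : Rapid T L w0) (h1 : Rapid T L w1)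
    (h2 : Rapid T L w2) (h3 : Rapid T L w3) (h4 : Rapid T L w4) :
    Rapid T L fun t x => locFluxX k₁ k₂ (τ t x) (χ t x) (χ1 t x) (w0 t x) (w1 t x) (w2 t x)
      (w3 t x) (w4 t x) := by
  unfold locFluxX
  repeat' first
    | with_reducible assumption
    | with_reducible apply Moderate.const
    | with_reducible apply Rapid.add
    | with_reducible apply Rapid.const_mul
    | with_reducible apply Rapid.mul_left
    | with_reducible refine Rapid.pow ?_ two_ne_zero
    | with_reducible apply Moderate.mul
    | with_reducible apply Moderate.pow
    | with_reducible apply Rapid.moderate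

end Energies

section Integration

variable {T L : ℝ} {F u v : ℝ → ℝ → ℝ}

lemma Rapid.integrable_prod (hu : Rapid T L u) : Integrable (Function.uncurry u)
    ((volume.restrict (Ioo 0 T)).prod (volume.restrict (Ioo 0 L))) := by
  rw [Measure.prod_restrict]
  exact hu.integrableOn

lemma Rapid.slice_space (hu : Rapid T L u) {t : ℝ} (ht : t ∈ Ioo 0 T) :
    ContinuousOn (u t) (Icc 0 L) :=
  hu.1.comp (f := fun x => (t, x)) (by fun_prop) fun _ hx => ⟨ht, hx⟩

lemma Rapid.slice_time (hu : Rapid T L u) {x : ℝ} (hx : x ∈ Icc 0 L) :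
    ContinuousOn (fun t => u t x) (Ioo 0 T) :=
  hu.1.comp (f := fun t => (t, x)) (by fun_prop) fun _ ht => ⟨ht, hx⟩

lemma Rapid.integrableOn_time (hu : Rapid T L u) {x : ℝ} (hx : x ∈ Icc 0 L) :
    IntegrableOn (fun t => u t x) (Ioo 0 T) := by
  obtain ⟨C, hC⟩ := hu.2 0
  refine ⟨(hu.slice_time hx).aestronglyMeasurable measurableSet_Ioo,
    HasFiniteIntegral.restrict_of_bounded C (by simp) ?_⟩
  refine (ae_restrict_iff' measurableSet_Ioo).2 (ae_of_all _ fun t ht => ?_)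
  simpa using hC t ht x hx

lemma integral_space_nonpos (hL : 0 ≤ L) (hu : Rapid T L u)
    (hd : ∀ t ∈ Ioo 0 T, ∀ x ∈ Icc 0 L, HasDerivAt (F t) (u t x) x)
    (hF : ∀ t ∈ Ioo 0 T, F t L ≤ F t 0) : ∫ t in Ioo 0 T, ∫ x in Ioo 0 L, u t x ≤ 0 := by
  refine setIntegral_nonpos measurableSet_Ioo fun t ht => ?_
  have h : ∫ x in (0:ℝ)..L, u t x = F t L - F t 0 :=
    intervalIntegral.integral_eq_sub_of_hasDerivAt
      (fun x hx => hd t ht x (by rwa [uIcc_of_le hL] at hx))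
      ((hu.slice_space ht).intervalIntegrable_of_Icc hL)
  rw [← integral_Ioc_eq_integral_Ioo, ← intervalIntegral.integral_of_le hL, h]
  linarith [hF t ht]

lemma integral_time_eq_zero (hT : 0 < T) (hu : Rapid T L u) (hF : Rapid T L F)
    (hd : ∀ t ∈ Ioo 0 T, ∀ x ∈ Icc 0 L, HasDerivAt (fun r => F r x) (u t x) t) :
    ∫ t in Ioo 0 T, ∫ x in Ioo 0 L, u t x = 0 := by
  rw [integral_integral_swap hu.integrable_prod]
  refine setIntegral_eq_zero_of_forall_eq_zero fun x hx => ?_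
  have hx' := Ioo_subset_Icc_self hx
  have h : ∫ t in (0:ℝ)..T, u t x = 0 - 0 :=
    intervalIntegral.integral_eq_sub_of_hasDerivAt_of_tendsto hT (f := fun t => F t x)
      (fun t ht => hd t ht x hx')
      ((intervalIntegrable_iff_integrableOn_Ioo_of_le hT.le).2 (hu.integrableOn_time hx'))
      (hF.tendsto_zero hT hx') (hF.tendsto_right hT hx')
  rw [← integral_Ioc_eq_integral_Ioo, ← intervalIntegral.integral_of_le hT.le, h, sub_zero]

lemma integral_mono_rapid (hu : Rapid T L u) (hv : Rapid T L v)
    (h : ∀ t ∈ Ioo 0 T, ∀ x ∈ Ioo 0 L, u t x ≤ v t x) :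
    ∫ t in Ioo 0 T, ∫ x in Ioo 0 L, u t x ≤ ∫ t in Ioo 0 T, ∫ x in Ioo 0 L, v t x := by
  refine setIntegral_mono_on hu.integrable_prod.integral_prod_left
    hv.integrable_prod.integral_prod_left measurableSet_Ioo fun t ht => ?_
  exact setIntegral_mono_on (((hu.slice_space ht).integrableOn_Icc).mono_set Ioo_subset_Icc_self)
    (((hv.slice_space ht).integrableOn_Icc).mono_set Ioo_subset_Icc_self)
    measurableSet_Ioo fun x hx => h t ht x hx

lemma integral_add_rapid (hu : Rapid T L u) (hv : Rapid T L v) :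
    ∫ t in Ioo 0 T, ∫ x in Ioo 0 L, (u t x + v t x) =
      (∫ t in Ioo 0 T, ∫ x in Ioo 0 L, u t x) + ∫ t in Ioo 0 T, ∫ x in Ioo 0 L, v t x :=
  integral_integral_add hu.integrable_prod hv.integrable_prod

lemma integral_const_mul_rapid (c : ℝ) (u : ℝ → ℝ → ℝ) :
    ∫ t in Ioo 0 T, ∫ x in Ioo 0 L, c * u t x = c * ∫ t in Ioo 0 T, ∫ x in Ioo 0 L, u t x := by
  simp only [integral_const_mul]

end Integration

section Conjugation

/-- The exponential weight `exp (τ(t)(α(x) - κ))`. -/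
noncomputable def expWeight (l T κ : ℝ) (α : ℝ → ℝ) (t x : ℝ) : ℝ :=
  exp (timeWeight l T t * (α x - κ))

/-- The conjugated jet in space. -/
noncomputable def conjJet (l T κ : ℝ) (α : ℝ → ℝ) (V : ℕ → ℝ → ℝ → ℝ) (k : ℕ) (t x : ℝ) : ℝ :=
  expWeight l T κ α t x * V k t x

/-- The time derivative of the conjugated jet. -/
noncomputable def conjJetT (l T κ : ℝ) (α : ℝ → ℝ) (V D : ℕ → ℝ → ℝ → ℝ) (k : ℕ)
    (t x : ℝ) : ℝ :=
  timeWeightDeriv l T t * (α x - κ) * conjJet l T κ α V k t x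
    + expWeight l T κ α t x * D k t x

variable {L T κ l α1 t x : ℝ} {α : ℝ → ℝ} {V D : ℕ → ℝ → ℝ → ℝ} {k : ℕ}

lemma hasDerivAt_expWeight (hα : HasDerivAt α α1 x) :
    HasDerivAt (expWeight l T κ α t) (timeWeight l T t * α1 * expWeight l T κ α t x) x :=
  (((hα.sub_const κ).const_mul (timeWeight l T t)).exp).congr_deriv (mul_comm _ _)

lemma hasDerivAt_expWeight_time (ht : t ∈ Ioo 0 T) :
    HasDerivAt (fun r => expWeight l T κ α r x)
      (timeWeightDeriv l T t * (α x - κ) * expWeight l T κ α t x) t :=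
  (((hasDerivAt_timeWeight l ht).mul_const (α x - κ)).exp).congr_deriv (mul_comm _ _)

lemma hasDerivAt_conjJet (hV : IsJet V D) (hk : k < 4) (hα : HasDerivAt α α1 x) :
    HasDerivAt (conjJet l T κ α V k t)
      (conjJet l T κ α V (k + 1) t x + timeWeight l T t * α1 * conjJet l T κ α V k t x) x := by
  refine ((hasDerivAt_expWeight (l := l) (T := T) (κ := κ) (t := t) hα).mul
    (hV.hasDerivAt_space k hk t x)).congr_deriv ?_
  unfold conjJet; ring

lemma hasDerivAt_conjJet_time (hV : IsJet V D) (hk : k ≤ 2) (ht : t ∈ Ioo 0 T) :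
    HasDerivAt (fun r => conjJet l T κ α V k r x) (conjJetT l T κ α V D k t x) t := by
  refine ((hasDerivAt_expWeight_time (l := l) (κ := κ) (α := α) (x := x) ht).mul
    (hV.hasDerivAt_time k hk t x)).congr_deriv ?_
  unfold conjJetT conjJet; ring

lemma hasDerivAt_conjJetT (hV : IsJet V D) (hk : k < 2) (hα : HasDerivAt α α1 x) :
    HasDerivAt (conjJetT l T κ α V D k t)
      (conjJetT l T κ α V D (k + 1) t x + timeWeight l T t * α1 * conjJetT l T κ α V D k t x
        + timeWeightDeriv l T t * α1 * conjJet l T κ α V k t x) x := by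
  refine ((((hα.sub_const κ).const_mul (timeWeightDeriv l T t)).mul
    (hasDerivAt_conjJet (l := l) (T := T) (κ := κ) (t := t) hV (by omega : k < 4) hα)).add
    ((hasDerivAt_expWeight (l := l) (T := T) (κ := κ) (t := t) hα).mul
      (hV.hasDerivAt_mixed k hk t x))).congr_deriv ?_
  unfold conjJetT; ring

lemma rapid_expWeight (hl : 0 < l) (hα : Continuous α) {b : ℝ} (hb : 0 < b)
    (h : ∀ x ∈ Icc 0 L, α x - κ ≤ -b) : Rapid T L (expWeight l T κ α) :=
  rapid_exp hl (hα.sub continuous_const) hb h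

lemma rapid_conjJet (he : Rapid T L (expWeight l T κ α)) (hV : IsJet V D) (hk : k ≤ 4) :
    Rapid T L (conjJet l T κ α V k) :=
  he.mul_right (Moderate.of_continuous (hV.continuous_space k hk))

lemma rapid_conjJetT (hl : 0 < l) (hα : Continuous α) (he : Rapid T L (expWeight l T κ α))
    (hV : IsJet V D) (hk : k ≤ 2) : Rapid T L (conjJetT l T κ α V D k) :=
  (Rapid.mul_left ((moderate_timeWeightDeriv hl).mul
    (Moderate.of_continuous_space (hα.sub continuous_const)))
    (rapid_conjJet he hV (by omega))).add
    (he.mul_right (Moderate.of_continuous (hV.continuous_time k hk)))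

lemma IsJet.time_eq_zero (hV : IsJet V D) (hk : k ≤ 2) (h : ∀ t ∈ Ioo 0 T, V k t x = 0)
    (ht : t ∈ Ioo 0 T) : D k t x = 0 := by
  refine (hV.hasDerivAt_time k hk t x).unique ((hasDerivAt_const t (0:ℝ)).congr_of_eventuallyEq ?_)
  filter_upwards [isOpen_Ioo.mem_nhds ht] with r hr using h r hr

end Conjugation

section Divergence

variable {T L γ k₁ k₂ μ : ℝ} {a a1 a2 at' a1t w0 w1 w2 w3 w4 wt w1t w2t τ χ χ1 : ℝ → ℝ → ℝ}

lemma integral_sub_two_mul_nonpos {F G u v : ℝ → ℝ → ℝ} (hT : 0 < T) (hL : 0 < L)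
    (hu : Rapid T L u) (hv : Rapid T L v) (hG : Rapid T L G)
    (dF : ∀ t ∈ Ioo 0 T, ∀ x ∈ Icc 0 L, HasDerivAt (F t) (u t x) x)
    (dG : ∀ t ∈ Ioo 0 T, ∀ x ∈ Icc 0 L, HasDerivAt (fun r => G r x) (v t x) t)
    (hF : ∀ t ∈ Ioo 0 T, F t L ≤ F t 0) :
    Rapid T L (fun t x => u t x - 2 * v t x) ∧
      ∫ t in Ioo 0 T, ∫ x in Ioo 0 L, (u t x - 2 * v t x) ≤ 0 := by
  refine ⟨hu.sub (hv.const_mul 2), ?_⟩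
  have h : ∫ t in Ioo 0 T, ∫ x in Ioo 0 L, (u t x - 2 * v t x) = _ :=
    integral_integral_sub hu.integrable_prod (hv.const_mul 2).integrable_prod
  refine h.le.trans ?_
  simp only [Function.uncurry_apply_pair]
  rw [integral_const_mul_rapid, integral_time_eq_zero hT hv hG dG, mul_zero, sub_zero]
  exact integral_space_nonpos hL.le hu dF hF

lemma integral_divergence_nonpos (hT : 0 < T) (hL : 0 < L)
    (ma : Moderate T L a) (ma1 : Moderate T L a1)
    (ma2 : Moderate T L a2) (mat : Moderate T L at') (ma1t : Moderate T L a1t)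
    (mτ : Moderate T L τ) (mχ : Moderate T L χ) (mχ1 : Moderate T L χ1)
    (r0 : Rapid T L w0) (r1 : Rapid T L w1) (r2 : Rapid T L w2) (r3 : Rapid T L w3)
    (r4 : Rapid T L w4) (rt : Rapid T L wt) (r1t : Rapid T L w1t) (r2t : Rapid T L w2t)
    (da : ∀ t ∈ Ioo 0 T, ∀ x ∈ Icc 0 L, HasDerivAt (a t) (a1 t x) x)
    (da1 : ∀ t ∈ Ioo 0 T, ∀ x ∈ Icc 0 L, HasDerivAt (a1 t) (a2 t x) x)
    (dat : ∀ t ∈ Ioo 0 T, ∀ x ∈ Icc 0 L, HasDerivAt (at' t) (a1t t x) x)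
    (dχ : ∀ t ∈ Ioo 0 T, ∀ x ∈ Icc 0 L, HasDerivAt (χ t) (χ1 t x) x)
    (hτ : ∀ t ∈ Ioo 0 T, ∀ x, τ t x = τ t 0)
    (d0 : ∀ t ∈ Ioo 0 T, ∀ x ∈ Icc 0 L, HasDerivAt (w0 t) (w1 t x) x)
    (d1 : ∀ t ∈ Ioo 0 T, ∀ x ∈ Icc 0 L, HasDerivAt (w1 t) (w2 t x) x)
    (d2 : ∀ t ∈ Ioo 0 T, ∀ x ∈ Icc 0 L, HasDerivAt (w2 t) (w3 t x) x)
    (d3 : ∀ t ∈ Ioo 0 T, ∀ x ∈ Icc 0 L, HasDerivAt (w3 t) (w4 t x) x)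
    (dt : ∀ t ∈ Ioo 0 T, ∀ x ∈ Icc 0 L, HasDerivAt (wt t) (w1t t x) x)
    (d1t : ∀ t ∈ Ioo 0 T, ∀ x ∈ Icc 0 L, HasDerivAt (w1t t) (w2t t x) x)
    (ta : ∀ t ∈ Ioo 0 T, ∀ x ∈ Icc 0 L, HasDerivAt (fun r => a r x) (at' t x) t)
    (ta1 : ∀ t ∈ Ioo 0 T, ∀ x ∈ Icc 0 L, HasDerivAt (fun r => a1 r x) (a1t t x) t)
    (t0 : ∀ t ∈ Ioo 0 T, ∀ x ∈ Icc 0 L, HasDerivAt (fun r => w0 r x) (wt t x) t)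
    (t1 : ∀ t ∈ Ioo 0 T, ∀ x ∈ Icc 0 L, HasDerivAt (fun r => w1 r x) (w1t t x) t)
    (t2 : ∀ t ∈ Ioo 0 T, ∀ x ∈ Icc 0 L, HasDerivAt (fun r => w2 r x) (w2t t x) t)
    (hχ0 : ∀ t ∈ Ioo 0 T, χ t 0 = 0) (hχL : ∀ t ∈ Ioo 0 T, χ t L = 0)
    (hb0 : ∀ t ∈ Ioo 0 T, flux γ (a t 0) (a1 t 0) (at' t 0) (w0 t 0) (w1 t 0) (w2 t 0) (w3 t 0)
      (wt t 0) (w1t t 0) ≤ 0)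
    (hbL : ∀ t ∈ Ioo 0 T, 0 ≤ flux γ (a t L) (a1 t L) (at' t L) (w0 t L) (w1 t L) (w2 t L)
      (w3 t L) (wt t L) (w1t t L)) :
    Rapid T L (fun t x => (μ * locFluxX k₁ k₂ (τ t x) (χ t x) (χ1 t x) (w0 t x) (w1 t x) (w2 t x)
        (w3 t x) (w4 t x)
      - 2 * fluxX γ (a t x) (a1 t x) (a2 t x) (at' t x) (a1t t x) (w0 t x) (w1 t x) (w2 t x)
        (w3 t x) (w4 t x) (wt t x) (w1t t x) (w2t t x))
      - 2 * densT γ (a t x) (a1 t x) (at' t x) (a1t t x) (w0 t x) (w1 t x) (w2 t x) (wt t x)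
        (w1t t x) (w2t t x)) ∧
    ∫ t in Ioo 0 T, ∫ x in Ioo 0 L,
      ((μ * locFluxX k₁ k₂ (τ t x) (χ t x) (χ1 t x) (w0 t x) (w1 t x) (w2 t x) (w3 t x) (w4 t x)
      - 2 * fluxX γ (a t x) (a1 t x) (a2 t x) (at' t x) (a1t t x) (w0 t x) (w1 t x) (w2 t x)
        (w3 t x) (w4 t x) (wt t x) (w1t t x) (w2t t x))
      - 2 * densT γ (a t x) (a1 t x) (at' t x) (a1t t x) (w0 t x) (w1 t x) (w2 t x) (wt t x)
        (w1t t x) (w2t t x)) ≤ 0 := by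
  have rX := rapid_fluxX (γ := γ) ma ma1 ma2 mat ma1t r0 r1 r2 r3 r4 rt r1t r2t
  have rL := rapid_locFluxX (k₁ := k₁) (k₂ := k₂) mτ mχ mχ1 r0 r1 r2 r3 r4
  have rT := rapid_densT (γ := γ) ma ma1 mat ma1t r0 r1 r2 rt r1t r2t
  have rG := rapid_dens (γ := γ) ma ma1 r0 r1 r2
  have key := integral_sub_two_mul_nonpos hT hL
    (F := fun t x => μ * locFlux k₁ k₂ (τ t 0) (χ t x) (w0 t x) (w1 t x) (w2 t x) (w3 t x)
      - 2 * flux γ (a t x) (a1 t x) (at' t x) (w0 t x) (w1 t x) (w2 t x) (w3 t x) (wt t x)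
        (w1t t x))
    ((rL.const_mul μ).sub (rX.const_mul 2)) rT rG
  refine key
    (fun t ht x hx => ?_) (fun t ht x hx => ?_) (fun t ht => ?_)
  · have h1 := hasDerivAt_locFlux (k₁ := k₁) (k₂ := k₂) (τ := τ t 0) (dχ t ht x hx)
      (d0 t ht x hx) (d1 t ht x hx) (d2 t ht x hx) (d3 t ht x hx)
    have h2 := hasDerivAt_flux (γ := γ) (da t ht x hx) (da1 t ht x hx) (dat t ht x hx)
      (d0 t ht x hx) (d1 t ht x hx) (d2 t ht x hx) (d3 t ht x hx) (dt t ht x hx)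
      (d1t t ht x hx)
    rw [hτ t ht x]
    exact (h1.const_mul μ).fun_sub (h2.const_mul 2)
  · exact hasDerivAt_dens (x := t) (a := fun r => a r x) (a1 := fun r => a1 r x)
      (at' := fun r => at' r x) (a1t := fun r => a1t r x) (w0 := fun r => w0 r x)
      (w1 := fun r => w1 r x) (w2 := fun r => w2 r x) (wt := fun r => wt r x)
      (w1t := fun r => w1t r x) (w2t := fun r => w2t r x) (ta t ht x hx) (ta1 t ht x hx)
      (t0 t ht x hx) (t1 t ht x hx) (t2 t ht x hx)
  · have h1 := hb0 t ht
    have h2 := hbL t ht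
    simp only [locFlux, hχ0 t ht, hχL t ht, zero_mul, mul_zero]
    linarith

end Divergence

section ConjugatedSolution

/-- The weight `A 0` with its derivatives `A k`, `k ≤ 4`, and the cutoff `χ` with derivative `χ1`
satisfy the positivity conditions of the Carleman estimate on `[0,L]`, with constants `R`, `c`. -/
structure AdmissibleWeight (L κ R c : ℝ) (A : ℕ → ℝ → ℝ) (χ χ1 : ℝ → ℝ) : Prop where
  one_le_bound : 1 ≤ R
  pos : 0 < c
  le_one : c ≤ 1
  continuous : ∀ k ≤ 4, Continuous (A k)
  hasDerivAt : ∀ k < 4, ∀ x, HasDerivAt (A k) (A (k + 1) x) x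
  abs_le : ∀ k ≤ 4, ∀ x ∈ Icc 0 L, |A k x| ≤ R
  abs_sub_le : ∀ x ∈ Icc 0 L, |A 0 x - κ| ≤ R
  exists_neg : ∃ b > 0, ∀ x ∈ Icc 0 L, A 0 x - κ ≤ -b
  left : c ≤ A 1 0
  right : A 1 L ≤ -c
  continuous_cutoff : Continuous χ
  continuous_cutoff_deriv : Continuous χ1
  hasDerivAt_cutoff : ∀ x, HasDerivAt χ (χ1 x) x
  cutoff_nonneg : ∀ x, 0 ≤ χ x
  cutoff_le_one : ∀ x, χ x ≤ 1
  abs_cutoff_deriv_le : ∀ x ∈ Icc 0 L, |χ1 x| ≤ R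
  cutoff_left : χ 0 = 0
  cutoff_right : χ L = 0
  lower : ∀ x ∈ Icc 0 L, χ x = 1 ∨ c ≤ A 2 x ∧ c ≤ |A 1 x|

variable {L T κ R c l γ s t x : ℝ} {A : ℕ → ℝ → ℝ} {χ χ1 : ℝ → ℝ} {V D : ℕ → ℝ → ℝ → ℝ}

/-- The product of the time weight and a function of space. -/
noncomputable def weightCoeff (l T : ℝ) (α : ℝ → ℝ) (t x : ℝ) : ℝ := timeWeight l T t * α x

/-- The time derivative of `weightCoeff`. -/
noncomputable def weightCoeffT (l T : ℝ) (α : ℝ → ℝ) (t x : ℝ) : ℝ := timeWeightDeriv l T t * α x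

/-- The space derivative of the conjugated solution. -/
noncomputable def conj1 (l T κ : ℝ) (A : ℕ → ℝ → ℝ) (V : ℕ → ℝ → ℝ → ℝ) (t x : ℝ) : ℝ :=
  jet1 (weightCoeff l T (A 1) t x) (conjJet l T κ (A 0) V 0 t x) (conjJet l T κ (A 0) V 1 t x)

/-- The second space derivative of the conjugated solution. -/
noncomputable def conj2 (l T κ : ℝ) (A : ℕ → ℝ → ℝ) (V : ℕ → ℝ → ℝ → ℝ) (t x : ℝ) : ℝ :=
  jet2 (weightCoeff l T (A 1) t x) (weightCoeff l T (A 2) t x) (conjJet l T κ (A 0) V 0 t x)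
    (conjJet l T κ (A 0) V 1 t x) (conjJet l T κ (A 0) V 2 t x)

/-- The third space derivative of the conjugated solution. -/
noncomputable def conj3 (l T κ : ℝ) (A : ℕ → ℝ → ℝ) (V : ℕ → ℝ → ℝ → ℝ) (t x : ℝ) : ℝ :=
  jet3 (weightCoeff l T (A 1) t x) (weightCoeff l T (A 2) t x) (weightCoeff l T (A 3) t x)
    (conjJet l T κ (A 0) V 0 t x) (conjJet l T κ (A 0) V 1 t x) (conjJet l T κ (A 0) V 2 t x)
    (conjJet l T κ (A 0) V 3 t x)

/-- The fourth space derivative of the conjugated solution. -/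
noncomputable def conj4 (l T κ : ℝ) (A : ℕ → ℝ → ℝ) (V : ℕ → ℝ → ℝ → ℝ) (t x : ℝ) : ℝ :=
  jet4 (weightCoeff l T (A 1) t x) (weightCoeff l T (A 2) t x) (weightCoeff l T (A 3) t x)
    (weightCoeff l T (A 4) t x)
    (conjJet l T κ (A 0) V 0 t x) (conjJet l T κ (A 0) V 1 t x) (conjJet l T κ (A 0) V 2 t x)
    (conjJet l T κ (A 0) V 3 t x) (conjJet l T κ (A 0) V 4 t x)

/-- The time derivative of `conj1`. -/
noncomputable def conj1T (l T κ : ℝ) (A : ℕ → ℝ → ℝ) (V D : ℕ → ℝ → ℝ → ℝ) (t x : ℝ) : ℝ :=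
  jet1T (weightCoeff l T (A 1) t x) (weightCoeffT l T (A 1) t x) (conjJet l T κ (A 0) V 0 t x)
    (conjJetT l T κ (A 0) V D 0 t x) (conjJetT l T κ (A 0) V D 1 t x)

/-- The time derivative of `conj2`. -/
noncomputable def conj2T (l T κ : ℝ) (A : ℕ → ℝ → ℝ) (V D : ℕ → ℝ → ℝ → ℝ) (t x : ℝ) : ℝ :=
  jet2T (weightCoeff l T (A 1) t x) (weightCoeff l T (A 2) t x) (weightCoeffT l T (A 1) t x)
    (weightCoeffT l T (A 2) t x) (conjJet l T κ (A 0) V 0 t x) (conjJet l T κ (A 0) V 1 t x)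
    (conjJetT l T κ (A 0) V D 0 t x) (conjJetT l T κ (A 0) V D 1 t x)
    (conjJetT l T κ (A 0) V D 2 t x)

lemma moderate_weightCoeff (hl : 0 < l) {α : ℝ → ℝ} (hα : Continuous α) :
    Moderate T L (weightCoeff l T α) :=
  (moderate_timeWeight hl).mul (Moderate.of_continuous_space hα)

lemma moderate_weightCoeffT (hl : 0 < l) {α : ℝ → ℝ} (hα : Continuous α) :
    Moderate T L (weightCoeffT l T α) :=
  (moderate_timeWeightDeriv hl).mul (Moderate.of_continuous_space hα)

lemma AdmissibleWeight.hasDerivAt_weightCoeff (hw : AdmissibleWeight L κ R c A χ χ1) {k : ℕ}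
    (hk : k < 4) : HasDerivAt (weightCoeff l T (A k) t) (weightCoeff l T (A (k + 1)) t x) x :=
  (hw.hasDerivAt k hk x).const_mul _

lemma AdmissibleWeight.hasDerivAt_weightCoeffT (hw : AdmissibleWeight L κ R c A χ χ1) {k : ℕ}
    (hk : k < 4) : HasDerivAt (weightCoeffT l T (A k) t) (weightCoeffT l T (A (k + 1)) t x) x :=
  (hw.hasDerivAt k hk x).const_mul _

lemma hasDerivAt_weightCoeff_time (ht : t ∈ Ioo 0 T) (α : ℝ → ℝ) :
    HasDerivAt (fun r => weightCoeff l T α r x) (weightCoeffT l T α t x) t :=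
  (hasDerivAt_timeWeight l ht).mul_const _

lemma AdmissibleWeight.rapid_conjJet (hw : AdmissibleWeight L κ R c A χ χ1) (hl : 0 < l)
    (hV : IsJet V D) : (∀ k ≤ 4, Rapid T L (conjJet l T κ (A 0) V k)) ∧
      ∀ k ≤ 2, Rapid T L (conjJetT l T κ (A 0) V D k) := by
  obtain ⟨b, hb, h⟩ := hw.exists_neg
  have he := rapid_expWeight (T := T) hl (hw.continuous 0 (by norm_num)) hb h
  exact ⟨fun k hk => CarlemanFourth.rapid_conjJet he hV hk,
    fun k hk => rapid_conjJetT hl (hw.continuous 0 (by norm_num)) he hV hk⟩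

lemma AdmissibleWeight.rapid_conj (hw : AdmissibleWeight L κ R c A χ χ1) (hl : 0 < l)
    (hV : IsJet V D) : Rapid T L (conj1 l T κ A V) ∧ Rapid T L (conj2 l T κ A V) ∧
      Rapid T L (conj3 l T κ A V) ∧ Rapid T L (conj4 l T κ A V) ∧
      Rapid T L (conj1T l T κ A V D) ∧ Rapid T L (conj2T l T κ A V D) := by
  obtain ⟨hz, hzt⟩ := hw.rapid_conjJet (T := T) hl hV
  have m : ∀ k ≤ 4, Moderate T L (weightCoeff l T (A k)) := fun k hk =>
    moderate_weightCoeff hl (hw.continuous k hk)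
  have mt : ∀ k ≤ 4, Moderate T L (weightCoeffT l T (A k)) := fun k hk =>
    moderate_weightCoeffT hl (hw.continuous k hk)
  have m1 := m 1 (by norm_num)
  have m2 := m 2 (by norm_num)
  have m3 := m 3 (by norm_num)
  have m4 := m 4 (by norm_num)
  have mt1 := mt 1 (by norm_num)
  have mt2 := mt 2 (by norm_num)
  have z0 := hz 0 (by norm_num)
  have z1 := hz 1 (by norm_num)
  have z2 := hz 2 (by norm_num)
  have z3 := hz 3 (by norm_num)
  have z4 := hz 4 (by norm_num)
  have zt0 := hzt 0 (by norm_num)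
  have zt1 := hzt 1 (by norm_num)
  have zt2 := hzt 2 (by norm_num)
  unfold conj1 conj2 conj3 conj4 conj1T conj2T jet1 jet2 jet3 jet4 jet1T jet2T
  refine ⟨?_, ?_, ?_, ?_, ?_, ?_⟩
  all_goals
    repeat' first
      | with_reducible assumption
      | with_reducible apply Moderate.const
      | with_reducible apply Rapid.add
      | with_reducible apply Rapid.mul_left
      | with_reducible apply Moderate.add
      | with_reducible apply Moderate.mul
      | with_reducible apply Moderate.pow

lemma AdmissibleWeight.hasDerivAt_conj (hw : AdmissibleWeight L κ R c A χ χ1)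
    (hV : IsJet V D) (t x : ℝ) :
    HasDerivAt (conjJet l T κ (A 0) V 0 t) (conj1 l T κ A V t x) x ∧
    HasDerivAt (conj1 l T κ A V t) (conj2 l T κ A V t x) x ∧
    HasDerivAt (conj2 l T κ A V t) (conj3 l T κ A V t x) x ∧
    HasDerivAt (conj3 l T κ A V t) (conj4 l T κ A V t x) x ∧
    HasDerivAt (conjJetT l T κ (A 0) V D 0 t) (conj1T l T κ A V D t x) x ∧
    HasDerivAt (conj1T l T κ A V D t) (conj2T l T κ A V D t x) x := by
  have h0 := hw.hasDerivAt 0 (by norm_num) x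
  have d1 := hw.hasDerivAt_weightCoeff (l := l) (T := T) (t := t) (x := x) (k := 1) (by norm_num)
  have d2 := hw.hasDerivAt_weightCoeff (l := l) (T := T) (t := t) (x := x) (k := 2) (by norm_num)
  have d3 := hw.hasDerivAt_weightCoeff (l := l) (T := T) (t := t) (x := x) (k := 3) (by norm_num)
  have dt := hw.hasDerivAt_weightCoeffT (l := l) (T := T) (t := t) (x := x) (k := 1) (by norm_num)
  have hz : ∀ k < 4, HasDerivAt (conjJet l T κ (A 0) V k t)
      (conjJet l T κ (A 0) V (k + 1) t x
        + weightCoeff l T (A 1) t x * conjJet l T κ (A 0) V k t x) x :=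
    fun k hk => hasDerivAt_conjJet hV hk h0
  have hzt : ∀ k < 2, HasDerivAt (conjJetT l T κ (A 0) V D k t)
      (conjJetT l T κ (A 0) V D (k + 1) t x
        + weightCoeff l T (A 1) t x * conjJetT l T κ (A 0) V D k t x
        + weightCoeffT l T (A 1) t x * conjJet l T κ (A 0) V k t x) x :=
    fun k hk => hasDerivAt_conjJetT hV hk h0
  have z0 := hz 0 (by norm_num)
  have z1 := hz 1 (by norm_num)
  have z2 := hz 2 (by norm_num)
  have z3 := hz 3 (by norm_num)
  have zt0 := hzt 0 (by norm_num)
  have zt1 := hzt 1 (by norm_num)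
  exact ⟨z0, hasDerivAt_jet1 d1 z0 z1, hasDerivAt_jet2 d1 d2 z0 z1 z2,
    hasDerivAt_jet3 d1 d2 d3 z0 z1 z2 z3, zt0, hasDerivAt_jet1T d1 dt z0 zt0 zt1⟩

lemma hasDerivAt_conj_time (A : ℕ → ℝ → ℝ) (hV : IsJet V D) (ht : t ∈ Ioo 0 T) (x : ℝ) :
    HasDerivAt (fun r => conj1 l T κ A V r x) (conj1T l T κ A V D t x) t ∧
    HasDerivAt (fun r => conj2 l T κ A V r x) (conj2T l T κ A V D t x) t := by
  have d1 := hasDerivAt_weightCoeff_time (l := l) (x := x) ht (A 1)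
  have d2 := hasDerivAt_weightCoeff_time (l := l) (x := x) ht (A 2)
  have z0 := hasDerivAt_conjJet_time (l := l) (κ := κ) (α := A 0) (x := x) hV (k := 0)
    (by norm_num) ht
  have z1 := hasDerivAt_conjJet_time (l := l) (κ := κ) (α := A 0) (x := x) hV (k := 1)
    (by norm_num) ht
  have z2 := hasDerivAt_conjJet_time (l := l) (κ := κ) (α := A 0) (x := x) hV (k := 2)
    (by norm_num) ht
  exact ⟨hasDerivAt_time_jet1 (x := t) (at' := fun r => weightCoeffT l T (A 1) r x)
      (zt0 := fun r => conjJetT l T κ (A 0) V D 0 r x)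
      (zt1 := fun r => conjJetT l T κ (A 0) V D 1 r x) d1 z0 z1,
    hasDerivAt_time_jet2 (x := t) (at' := fun r => weightCoeffT l T (A 1) r x)
      (a1t := fun r => weightCoeffT l T (A 2) r x)
      (zt0 := fun r => conjJetT l T κ (A 0) V D 0 r x)
      (zt1 := fun r => conjJetT l T κ (A 0) V D 1 r x)
      (zt2 := fun r => conjJetT l T κ (A 0) V D 2 r x) d1 d2 z0 z1 z2⟩

lemma exists_timeWeightDeriv_eq (hl : 1 ≤ l) (hTR : T ^ 3 ≤ R) (ht : t ∈ Ioo 0 T) :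
    ∃ e : ℝ, |e| ≤ R ∧ timeWeightDeriv l T t = timeWeight l T t ^ 3 * e := by
  have h : 0 < t * (T - t) := mul_pos ht.1 (sub_pos.2 ht.2)
  have hT : 0 < T := ht.1.trans ht.2
  have hl0 : 0 < l := zero_lt_one.trans_le hl
  refine ⟨-((T - 2 * t) * (t * (T - t))) / l ^ 2, ?_, ?_⟩
  · rw [abs_div, abs_neg, abs_mul, abs_of_pos h, abs_of_pos (by positivity : 0 < l ^ 2)]
    have h1 : |T - 2 * t| ≤ T := abs_le.2 ⟨by linarith [ht.2], by linarith [ht.1]⟩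
    have h2 : t * (T - t) ≤ T ^ 2 := by nlinarith [ht.1, ht.2]
    calc |T - 2 * t| * (t * (T - t)) / l ^ 2 ≤ |T - 2 * t| * (t * (T - t)) :=
          div_le_self (by positivity) (one_le_pow₀ hl)
      _ ≤ T * T ^ 2 := by gcongr
      _ ≤ R := by linarith
  · have : T - t ≠ 0 := (sub_pos.2 ht.2).ne'
    have := ht.1.ne'
    unfold timeWeightDeriv timeWeight
    field_simp

lemma le_timeWeight {τ₀ : ℝ} (hτ₀ : 0 ≤ τ₀) (hl : τ₀ * T ^ 2 ≤ l) (ht : t ∈ Ioo 0 T) :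
    τ₀ ≤ timeWeight l T t := by
  have h : 0 < t * (T - t) := mul_pos ht.1 (sub_pos.2 ht.2)
  have h2 : t * (T - t) ≤ T ^ 2 := by nlinarith [ht.1, ht.2]
  unfold timeWeight
  rw [le_div_iff₀ h]
  exact (mul_le_mul_of_nonneg_left h2 hτ₀).trans hl

end ConjugatedSolution

section ConjugatedEstimate

variable {L T κ R c l γ s t y : ℝ} {A : ℕ → ℝ → ℝ} {χ χ1 : ℝ → ℝ} {V D : ℕ → ℝ → ℝ → ℝ}

/-- The clamped or hinged boundary conditions at `y`. -/
def BoundaryCondition (T y : ℝ) (V : ℕ → ℝ → ℝ → ℝ) : Prop :=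
  (∀ t ∈ Ioo 0 T, V 0 t y = 0) ∧ ((∀ t ∈ Ioo 0 T, V 1 t y = 0) ∨ ∀ t ∈ Ioo 0 T, V 2 t y = 0)

lemma BoundaryCondition.conj (hb : BoundaryCondition T y V) (hV : IsJet V D) (ht : t ∈ Ioo 0 T)
    (A : ℕ → ℝ → ℝ) : conjJet l T κ (A 0) V 0 t y = 0 ∧ conjJetT l T κ (A 0) V D 0 t y = 0 ∧
      (conj1 l T κ A V t y = 0 ∧ conj1T l T κ A V D t y = 0 ∨
        conj2 l T κ A V t y = 2 * (timeWeight l T t * A 1 y) * conj1 l T κ A V t y) := by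
  obtain ⟨h0, h⟩ := hb
  have z0 : conjJet l T κ (A 0) V 0 t y = 0 := by simp [conjJet, h0 t ht]
  have zt0 : conjJetT l T κ (A 0) V D 0 t y = 0 := by
    simp [conjJetT, z0, hV.time_eq_zero (by norm_num) h0 ht]
  refine ⟨z0, zt0, h.imp (fun h => ?_) fun h => ?_⟩
  · have z1 : conjJet l T κ (A 0) V 1 t y = 0 := by simp [conjJet, h t ht]
    have zt1 : conjJetT l T κ (A 0) V D 1 t y = 0 := by
      simp [conjJetT, z1, hV.time_eq_zero (by norm_num) h ht]
    simp [conj1, conj1T, jet1, jet1T, z0, z1, zt0, zt1]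
  · have z2 : conjJet l T κ (A 0) V 2 t y = 0 := by simp [conjJet, h t ht]
    simp [conj1, conj2, jet1, jet2, z0, z2, weightCoeff]

theorem AdmissibleWeight.exists_conjugated_estimate (hw : AdmissibleWeight L κ R c A χ χ1)
    (hT : 0 < T) (hL : 0 < L) (hTR : T ^ 3 ≤ R) (γ s : ℝ) :
    ∃ l₀ > (0:ℝ), ∃ C > (0:ℝ), ∀ V D, IsJet V D → BoundaryCondition T 0 V →
      BoundaryCondition T L V → ∀ l ≥ l₀,
      ∫ t in Ioo 0 T, ∫ x in Ioo 0 L, s ^ 2 * (timeWeight l T t * A 0 x)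
        * (conjJet l T κ (A 0) V 3 t x ^ 2
          + s ^ 2 * (timeWeight l T t * A 0 x) ^ 2 * conjJet l T κ (A 0) V 2 t x ^ 2
          + s ^ 4 * (timeWeight l T t * A 0 x) ^ 4 * conjJet l T κ (A 0) V 1 t x ^ 2
          + s ^ 6 * (timeWeight l T t * A 0 x) ^ 6 * conjJet l T κ (A 0) V 0 t x ^ 2) ≤
      C * (∫ t in Ioo 0 T, ∫ x in Ioo 0 L,
        (expWeight l T κ (A 0) t x * (γ * D 0 t x + V 4 t x)) ^ 2)
      + C * (∫ t in Ioo 0 T, ∫ x in Ioo 0 L,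
        χ x * timeWeight l T t * (timeWeight l T t ^ 3 * conjJet l T κ (A 0) V 0 t x) ^ 2) := by
  have hR := hw.one_le_bound
  obtain ⟨k₁, k₂, B, τ₁, c₁, μ, hB, hτ₁, hc₁, hpt⟩ :=
    exists_pointwise_carleman γ hR hw.pos hw.le_one
  obtain ⟨τ₂, hτ₂, hbd⟩ := exists_boundary_sign γ hR hw.pos hw.le_one
  obtain ⟨K, hK, hen⟩ := exists_weighted_energy_bound s hR
  obtain ⟨M, hM⟩ : ∃ M, M = K / c₁ := ⟨_, rfl⟩
  have hM0 : 0 < M := hM ▸ div_pos hK hc₁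
  refine ⟨max 1 (max τ₁ τ₂ * T ^ 2), lt_max_of_lt_left one_pos, M * (2 + B), by positivity,
    fun V D hV hb0 hbL l hl => ?_⟩
  have hl1 : 1 ≤ l := (le_max_left _ _).trans hl
  have hl0 : 0 < l := one_pos.trans_le hl1
  have hτ : ∀ t ∈ Ioo 0 T, max τ₁ τ₂ ≤ timeWeight l T t := fun t ht =>
    le_timeWeight (le_max_of_le_left (zero_le_one.trans hτ₁)) ((le_max_right _ _).trans hl) ht
  obtain ⟨rz, rzt⟩ := hw.rapid_conjJet (T := T) hl0 hV
  obtain ⟨r1, r2, r3, r4, r1t, r2t⟩ := hw.rapid_conj (T := T) hl0 hV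
  have hA : ∀ k ≤ 4, Continuous (A k) := hw.continuous
  have hflux : ∀ y ∈ Icc 0 L, BoundaryCondition T y V → c ≤ |A 1 y| → ∀ t ∈ Ioo 0 T,
      A 1 y * flux γ (weightCoeff l T (A 1) t y) (weightCoeff l T (A 2) t y)
        (weightCoeffT l T (A 1) t y) (conjJet l T κ (A 0) V 0 t y) (conj1 l T κ A V t y)
        (conj2 l T κ A V t y) (conj3 l T κ A V t y) (conjJetT l T κ (A 0) V D 0 t y)
        (conj1T l T κ A V D t y) ≤ 0 := by
    intro y hy hb hc t ht
    obtain ⟨e, he, hte⟩ := exists_timeWeightDeriv_eq hl1 hTR ht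
    obtain ⟨z0, zt0, h⟩ := hb.conj (l := l) (κ := κ) hV ht A
    rw [z0, zt0]
    unfold weightCoeff weightCoeffT
    rw [hte]
    exact hbd _ e _ _ _ _ _ _ ((le_max_right _ _).trans (hτ t ht)) he
      (hw.abs_le 1 (by norm_num) y hy) (hw.abs_le 2 (by norm_num) y hy) hc h
  have h0mem : (0:ℝ) ∈ Icc 0 L := ⟨le_rfl, hL.le⟩
  have hLmem : L ∈ Icc 0 L := ⟨hL.le, le_rfl⟩
  have hleft : 0 < A 1 0 := hw.pos.trans_le hw.left
  have hright : A 1 L < 0 := hw.right.trans_lt (neg_neg_of_pos hw.pos)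
  obtain ⟨rdiv, hdiv⟩ := integral_divergence_nonpos (γ := γ) (k₁ := k₁) (k₂ := k₂) (μ := μ) hT hL
    (moderate_weightCoeff hl0 (hA 1 (by norm_num)))
    (moderate_weightCoeff hl0 (hA 2 (by norm_num)))
    (moderate_weightCoeff hl0 (hA 3 (by norm_num)))
    (moderate_weightCoeffT hl0 (hA 1 (by norm_num)))
    (moderate_weightCoeffT hl0 (hA 2 (by norm_num)))
    (τ := fun t _ => timeWeight l T t) (χ := fun _ x => χ x) (χ1 := fun _ x => χ1 x)
    (moderate_timeWeight hl0) (Moderate.of_continuous_space hw.continuous_cutoff)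
    (Moderate.of_continuous_space hw.continuous_cutoff_deriv)
    (rz 0 (by norm_num)) r1 r2 r3 r4 (rzt 0 (by norm_num)) r1t r2t
    (fun t _ x _ => hw.hasDerivAt_weightCoeff (by norm_num))
    (fun t _ x _ => hw.hasDerivAt_weightCoeff (by norm_num))
    (fun t _ x _ => hw.hasDerivAt_weightCoeffT (by norm_num))
    (fun t _ x _ => hw.hasDerivAt_cutoff x) (fun _ _ _ => rfl)
    (fun t _ x _ => (hw.hasDerivAt_conj hV t x).1)
    (fun t _ x _ => (hw.hasDerivAt_conj hV t x).2.1)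
    (fun t _ x _ => (hw.hasDerivAt_conj hV t x).2.2.1)
    (fun t _ x _ => (hw.hasDerivAt_conj hV t x).2.2.2.1)
    (fun t _ x _ => (hw.hasDerivAt_conj hV t x).2.2.2.2.1)
    (fun t _ x _ => (hw.hasDerivAt_conj hV t x).2.2.2.2.2)
    (fun t ht x _ => hasDerivAt_weightCoeff_time ht (A 1))
    (fun t ht x _ => hasDerivAt_weightCoeff_time ht (A 2))
    (fun t ht x _ => hasDerivAt_conjJet_time hV (by norm_num) ht)
    (fun t ht x _ => (hasDerivAt_conj_time A hV ht x).1)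
    (fun t ht x _ => (hasDerivAt_conj_time A hV ht x).2)
    (fun _ _ => hw.cutoff_left) (fun _ _ => hw.cutoff_right)
    (fun t ht => nonpos_of_mul_nonpos_right
      (hflux 0 h0mem hb0 (hw.left.trans (le_abs_self _)) t ht) hleft)
    (fun t ht => nonneg_of_mul_nonpos_right
      (hflux L hLmem hbL ((le_neg.1 hw.right).trans (neg_le_abs _)) t ht) hright)
  obtain ⟨b, hb, hneg⟩ := hw.exists_neg
  have mτ : Moderate T L fun t _ => timeWeight l T t := moderate_timeWeight hl0
  have mA : Moderate T L fun _ x => A 0 x := Moderate.of_continuous_space (hA 0 (by norm_num))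
  have mχ : Moderate T L fun _ x => χ x := Moderate.of_continuous_space hw.continuous_cutoff
  have rsource : Rapid T L fun t x =>
      (expWeight l T κ (A 0) t x * (γ * D 0 t x + V 4 t x)) ^ 2 :=
    ((rapid_expWeight hl0 (hA 0 (by norm_num)) hb hneg).mul_right
      (((Moderate.const γ).mul (Moderate.of_continuous (hV.continuous_time 0 (by norm_num)))).add
        (Moderate.of_continuous (hV.continuous_space 4 (by norm_num))))).pow two_ne_zero
  have z0 := rz 0 (by norm_num)
  have z1 := rz 1 (by norm_num)
  have z2 := rz 2 (by norm_num)
  have z3 := rz 3 (by norm_num)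
  have robs : Rapid T L fun t x =>
      χ x * timeWeight l T t * (timeWeight l T t ^ 3 * conjJet l T κ (A 0) V 0 t x) ^ 2 :=
    Rapid.mul_left (mχ.mul mτ) ((Rapid.mul_left (mτ.pow 3) z0).pow two_ne_zero)
  have rlhs : Rapid T L fun t x => s ^ 2 * (timeWeight l T t * A 0 x)
        * (conjJet l T κ (A 0) V 3 t x ^ 2
          + s ^ 2 * (timeWeight l T t * A 0 x) ^ 2 * conjJet l T κ (A 0) V 2 t x ^ 2
          + s ^ 4 * (timeWeight l T t * A 0 x) ^ 4 * conjJet l T κ (A 0) V 1 t x ^ 2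
          + s ^ 6 * (timeWeight l T t * A 0 x) ^ 6 * conjJet l T κ (A 0) V 0 t x ^ 2) := by
    repeat' first
      | with_reducible assumption
      | with_reducible apply Moderate.const
      | with_reducible apply Rapid.add
      | with_reducible apply Rapid.mul_left
      | with_reducible refine Rapid.pow ?_ two_ne_zero
      | with_reducible apply Moderate.mul
      | with_reducible apply Moderate.pow
  have rsum := (rsource.const_mul 2).add (robs.const_mul B)
  have hmono := integral_mono_rapid rlhs ((rsum.add rdiv).const_mul M) fun t ht x hx => by
    have hx' := Ioo_subset_Icc_self hx
    obtain ⟨e, he, hte⟩ := exists_timeWeightDeriv_eq hl1 hTR ht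
    have hτt := hτ t ht
    have h1 := hen (timeWeight l T t) (A 0 x) (A 1 x) (A 2 x) (A 3 x)
      (conjJet l T κ (A 0) V 0 t x) (conjJet l T κ (A 0) V 1 t x) (conjJet l T κ (A 0) V 2 t x)
      (conjJet l T κ (A 0) V 3 t x) (hτ₁.trans ((le_max_left _ _).trans hτt))
      (hw.abs_le 0 (by norm_num) x hx') (hw.abs_le 1 (by norm_num) x hx')
      (hw.abs_le 2 (by norm_num) x hx') (hw.abs_le 3 (by norm_num) x hx')
    have hsource := symPart_add_skewPart γ (timeWeight l T t) (A 0 x - κ) e (A 1 x) (A 2 x)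
      (A 3 x) (A 4 x) (conjJet l T κ (A 0) V 0 t x) (conjJet l T κ (A 0) V 1 t x)
      (conjJet l T κ (A 0) V 2 t x) (conjJet l T κ (A 0) V 3 t x) (conjJet l T κ (A 0) V 4 t x)
      (expWeight l T κ (A 0) t x * D 0 t x)
    have hzt : timeWeight l T t ^ 3 * e * (A 0 x - κ) * conjJet l T κ (A 0) V 0 t x
        + expWeight l T κ (A 0) t x * D 0 t x = conjJetT l T κ (A 0) V D 0 t x := by
      unfold conjJetT; rw [hte]
    have hg : γ * (expWeight l T κ (A 0) t x * D 0 t x) + conjJet l T κ (A 0) V 4 t x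
        = expWeight l T κ (A 0) t x * (γ * D 0 t x + V 4 t x) := by
      unfold conjJet; ring
    rw [hzt, hg] at hsource
    have h2 := hpt _ _ e _ _ _ _ (χ x) (χ1 x) _ _ _ (conj3 l T κ A V t x) _ _
      (conj1T l T κ A V D t x) (conj2T l T κ A V D t x) (weightCoeffT l T (A 2) t x) _
      ((le_max_left _ _).trans hτt) (hw.abs_sub_le x hx') he
      (hw.abs_le 1 (by norm_num) x hx') (hw.abs_le 2 (by norm_num) x hx')
      (hw.abs_le 3 (by norm_num) x hx') (hw.abs_le 4 (by norm_num) x hx')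
      (hw.cutoff_nonneg x) (hw.cutoff_le_one x) (hw.abs_cutoff_deriv_le x hx')
      (hw.lower x hx') hsource
    rw [← hte] at h2
    refine h1.trans ?_
    have h3 := mul_le_mul_of_nonneg_left h2 hM0.le
    rw [← mul_assoc M, hM, div_mul_cancel₀ K hc₁.ne', ← hM] at h3
    refine h3.trans_eq ?_
    rw [add_sub_assoc]
    rfl
  refine hmono.trans ?_
  rw [integral_const_mul_rapid, integral_add_rapid rsum rdiv,
    integral_add_rapid (rsource.const_mul 2) (robs.const_mul B), integral_const_mul_rapid,
    integral_const_mul_rapid]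
  have hs : 0 ≤ ∫ t in Ioo 0 T, ∫ x in Ioo 0 L,
      (expWeight l T κ (A 0) t x * (γ * D 0 t x + V 4 t x)) ^ 2 :=
    integral_nonneg fun t => integral_nonneg fun x => sq_nonneg _
  have ho : 0 ≤ ∫ t in Ioo 0 T, ∫ x in Ioo 0 L,
      χ x * timeWeight l T t * (timeWeight l T t ^ 3 * conjJet l T κ (A 0) V 0 t x) ^ 2 :=
    setIntegral_nonneg measurableSet_Ioo fun t ht => integral_nonneg fun x =>
      mul_nonneg (mul_nonneg (hw.cutoff_nonneg x)
        ((zero_le_one.trans (hτ₁.trans (le_max_left _ _))).trans (hτ t ht))) (sq_nonneg _)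
  have h3 := mul_nonneg (mul_pos hM0 hB).le hs
  have h4 := mul_nonneg (mul_pos hM0 two_pos).le ho
  have h5 := mul_nonpos_of_nonneg_of_nonpos hM0.le hdiv
  linear_combination h3 + h4 + h5

end ConjugatedEstimate

section Weight

variable {L : ℝ} {ω₀ ω : Set ℝ} {φh : ℝ → ℝ}

lemma exists_cutoff (hω : IsOpen ω) (hsub : closure ω₀ ⊆ ω) :
    ∃ χ : ℝ → ℝ, ContDiff ℝ 1 χ ∧ (∀ x, 0 ≤ χ x) ∧ (∀ x, χ x ≤ 1) ∧
      (∀ x ∈ ω₀, χ x = 1) ∧ ∀ x ∉ ω, χ x = 0 := by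
  obtain ⟨f, h0, h1, h⟩ := exists_contMDiffMap_zero_one_of_isClosed (n := 1)
    (modelWithCornersSelf ℝ ℝ) hω.isClosed_compl (isClosed_closure (s := ω₀))
    (disjoint_compl_left_iff_subset.2 hsub)
  exact ⟨f, f.contMDiff.contDiff, fun x => (h x).1, fun x => (h x).2,
    fun x hx => h1 (subset_closure hx), fun x hx => h0 hx⟩

/-- A function that is positive inside an interval and vanishes at its left end is
nondecreasing there. -/
lemma deriv_nonneg_left (hL : 0 < L) (hφ : DifferentiableAt ℝ φh 0)
    (hpos : ∀ x ∈ Ioo 0 L, 0 < φh x) (h0 : φh 0 = 0) : 0 ≤ deriv φh 0 := by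
  refine ge_of_tendsto hφ.hasDerivAt.tendsto_slope_zero_right ?_
  filter_upwards [Ioo_mem_nhdsGT hL] with x hx
  simpa [h0] using mul_nonneg (inv_nonneg.2 hx.1.le) (hpos x hx).le

/-- A function that is positive inside an interval and vanishes at its right end is
nonincreasing there. -/
lemma deriv_nonpos_right (hL : 0 < L) (hφ : DifferentiableAt ℝ φh L)
    (hpos : ∀ x ∈ Ioo 0 L, 0 < φh x) (hφL : φh L = 0) : deriv φh L ≤ 0 := by
  have hd : DifferentiableAt ℝ (fun x => φh (L - x)) 0 := by
    refine DifferentiableAt.comp (g := φh) 0 (by simpa using hφ) (by fun_prop)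
  have h := deriv_nonneg_left hL hd
    (fun x hx => hpos _ ⟨by linarith [hx.2], by linarith [hx.1]⟩) (by simpa using hφL)
  rw [deriv_comp_const_sub, sub_zero] at h
  linarith

/-- The exponential of a weight without critical points outside `ω₀` is admissible. -/
lemma exists_admissibleWeight (hL : 0 < L) (hω₀ : IsOpen ω₀) (hω : IsOpen ω)
    (hsub : closure ω₀ ⊆ ω) (hωΩ : ω ⊆ Ioo 0 L) (hφ : ContDiff ℝ 4 φh)
    (hφpos : ∀ x ∈ Ioo (0:ℝ) L, 0 < φh x) (hφ0 : φh 0 = 0) (hφL : φh L = 0)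
    (hφ' : ∀ x ∈ Icc (0:ℝ) L \ ω₀, deriv φh x ≠ 0)
    {K : ℝ} (hK : K = sSup ((fun x => |φh x|) '' Icc (0:ℝ) L)) (B : ℝ) :
    ∃ s₀ ≥ (1:ℝ), ∀ s ≥ s₀, ∃ R c χ χ1, B ≤ R ∧
      AdmissibleWeight L (exp (2 * s * K)) R c
        (fun k => iteratedDeriv k fun x => exp (s * φh x)) χ χ1 ∧ ∀ x ∉ ω, χ x = 0 := by
  obtain ⟨χ, hχ, hχ0, hχ1, hχω₀, hχω⟩ := exists_cutoff hω hsub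
  have hφn : ∀ x ∈ Icc 0 L, 0 ≤ φh x := by
    intro x hx
    rcases eq_or_lt_of_le hx.1 with h | h
    · rw [← h, hφ0]
    rcases eq_or_lt_of_le hx.2 with h' | h'
    · rw [h', hφL]
    exact (hφpos x ⟨h, h'⟩).le
  have hφK : ∀ x ∈ Icc 0 L, φh x ≤ K := by
    intro x hx
    rw [hK]
    exact (le_abs_self _).trans (le_csSup (isCompact_Icc.bddAbove_image
      (hφ.continuous.abs.continuousOn)) ⟨x, hx, rfl⟩)
  have hKpos : 0 < K := (hφpos (L / 2) ⟨by linarith, by linarith⟩).trans_le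
    (hφK _ ⟨by linarith, by linarith⟩)
  have h0ω : (0:ℝ) ∉ ω := fun h => lt_irrefl _ (hωΩ h).1
  have hLω : L ∉ ω := fun h => lt_irrefl _ (hωΩ h).2
  have hω₀ω : ω₀ ⊆ ω := subset_closure.trans hsub
  have hd1 : ContDiff ℝ 3 (deriv φh) :=
    (contDiff_succ_iff_deriv.1 (show ContDiff ℝ (3 + 1) φh from hφ)).2.2
  have hd2 : ContDiff ℝ 2 (deriv (deriv φh)) :=
    (contDiff_succ_iff_deriv.1 (show ContDiff ℝ (2 + 1) (deriv φh) from hd1)).2.2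
  have hdφ : Differentiable ℝ φh := hφ.differentiable (by norm_num)
  have hddφ : Differentiable ℝ (deriv φh) := hd1.differentiable (by norm_num)
  obtain ⟨m, hm, hmle⟩ : ∃ m > 0, ∀ x ∈ Icc 0 L \ ω₀, m ≤ |deriv φh x| := by
    have hc : IsCompact (Icc 0 L \ ω₀) := isCompact_Icc.diff hω₀
    obtain ⟨x, hx, h⟩ := hc.exists_isMinOn ⟨0, left_mem_Icc.2 hL.le, fun h => h0ω (hω₀ω h)⟩
      hd1.continuous.abs.continuousOn
    exact ⟨_, abs_pos.2 (hφ' x hx), fun y hy => h hy⟩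
  obtain ⟨M, hM⟩ := isCompact_Icc.exists_bound_of_continuousOn (s := Icc 0 L)
    hd2.continuous.continuousOn
  have hM0 : 0 ≤ M := (norm_nonneg _).trans (hM 0 (left_mem_Icc.2 hL.le))
  have hleft : m ≤ deriv φh 0 := by
    have h := hmle 0 ⟨left_mem_Icc.2 hL.le, fun h => h0ω (hω₀ω h)⟩
    rwa [abs_of_nonneg (deriv_nonneg_left hL (hdφ 0) hφpos hφ0)] at h
  have hright : deriv φh L ≤ -m := by
    have h := hmle L ⟨right_mem_Icc.2 hL.le, fun h => hLω (hω₀ω h)⟩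
    rw [abs_of_nonpos (deriv_nonpos_right hL (hdφ L) hφpos hφL)] at h
    linarith
  refine ⟨max 1 ((M + 1) / m ^ 2), le_max_left _ _, fun s hs => ?_⟩
  have hs1 : 1 ≤ s := (le_max_left _ _).trans hs
  have hs0 : 0 < s := by linarith
  have hsM : M + 1 ≤ s * m ^ 2 := (div_le_iff₀ (by positivity)).1 ((le_max_right _ _).trans hs)
  have hg : ContDiff ℝ 4 fun x => exp (s * φh x) := (contDiff_const.mul hφ).exp
  have hA1 : deriv (fun x => exp (s * φh x)) = fun x => exp (s * φh x) * (s * deriv φh x) :=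
    funext fun x => ((hdφ x).hasDerivAt.const_mul s).exp.deriv
  have hA2 : deriv (deriv fun x => exp (s * φh x)) = fun x =>
      exp (s * φh x) * (s ^ 2 * deriv φh x ^ 2 + s * deriv (deriv φh) x) := by
    rw [hA1]
    funext x
    refine (((hdφ x).hasDerivAt.const_mul s).exp.mul
      ((hddφ x).hasDerivAt.const_mul s)).deriv.trans ?_
    ring
  have hA2' : (iteratedDeriv 2 fun x => exp (s * φh x)) = _ := iteratedDeriv_succ.trans
    ((congrArg deriv iteratedDeriv_one).trans hA2)
  have hA1' : (iteratedDeriv 1 fun x => exp (s * φh x)) = _ := iteratedDeriv_one.trans hA1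
  have hone : ∀ x ∈ Icc 0 L, 1 ≤ exp (s * φh x) := fun x hx =>
    one_le_exp (mul_nonneg hs0.le (hφn x hx))
  have hcont : ∀ k ≤ 4, Continuous (iteratedDeriv k fun x => exp (s * φh x)) := fun k hk =>
    hg.continuous_iteratedDeriv k (by exact_mod_cast hk)
  have hbdd : ∀ f : ℝ → ℝ, Continuous f → ∃ r, ∀ x ∈ Icc 0 L, |f x| ≤ r := fun f hf =>
    isCompact_Icc.exists_bound_of_continuousOn hf.continuousOn
  have hbddA : ∀ k, ∃ r, k ≤ 4 → ∀ x ∈ Icc 0 L,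
      |iteratedDeriv k (fun x => exp (s * φh x)) x| ≤ r := fun k => by
    by_cases hk : k ≤ 4
    · exact (hbdd _ (hcont k hk)).imp fun r h _ => h
    · exact ⟨0, fun h => absurd h hk⟩
  choose r hr using hbddA
  obtain ⟨q, hq⟩ := hbdd _ (hg.continuous.sub (continuous_const (y := exp (2 * s * K))))
  have hχd := hχ.continuous_deriv le_rfl
  obtain ⟨p, hp⟩ := hbdd _ hχd
  set R := max (max 1 B) (max (max p q) ((Finset.range 5).sup' ⟨0, by simp⟩ r))
  refine ⟨R, min 1 m, χ, deriv χ, ?_, ⟨?_, by positivity, min_le_left _ _, hcont, ?_, ?_, ?_, ?_,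
    ?_, ?_, hχ.continuous, hχd, fun x => (hχ.differentiable one_ne_zero x).hasDerivAt, hχ0, hχ1,
    ?_, hχω 0 h0ω, hχω L hLω, ?_⟩, hχω⟩
  · simp [R]
  · simp [R]
  · intro k hk x
    rw [iteratedDeriv_succ]
    exact ((hg.differentiable_iteratedDeriv k (by exact_mod_cast hk)) x).hasDerivAt
  · intro k hk x hx
    refine (hr k hk x hx).trans ?_
    exact (Finset.le_sup' r (Finset.mem_range.2 (by omega))).trans
      ((le_max_right _ _).trans (le_max_right _ _))
  · intro x hx
    rw [iteratedDeriv_zero]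
    exact (hq x hx).trans (by simp [R])
  · refine ⟨exp (2 * s * K) - exp (s * K), sub_pos.2 (exp_lt_exp.2 (by nlinarith)),
      fun x hx => ?_⟩
    rw [iteratedDeriv_zero]
    have := exp_le_exp.2 (mul_le_mul_of_nonneg_left (hφK x hx) hs0.le)
    linarith
  · simp only [hA1', hφ0, mul_zero, exp_zero, one_mul]
    exact (min_le_right _ _).trans (by nlinarith)
  · simp only [hA1', hφL, mul_zero, exp_zero, one_mul]
    exact le_trans (by nlinarith) (neg_le_neg (min_le_right _ _))
  · exact fun x hx => (hp x hx).trans (by simp [R])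
  · intro x hx
    by_cases hxω : x ∈ ω₀
    · exact Or.inl (hχω₀ x hxω)
    refine Or.inr ?_
    have hmx := hmle x ⟨hx, hxω⟩
    have he := hone x hx
    have hsq : m ^ 2 ≤ deriv φh x ^ 2 := by
      rw [← sq_abs (deriv φh x)]
      exact pow_le_pow_left₀ hm.le hmx 2
    simp only [hA1', hA2']
    constructor
    · have h2 : -M ≤ deriv (deriv φh) x := (abs_le.1 (hM x hx)).1
      have h3 : s ^ 2 * m ^ 2 ≤ s ^ 2 * deriv φh x ^ 2 :=
        mul_le_mul_of_nonneg_left hsq (by positivity)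
      have h4 : 1 ≤ s ^ 2 * deriv φh x ^ 2 + s * deriv (deriv φh) x := by nlinarith
      exact (min_le_left _ _).trans (one_le_mul_of_one_le_of_one_le he h4)
    · rw [abs_mul, abs_mul, abs_of_pos (exp_pos _), abs_of_pos hs0]
      refine (min_le_right _ _).trans (hmx.trans ?_)
      exact (le_mul_of_one_le_left (abs_nonneg _) hs1).trans
        (le_mul_of_one_le_left (by positivity) he)

end Weight

section Localization

variable {T L : ℝ} {u v : ℝ → ℝ → ℝ} {ω : Set ℝ}

lemma integral_le_integral_subset (hu : Rapid T L u) (hv : Rapid T L v) (hω : MeasurableSet ω)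
    (hωΩ : ω ⊆ Ioo 0 L) (h0 : ∀ t ∈ Ioo 0 T, ∀ x ∈ Ioo 0 L \ ω, u t x = 0)
    (h : ∀ t ∈ Ioo 0 T, ∀ x ∈ ω, u t x ≤ v t x) :
    ∫ t in Ioo 0 T, ∫ x in Ioo 0 L, u t x ≤ ∫ t in Ioo 0 T, ∫ x in ω, v t x := by
  have hv' : Integrable (Function.uncurry v)
      ((volume.restrict (Ioo 0 T)).prod (volume.restrict ω)) :=
    hv.integrable_prod.mono_measure
      (Measure.prod_mono le_rfl (Measure.restrict_mono hωΩ le_rfl))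
  refine setIntegral_mono_on hu.integrable_prod.integral_prod_left hv'.integral_prod_left
    measurableSet_Ioo fun t ht => ?_
  have hω' : ω ⊆ Icc 0 L := hωΩ.trans Ioo_subset_Icc_self
  change ∫ x in Ioo 0 L, u t x ≤ ∫ x in ω, v t x
  rw [setIntegral_eq_of_subset_of_forall_sdiff_eq_zero measurableSet_Ioo hωΩ (h0 t ht)]
  exact setIntegral_mono_on ((hu.slice_space ht).integrableOn_Icc.mono_set hω')
    ((hv.slice_space ht).integrableOn_Icc.mono_set hω') hω (h t ht)

end Localization

lemma timeWeight_mul_exp (l s T : ℝ) (g : ℝ → ℝ) (t x : ℝ) :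
    timeWeight l T t * exp (s * g x) = l * wphi s T g t x := by
  unfold timeWeight wphi; ring

lemma expWeight_sq (l s T K : ℝ) (g : ℝ → ℝ) (t x : ℝ) :
    expWeight l T (exp (2 * s * K)) (fun x => exp (s * g x)) t x ^ 2 =
      exp (2 * l * wrho s T K g t x) := by
  unfold expWeight timeWeight wrho
  rw [← exp_nat_mul]
  congr 1
  push_cast
  ring

end CarlemanFourth

open CarlemanFourth

/-- Carleman estimate with singular weight for `γ∂_t + ∂_x⁴` on `Q = (0,T)×(0,L)`. -/
theorem carleman_fourth_order_singular_weight
    (L T γ : ℝ) (hL : 0 < L) (hT : 0 < T)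
    (ω₀ ω : Set ℝ) (hω₀ : IsOpen ω₀) (hω : IsOpen ω) (hne : ω₀.Nonempty)
    (hsub : closure ω₀ ⊆ ω) (hωΩ : ω ⊆ Ioo 0 L)
    (φh : ℝ → ℝ) (hφ : ContDiff ℝ 4 φh) (hφpos : ∀ x ∈ Ioo (0:ℝ) L, 0 < φh x)
    (hφ0 : φh 0 = 0) (hφL : φh L = 0)
    (hφ' : ∀ x ∈ Icc (0:ℝ) L \ ω₀, deriv φh x ≠ 0)
    (K : ℝ) (hK : K = sSup ((fun x => |φh x|) '' Icc (0:ℝ) L)) :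
    ∃ s₀ > (0:ℝ), ∀ s ≥ s₀, ∃ lam₀ > (0:ℝ), ∃ C > (0:ℝ),
      ∀ v f : ℝ → ℝ → ℝ, ContDiff ℝ 4 (Function.uncurry v) →
      (∀ t ∈ Ioo 0 T, ∀ x ∈ Ioo 0 L,
        γ * deriv (fun τ => v τ x) t + iteratedDeriv 4 (v t) x = f t x) →
      IntegrableOn (fun p : ℝ × ℝ => (f p.1 p.2) ^ 2) (Ioo 0 T ×ˢ Ioo 0 L) →
      ((∀ t ∈ Ioo (0:ℝ) T, v t 0 = 0 ∧ v t L = 0 ∧ deriv (v t) 0 = 0 ∧ deriv (v t) L = 0) ∨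
       (∀ t ∈ Ioo (0:ℝ) T, v t 0 = 0 ∧ v t L = 0 ∧
          iteratedDeriv 2 (v t) 0 = 0 ∧ iteratedDeriv 2 (v t) L = 0)) →
      ∀ lam ≥ lam₀,
      (∫ t in Ioo (0:ℝ) T, ∫ x in Ioo (0:ℝ) L,
          lam * s ^ 2 * wphi s T φh t x * exp (2 * lam * wrho s T K φh t x) *
            ((iteratedDeriv 3 (v t) x) ^ 2
              + lam ^ 2 * s ^ 2 * (wphi s T φh t x) ^ 2 * (iteratedDeriv 2 (v t) x) ^ 2
              + lam ^ 4 * s ^ 4 * (wphi s T φh t x) ^ 4 * (deriv (v t) x) ^ 2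
              + lam ^ 6 * s ^ 6 * (wphi s T φh t x) ^ 6 * (v t x) ^ 2))
      ≤ C * (∫ t in Ioo (0:ℝ) T, ∫ x in Ioo (0:ℝ) L,
            exp (2 * lam * wrho s T K φh t x) * (f t x) ^ 2)
        + C * (∫ t in Ioo (0:ℝ) T, ∫ x in ω,
            lam ^ 7 * s ^ 8 * (wphi s T φh t x) ^ 7 *
              exp (2 * lam * wrho s T K φh t x) * (v t x) ^ 2) := by
  obtain ⟨s₀, hs₀, hweight⟩ :=
    exists_admissibleWeight hL hω₀ hω hsub hωΩ hφ hφpos hφ0 hφL hφ' hK (T ^ 3)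
  refine ⟨s₀, one_pos.trans_le hs₀, fun s hs => ?_⟩
  obtain ⟨R, c, χ, χ1, hR, hw, hχ⟩ := hweight s hs
  obtain ⟨l₀, hl₀, C, hC, hest⟩ := hw.exists_conjugated_estimate hT hL hR γ s
  refine ⟨l₀, hl₀, C, hC, fun v f hv hf _ hbc l hl => ?_⟩
  have hl0 : 0 < l := hl₀.trans_le hl
  have hs1 : 1 ≤ s := hs₀.trans hs
  have hV := isJet_of_contDiff hv
  have hb : BoundaryCondition T 0 (fun k t x => iteratedDeriv k (v t) x) ∧
      BoundaryCondition T L (fun k t x => iteratedDeriv k (v t) x) := by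
    simp only [BoundaryCondition, iteratedDeriv_zero, iteratedDeriv_one]
    rcases hbc with h | h
    · exact ⟨⟨fun t ht => (h t ht).1, .inl fun t ht => (h t ht).2.2.1⟩,
        fun t ht => (h t ht).2.1, .inl fun t ht => (h t ht).2.2.2⟩
    · exact ⟨⟨fun t ht => (h t ht).1, .inr fun t ht => (h t ht).2.2.1⟩,
        fun t ht => (h t ht).2.1, .inr fun t ht => (h t ht).2.2.2⟩
  have h := hest _ _ hV hb.1 hb.2 l hl
  have hr := (hw.rapid_conjJet (T := T) hl0 hV).1 0 (by norm_num)
  simp only [iteratedDeriv_zero, timeWeight_mul_exp] at h hr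
  refine le_trans (le_of_eq ?_) (h.trans (add_le_add
    (mul_le_mul_of_nonneg_left (le_of_eq ?_) hC.le) (mul_le_mul_of_nonneg_left ?_ hC.le)))
  · refine setIntegral_congr_fun measurableSet_Ioo fun t _ =>
      setIntegral_congr_fun measurableSet_Ioo fun x _ => ?_
    simp only [← expWeight_sq, conjJet, iteratedDeriv_zero, iteratedDeriv_one]
    ring
  · refine setIntegral_congr_fun measurableSet_Ioo fun t ht =>
      setIntegral_congr_fun measurableSet_Ioo fun x hx => ?_
    simp only [← expWeight_sq, ← hf t ht x hx]
    ring
  · have hα : Continuous fun x => exp (s * φh x) := (continuous_const.mul hφ.continuous).rexp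
    have hτ := moderate_timeWeight (T := T) (L := L) hl0
    have hz := hr.pow two_ne_zero
    have hu := Rapid.mul_left ((Moderate.of_continuous_space hw.continuous_cutoff).mul
      (hτ.pow 7)) hz
    have hv := (Rapid.mul_left ((hτ.mul (Moderate.of_continuous_space hα)).pow 7) hz).const_mul
      (s ^ 8)
    refine le_trans (le_of_eq ?_) ((integral_le_integral_subset hu hv hω.measurableSet hωΩ
      (fun t _ x hx => by simp [hχ x hx.2]) fun t ht x hx => ?_).trans (le_of_eq ?_))
    · refine setIntegral_congr_fun measurableSet_Ioo fun t _ =>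
        setIntegral_congr_fun measurableSet_Ioo fun x _ => ?_
      ring
    · have hτ0 : 0 < timeWeight l T t := div_pos hl0 (mul_pos ht.1 (sub_pos.2 ht.2))
      have hα1 : 1 ≤ exp (s * φh x) :=
        one_le_exp (mul_nonneg (by linarith) (hφpos x (hωΩ hx)).le)
      have h1 : χ x ≤ s ^ 8 * exp (s * φh x) ^ 7 := (hw.cutoff_le_one x).trans
        (one_le_mul_of_one_le_of_one_le (one_le_pow₀ hs1) (one_le_pow₀ hα1))
      refine (mul_assoc _ _ _).trans_le
        ((mul_le_mul_of_nonneg_right h1 (by positivity)).trans_eq ?_)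
      ring
    · refine setIntegral_congr_fun measurableSet_Ioo fun t _ =>
        setIntegral_congr_fun hω.measurableSet fun x _ => ?_
      simp only [timeWeight_mul_exp, ← expWeight_sq, conjJet, iteratedDeriv_zero]
      ring
end

section
/- For every sufficiently smooth function v on Q and every λ > 0, the pointwise identity θ(γ∂_t v + ∂_x⁴ v) = I₁ + I₂ + I₃ + I₄ holds on Q, where w = θ v, I₁ = γ w_t − 4λμ w_{xxx} − 4λ³μ³ w_x − 12λ³μ² w, I₂ = w_{xxxx} + 6λ²μ² w_{xx} + λ⁴μ⁴ w + 12λ² w, I₃ = −12λ w_{xx} + 24λ²μ w_x, and I₄ = −γ ℓ_t w. -/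
open Real Set

/-- Differentiating a product with the Gaussian weight `exp (r ((y - x₀)² - c))`. -/
lemma hasDerivAt_exp_sq_mul {r x₀ c x g' : ℝ} {g : ℝ → ℝ} (hg : HasDerivAt g g' x) :
    HasDerivAt (fun y => exp (r * ((y - x₀) ^ 2 - c)) * g y)
      (exp (r * ((x - x₀) ^ 2 - c)) * (g' + r * (2 * (x - x₀)) * g x)) x := by
  have h := ((((((hasDerivAt_id x).sub_const x₀).pow 2).sub_const c).const_mul r).exp).mul hg
  refine h.congr_deriv ?_
  simp only [id, Pi.pow_apply]
  ring

/-- The first four derivatives of a smooth function times the weight `exp (r ((y - x₀)² - c))`. -/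
lemma iteratedDeriv_exp_sq_mul (r x₀ c : ℝ) {f : ℝ → ℝ} (hf : ContDiff ℝ (⊤ : ℕ∞) f) (x : ℝ) :
    let a : ℝ := r * (2 * (x - x₀))
    let E : ℝ → ℝ := fun y => exp (r * ((y - x₀) ^ 2 - c))
    deriv (fun y => E y * f y) x = E x * (deriv f x + a * f x) ∧
    iteratedDeriv 2 (fun y => E y * f y) x =
      E x * (iteratedDeriv 2 f x + 2 * a * deriv f x + (a ^ 2 + 2 * r) * f x) ∧
    iteratedDeriv 3 (fun y => E y * f y) x =
      E x * (iteratedDeriv 3 f x + 3 * a * iteratedDeriv 2 f x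
        + (3 * a ^ 2 + 6 * r) * deriv f x + (a ^ 3 + 6 * a * r) * f x) ∧
    iteratedDeriv 4 (fun y => E y * f y) x =
      E x * (iteratedDeriv 4 f x + 4 * a * iteratedDeriv 3 f x
        + (6 * a ^ 2 + 12 * r) * iteratedDeriv 2 f x + (4 * a ^ 3 + 24 * a * r) * deriv f x
        + (a ^ 4 + 12 * a ^ 2 * r + 12 * r ^ 2) * f x) := by
  intro a E
  have hd (n : ℕ) (y : ℝ) : HasDerivAt (iteratedDeriv n f) (iteratedDeriv (n + 1) f y) y := by
    rw [iteratedDeriv_succ]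
    exact (hf.differentiable_iteratedDeriv n (by exact_mod_cast WithTop.coe_lt_top n) y).hasDerivAt
  have hd0 (y : ℝ) : HasDerivAt f (deriv f y) y := by
    simpa only [iteratedDeriv_zero, zero_add, iteratedDeriv_one] using hd 0 y
  have hd1 (y : ℝ) : HasDerivAt (deriv f) (iteratedDeriv 2 f y) y := by
    simpa only [iteratedDeriv_one] using hd 1 y
  have hd2 := hd 2
  have hd3 := hd 3
  have ha (y : ℝ) : HasDerivAt (fun y => r * (2 * (y - x₀))) (2 * r) y := by
    refine ((((hasDerivAt_id y).sub_const x₀).const_mul 2).const_mul r).congr_deriv ?_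
    ring
  have h1 : deriv (fun y => E y * f y) =
      fun y => E y * (deriv f y + r * (2 * (y - x₀)) * f y) :=
    funext fun y => (hasDerivAt_exp_sq_mul (hd0 y)).deriv
  have h2 : iteratedDeriv 2 (fun y => E y * f y) =
      fun y => E y * (iteratedDeriv 2 f y + 2 * (r * (2 * (y - x₀))) * deriv f y
        + ((r * (2 * (y - x₀))) ^ 2 + 2 * r) * f y) := by
    rw [iteratedDeriv_succ, iteratedDeriv_one, h1]
    funext y
    refine (hasDerivAt_exp_sq_mul ((hd1 y).add ((ha y).mul (hd0 y)))).deriv.trans ?_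
    simp only [E, Pi.add_apply, Pi.mul_apply]
    ring
  have h3 : iteratedDeriv 3 (fun y => E y * f y) =
      fun y => E y * (iteratedDeriv 3 f y + 3 * (r * (2 * (y - x₀))) * iteratedDeriv 2 f y
        + (3 * (r * (2 * (y - x₀))) ^ 2 + 6 * r) * deriv f y
        + ((r * (2 * (y - x₀))) ^ 3 + 6 * (r * (2 * (y - x₀))) * r) * f y) := by
    rw [iteratedDeriv_succ, h2]
    funext y
    refine (hasDerivAt_exp_sq_mul (((hd2 y).add (((ha y).const_mul 2).mul (hd1 y))).add
      ((((ha y).pow 2).add_const (2 * r)).mul (hd0 y)))).deriv.trans ?_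
    simp only [E, Pi.add_apply, Pi.mul_apply, Pi.pow_apply]
    ring
  refine ⟨congrFun h1 x, congrFun h2 x, congrFun h3 x, ?_⟩
  rw [iteratedDeriv_succ, h3]
  refine (hasDerivAt_exp_sq_mul ((((hd3 x).add (((ha x).const_mul 3).mul (hd2 x))).add
    (((((ha x).pow 2).const_mul 3).add_const (6 * r)).mul (hd1 x))).add
    ((((ha x).pow 3).add (((ha x).const_mul 6).mul_const r)).mul (hd0 x)))).deriv.trans ?_
  simp only [E, a, Pi.add_apply, Pi.mul_apply, Pi.pow_apply]
  ring

/-- Pointwise decomposition `θ(γ∂_t v + ∂_x⁴ v) = I₁ + I₂ + I₃ + I₄` on `Q`,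
with `ψ(t,x) = (x-x₀)² - β(t-t₀)²`, `μ(x) = 2(x-x₀)`, `ℓ = λψ`, `θ = e^ℓ`, `w = θv`. -/
theorem pointwise_decomposition_fourth_order
    (L T γ x₀ t₀ β lam : ℝ) (hL : 0 < L) (hT : 0 < T) (hx₀ : L < x₀)
    (ht₀ : t₀ ∈ Ioo 0 T) (hβ : 0 < β) (hlam : 0 < lam)
    (v : ℝ → ℝ → ℝ) (hv : ContDiff ℝ (⊤ : ℕ∞) (Function.uncurry v)) :
    ∀ t ∈ Ioo (0:ℝ) T, ∀ x ∈ Ioo (0:ℝ) L,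
      let ψ : ℝ → ℝ → ℝ := fun t' x' => (x' - x₀) ^ 2 - β * (t' - t₀) ^ 2;
      let μ : ℝ → ℝ := fun x' => 2 * (x' - x₀);
      let θ : ℝ → ℝ → ℝ := fun t' x' => exp (lam * ψ t' x');
      let w : ℝ → ℝ → ℝ := fun t' x' => θ t' x' * v t' x';
      θ t x * (γ * deriv (fun τ => v τ x) t + iteratedDeriv 4 (v t) x) =
        (γ * deriv (fun τ => w τ x) t - 4 * lam * μ x * iteratedDeriv 3 (w t) x
            - 4 * lam ^ 3 * μ x ^ 3 * deriv (w t) x - 12 * lam ^ 3 * μ x ^ 2 * w t x)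
        + (iteratedDeriv 4 (w t) x + 6 * lam ^ 2 * μ x ^ 2 * iteratedDeriv 2 (w t) x
            + lam ^ 4 * μ x ^ 4 * w t x + 12 * lam ^ 2 * w t x)
        + (-12 * lam * iteratedDeriv 2 (w t) x + 24 * lam ^ 2 * μ x * deriv (w t) x)
        + (-γ * deriv (fun τ => lam * ψ τ x) t * w t x) := by
  intro t _ x _ ψ μ θ w
  have hvx : ContDiff ℝ (⊤ : ℕ∞) (v t) := hv.comp (contDiff_const.prodMk contDiff_id)
  have hvt : ContDiff ℝ (⊤ : ℕ∞) (fun τ => v τ x) := hv.comp (contDiff_id.prodMk contDiff_const)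
  have hvd : HasDerivAt (fun τ => v τ x) (deriv (fun τ => v τ x) t) t :=
    (hvt.differentiable (by simp) t).hasDerivAt
  have hψ : DifferentiableAt ℝ (fun τ => lam * ψ τ x) t := by fun_prop
  have hw : deriv (fun τ => w τ x) t =
      θ t x * (deriv (fun τ => lam * ψ τ x) t * v t x + deriv (fun τ => v τ x) t) := by
    refine (hψ.hasDerivAt.exp.mul hvd).deriv.trans ?_
    simp only [θ]
    ring
  obtain ⟨h1, h2, h3, h4⟩ := iteratedDeriv_exp_sq_mul lam x₀ (β * (t - t₀) ^ 2) hvx x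
  change deriv (w t) x = θ t x * _ at h1
  change iteratedDeriv 2 (w t) x = θ t x * _ at h2
  change iteratedDeriv 3 (w t) x = θ t x * _ at h3
  change iteratedDeriv 4 (w t) x = θ t x * _ at h4
  have hwv : w t x = θ t x * v t x := rfl
  rw [hw, h1, h2, h3, h4, hwv]
  simp only [μ]
  ring
end
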